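/- Assume GRH(q), and let ℓ be a tuple of nonnegative integers indexed by the Dirichlet characters modulo q with |ℓ| = k. Then for every ε > 0, ∫_T^{2T} |𝓛^ℓ(1/2+it)|² dt ≪_{q,k,ε} T(log T)^{λ(ℓ)+ε} for all sufficiently large T. In particular, if ℓ ≠ k·δ^χ for every Dirichlet character χ modulo q (where δ^χ is the tuple with entry 1 at χ and 0 elsewhere), then ∫_T^{2T} |𝓛^ℓ(1/2+it)|² dt ≪_{q,k,ε} T(log T)^{k²−1+ε}. -/

import Mathlib

open Complex Filter MeasureTheory Finset HurwitzZeta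
open scoped ArithmeticFunction Real Classical

noncomputable section

/-- The finite set of primes `p ≤ X`. -/
def primesUpTo (X : ℝ) : Finset ℕ :=
  (Finset.range (Nat.floor X + 1)).filter (fun p => p.Prime ∧ (p : ℝ) ≤ X)

/-- The finite set of naturals `n ≤ X`. -/
def natsUpTo (X : ℝ) : Finset ℕ :=
  (Finset.range (Nat.floor X + 1)).filter (fun n => (n : ℝ) ≤ X)

/-- Truncated Euler product `P_X(s,χ)`, defined via the primitive character `χ*` inducing `χ`:
`P_X(s,χ) = ∏_{p ∣ q} (1 - χ*(p) p^{-s}) · exp(∑_{n ≤ X} χ*(n) Λ(n) / (n^s log n))`. -/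
def PX {q : ℕ} (X : ℝ) (χ : DirichletCharacter ℂ q) (s : ℂ) : ℂ :=
  (∏ p ∈ q.primeFactors, (1 - χ.primitiveCharacter ((p : ℕ) : ZMod χ.conductor) * (p : ℂ) ^ (-s))) *
    Complex.exp (∑ n ∈ natsUpTo X,
      χ.primitiveCharacter ((n : ℕ) : ZMod χ.conductor) * (Λ n : ℂ) / ((n : ℂ) ^ s * (Real.log n : ℂ)))

/-- `𝓟_X^ℓ(s) = ∏_χ P_X(s,χ)^{ℓ_χ}`. -/
def PXl {q : ℕ} (X : ℝ) (ℓ : DirichletCharacter ℂ q → ℕ) (s : ℂ) : ℂ :=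
  ∏ χ : DirichletCharacter ℂ q, (PX X χ s) ^ (ℓ χ)

/-- A Dirichlet character as an arithmetic function. -/
def chiArith {q : ℕ} (χ : DirichletCharacter ℂ q) : ArithmeticFunction ℂ :=
  ⟨fun n => if n = 0 then 0 else χ ((n : ℕ) : ZMod q), by simp⟩

/-- `d_ℓ`, the coefficients of the Dirichlet series of `𝓛^ℓ(s) = ∏_χ L(s,χ)^{ℓ_χ}`,
i.e. the Dirichlet convolution product `∏_χ χ^{*ℓ_χ}`. -/
def dcoef {q : ℕ} (ℓ : DirichletCharacter ℂ q → ℕ) : ArithmeticFunction ℂ :=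
  ∏ χ : DirichletCharacter ℂ q, (chiArith χ) ^ (ℓ χ)

/-- `P*_X(s,χ) = ∏_{p ≤ X}(1 − χ(p)p^{−s})^{−1} · ∏_{√X < p ≤ X}(1 + χ(p)²/(2p^{2s}))^{−1}`. -/
def PstarX {q : ℕ} (X : ℝ) (χ : DirichletCharacter ℂ q) (s : ℂ) : ℂ :=
  ((primesUpTo X).prod (fun p : ℕ => (1 - χ ((p : ℕ) : ZMod q) * (p : ℂ) ^ (-s))⁻¹)) *
    ((primesUpTo X).filter (fun p : ℕ => Real.sqrt X < (p : ℝ))).prod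
      (fun p : ℕ => (1 + χ ((p : ℕ) : ZMod q) ^ 2 / (2 * (p : ℂ) ^ (2 * s)))⁻¹)

/-- `𝓟*_X^ℓ(s) = ∏_χ P*_X(s,χ)^{ℓ_χ}`. -/
def PstarXl {q : ℕ} (X : ℝ) (ℓ : DirichletCharacter ℂ q → ℕ) (s : ℂ) : ℂ :=
  ∏ χ : DirichletCharacter ℂ q, (PstarX X χ s) ^ (ℓ χ)

/-- `Q_X(s,χ) = ∏_{p ≤ √X}(1 − χ(p)p^{−s}) · ∏_{√X < p ≤ X}(1 − χ(p)p^{−s} + χ(p)²/(2p^{2s}))`. -/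
def QX {q : ℕ} (X : ℝ) (χ : DirichletCharacter ℂ q) (s : ℂ) : ℂ :=
  (((primesUpTo X).filter (fun p : ℕ => (p : ℝ) ≤ Real.sqrt X)).prod
      (fun p : ℕ => 1 - χ ((p : ℕ) : ZMod q) * (p : ℂ) ^ (-s))) *
    ((primesUpTo X).filter (fun p : ℕ => Real.sqrt X < (p : ℝ))).prod
      (fun p : ℕ => 1 - χ ((p : ℕ) : ZMod q) * (p : ℂ) ^ (-s)
        + χ ((p : ℕ) : ZMod q) ^ 2 / (2 * (p : ℂ) ^ (2 * s)))

/-- `𝓠_X^ℓ(s) = ∏_χ Q_X(s,χ)^{ℓ_χ}`. -/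
def QXl {q : ℕ} (X : ℝ) (ℓ : DirichletCharacter ℂ q → ℕ) (s : ℂ) : ℂ :=
  ∏ χ : DirichletCharacter ℂ q, (QX X χ s) ^ (ℓ χ)

/-- `𝓛^ℓ(s) = ∏_χ L(s,χ)^{ℓ_χ}`. -/
def Ll {q : ℕ} [NeZero q] (ℓ : DirichletCharacter ℂ q → ℕ) (s : ℂ) : ℂ :=
  ∏ χ : DirichletCharacter ℂ q, (DirichletCharacter.LFunction χ s) ^ (ℓ χ)

/-- GRH for the Dirichlet L-functions modulo `q`: every zero `ρ` of `L(s,χ)` with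
`0 < Re ρ < 1` satisfies `Re ρ = 1/2`. -/
def GRHmod (q : ℕ) [NeZero q] : Prop :=
  ∀ χ : DirichletCharacter ℂ q, ∀ ρ : ℂ,
    DirichletCharacter.LFunction χ ρ = 0 → 0 < ρ.re → ρ.re < 1 → ρ.re = 1 / 2

end

noncomputable section

/-- The entire function `sinh w / w`. -/
def sinhc : ℂ → ℂ := dslope Complex.sinh 0

/-- The entire function `(sinh w / w)² - ((sinh w / w)')²`, of exponential type `2`. -/
def bandKernel (w : ℂ) : ℂ := sinhc w ^ 2 - deriv sinhc w ^ 2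

/-- The restriction of `bandKernel` to the imaginary axis. -/
def axisKernel (r : ℝ) : ℝ := (bandKernel (Complex.I * r)).re

/-- The radial density `-axisKernel'`. -/
def radialDensity (r : ℝ) : ℝ := 4 * (Real.sin r - r * Real.cos r) ^ 2 / r ^ 5

/-- The mean of `g` over the right half of the circle of radius `r` about `0`. -/
def halfMean (g : ℂ → ℂ) (r : ℝ) : ℂ :=
  (1 / Real.pi : ℂ) * ∫ θ in (-(Real.pi / 2))..(Real.pi / 2), g (r * Complex.exp (θ * Complex.I))

lemma differentiable_sinhc : Differentiable ℂ sinhc := by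
  rw [← differentiableOn_univ]
  exact (Complex.differentiableOn_dslope (c := 0) (by simp)).2
    Complex.differentiable_sinh.differentiableOn

lemma differentiable_bandKernel : Differentiable ℂ bandKernel := by
  have h := differentiable_sinhc
  have h2 : Differentiable ℂ (deriv sinhc) := by
    rw [← differentiableOn_univ] at h ⊢
    exact h.deriv isOpen_univ
  exact (h.pow 2).sub (h2.pow 2)

lemma sinhc_of_ne {w : ℂ} (hw : w ≠ 0) : sinhc w = Complex.sinh w / w := by
  rw [sinhc, dslope_of_ne _ hw, slope_def_field]; simp

lemma sinhc_neg (w : ℂ) : sinhc (-w) = sinhc w := by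
  by_cases hw : w = 0
  · simp [hw]
  · rw [sinhc_of_ne hw, sinhc_of_ne (neg_ne_zero.2 hw), Complex.sinh_neg]; simp

lemma deriv_sinhc_of_ne {w : ℂ} (hw : w ≠ 0) :
    deriv sinhc w = (w * Complex.cosh w - Complex.sinh w) / w ^ 2 := by
  have h1 : sinhc =ᶠ[nhds w] fun z => Complex.sinh z / z := by
    filter_upwards [isOpen_ne.mem_nhds hw] with z hz using sinhc_of_ne hz
  rw [h1.deriv_eq]
  have := (Complex.hasDerivAt_sinh w).div (hasDerivAt_id w) hw
  rw [HasDerivAt.deriv (f := fun z => Complex.sinh z / z) this]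
  simp [mul_comm]

lemma deriv_sinhc_zero : deriv sinhc 0 = 0 := by
  have h1 : HasDerivAt sinhc (deriv sinhc 0) (-0) := by
    simpa using (differentiable_sinhc 0).hasDerivAt
  have h2 := h1.comp (0 : ℂ) (hasDerivAt_neg (0 : ℂ))
  have h3 : sinhc ∘ Neg.neg = sinhc := by ext w; exact sinhc_neg w
  have h4 : HasDerivAt sinhc (deriv sinhc 0 * -1) 0 := by simpa only [h3] using h2
  have h5 := h4.unique (differentiable_sinhc 0).hasDerivAt
  have h6 : (2 : ℂ) * deriv sinhc 0 = 0 := by linear_combination -h5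
  simpa using h6

lemma bandKernel_zero : bandKernel 0 = 1 := by
  have h1 : sinhc 0 = 1 := by simp [sinhc, dslope_same, Complex.deriv_sinh]
  simp [bandKernel, deriv_sinhc_zero, h1]

lemma bandKernel_of_ne {w : ℂ} (hw : w ≠ 0) : bandKernel w =
    (2 * w * Complex.sinh w * Complex.cosh w - w ^ 2 - Complex.sinh w ^ 2) / w ^ 4 := by
  rw [bandKernel, sinhc_of_ne hw, deriv_sinhc_of_ne hw]
  have := Complex.cosh_sq w
  field_simp
  linear_combination (-w^2) * this

lemma norm_sinh_le {w : ℂ} (hw : 0 ≤ w.re) : ‖Complex.sinh w‖ ≤ Real.exp w.re := by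
  rw [Complex.sinh, norm_div]
  have h1 := norm_sub_le (Complex.exp w) (Complex.exp (-w))
  rw [Complex.norm_exp, Complex.norm_exp, Complex.neg_re] at h1
  have : Real.exp (-w.re) ≤ Real.exp w.re := Real.exp_le_exp.2 (by linarith)
  simp only [Complex.norm_ofNat]
  linarith

lemma norm_cosh_le {w : ℂ} (hw : 0 ≤ w.re) : ‖Complex.cosh w‖ ≤ Real.exp w.re := by
  rw [Complex.cosh, norm_div]
  have h1 := norm_add_le (Complex.exp w) (Complex.exp (-w))
  rw [Complex.norm_exp, Complex.norm_exp, Complex.neg_re] at h1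
  have : Real.exp (-w.re) ≤ Real.exp w.re := Real.exp_le_exp.2 (by linarith)
  simp only [Complex.norm_ofNat]
  linarith

lemma norm_bandKernel_le {w : ℂ} (hw : 0 ≤ w.re) (h1 : 1 ≤ ‖w‖) :
    ‖bandKernel w‖ ≤ 4 * Real.exp (2 * w.re) / ‖w‖ ^ 2 := by
  have hw0 : w ≠ 0 := by rintro rfl; simp at h1; linarith
  have hs := norm_sinh_le hw
  have hc := norm_cosh_le hw
  set E := Real.exp w.re with hE
  have hE1 : 1 ≤ E := Real.one_le_exp hw
  have hE2 : Real.exp (2 * w.re) = E ^ 2 := by rw [hE, ← Real.exp_nat_mul]; simp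
  rw [bandKernel_of_ne hw0, norm_div, norm_pow, hE2, div_le_div_iff₀ (by positivity) (by positivity)]
  have h2 : ‖2 * w * Complex.sinh w * Complex.cosh w - w ^ 2 - Complex.sinh w ^ 2‖ ≤
      2 * ‖w‖ * E * E + ‖w‖ ^ 2 + E ^ 2 := by
    refine (norm_sub_le _ _).trans (add_le_add ((norm_sub_le _ _).trans (add_le_add ?_ ?_)) ?_)
    · simp only [norm_mul, Complex.norm_ofNat]; gcongr
    · simp
    · rw [norm_pow]; gcongr
  have h3 : 2 * ‖w‖ * E * E + ‖w‖ ^ 2 + E ^ 2 ≤ 4 * E ^ 2 * ‖w‖ ^ 2 := by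
    have : 0 ≤ E ^ 2 * (‖w‖ * (‖w‖ - 1)) := by
      apply mul_nonneg (by positivity) (mul_nonneg (by positivity) (by linarith))
    have : 0 ≤ (E ^ 2 - 1) * ‖w‖ ^ 2 := mul_nonneg (by nlinarith) (by positivity)
    have : 0 ≤ E ^ 2 * (‖w‖ ^ 2 - 1) := mul_nonneg (by positivity) (by nlinarith)
    nlinarith
  calc _ ≤ (4 * E ^ 2 * ‖w‖ ^ 2) * ‖w‖ ^ 2 := by gcongr; exact h2.trans h3
    _ = _ := by ring

lemma bandKernel_neg (w : ℂ) : bandKernel (-w) = bandKernel w := by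
  by_cases hw : w = 0
  · simp [hw]
  · rw [bandKernel_of_ne hw, bandKernel_of_ne (neg_ne_zero.2 hw), Complex.sinh_neg, Complex.cosh_neg]
    ring_nf

lemma bandKernel_I_mul {r : ℝ} (hr : r ≠ 0) : bandKernel (Complex.I * r) =
    (((r ^ 2 + Real.sin r ^ 2 - 2 * r * Real.sin r * Real.cos r) / r ^ 4 : ℝ) : ℂ) := by
  have h0 : Complex.I * r ≠ 0 := by simp [hr]
  rw [bandKernel_of_ne h0, mul_comm Complex.I, Complex.sinh_mul_I, Complex.cosh_mul_I]
  push_cast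
  have hI : Complex.I ^ 2 = -1 := Complex.I_sq
  have hI4 : Complex.I ^ 4 = 1 := Complex.I_pow_four
  rw [mul_pow (r : ℂ) Complex.I 4, hI4, mul_one]
  congr 1
  linear_combination (2 * (r : ℂ) * Complex.sin r * Complex.cos r - r ^ 2 - Complex.sin r ^ 2) * hI

lemma axisKernel_of_ne {r : ℝ} (hr : r ≠ 0) : axisKernel r =
    (r ^ 2 + Real.sin r ^ 2 - 2 * r * Real.sin r * Real.cos r) / r ^ 4 := by
  rw [axisKernel, bandKernel_I_mul hr, Complex.ofReal_re]

lemma bandKernel_I (r : ℝ) : bandKernel (Complex.I * r) = (axisKernel r : ℂ) := by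
  by_cases hr : r = 0
  · simp [hr, axisKernel, bandKernel_zero]
  · rw [axisKernel_of_ne hr, bandKernel_I_mul hr]

lemma axisKernel_zero : axisKernel 0 = 1 := by simp [axisKernel, bandKernel_zero]

lemma continuous_axisKernel : Continuous axisKernel := by
  exact Complex.continuous_re.comp (differentiable_bandKernel.continuous.comp
    (by fun_prop : Continuous fun r : ℝ => Complex.I * (r : ℂ)))

lemma hasDerivAt_axisKernel {r : ℝ} (hr : 0 < r) :
    HasDerivAt axisKernel (-radialDensity r) r := by
  have h1 : axisKernel =ᶠ[nhds r]
      fun r => (r ^ 2 + Real.sin r ^ 2 - 2 * r * Real.sin r * Real.cos r) / r ^ 4 := by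
    filter_upwards [lt_mem_nhds hr] with z hz using axisKernel_of_ne hz.ne'
  refine HasDerivAt.congr_of_eventuallyEq ?_ h1
  have hs := Real.hasDerivAt_sin r
  have hc := Real.hasDerivAt_cos r
  have := ((((hasDerivAt_id r).pow 2).add (hs.pow 2)).sub
    ((((hasDerivAt_id r).const_mul 2).mul hs).mul hc)).div ((hasDerivAt_id r).pow 4) (by simp [hr.ne'])
  refine this.congr_deriv ?_
  simp only [radialDensity, id, Pi.pow_apply, Pi.mul_apply, Pi.add_apply, Pi.sub_apply]
  have h2 := Real.sin_sq_add_cos_sq r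
  have h3 : Real.cos r ^ 2 = 1 - Real.sin r ^ 2 := by linarith
  field_simp
  ring_nf
  simp only [h3]
  ring

lemma radialDensity_nonneg {r : ℝ} (hr : 0 ≤ r) : 0 ≤ radialDensity r := by
  unfold radialDensity; positivity

lemma radialDensity_le {r : ℝ} (hr : 0 < r) : radialDensity r ≤ 128 / (1 + r) ^ 3 := by
  rw [radialDensity, div_le_div_iff₀ (by positivity) (by positivity)]
  rcases le_total r 1 with h | h
  · have h1 : |Real.sin r - r * Real.cos r| ≤ r ^ 3 / 2 := by
      have a1 := Real.sin_le hr.le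
      have a2 := Real.one_sub_sq_div_two_le_cos (x := r)
      have a3 := Real.sin_gt_sub_cube hr
      have a4 := Real.cos_le_one r
      have a5 : 0 < r ^ 3 := by positivity
      rw [abs_le]; constructor
      · nlinarith
      · nlinarith
    have h2 : (Real.sin r - r * Real.cos r) ^ 2 ≤ (r ^ 3 / 2) ^ 2 := by
      rw [← sq_abs]; gcongr
    calc _ ≤ 4 * (r ^ 3 / 2) ^ 2 * (1 + 1) ^ 3 := by gcongr
      _ = 8 * r * r ^ 5 := by ring
      _ ≤ _ := by gcongr; linarith
  · have h1 : |Real.sin r - r * Real.cos r| ≤ 2 * r := by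
      have a1 := Real.abs_sin_le_one r
      have a2 := Real.abs_cos_le_one r
      calc _ ≤ |Real.sin r| + |r * Real.cos r| := abs_sub _ _
        _ ≤ 1 + r * 1 := by rw [abs_mul, abs_of_pos hr]; gcongr
        _ ≤ _ := by linarith
    have h2 : (Real.sin r - r * Real.cos r) ^ 2 ≤ (2 * r) ^ 2 := by
      rw [← sq_abs]; gcongr
    calc _ ≤ 4 * (2 * r) ^ 2 * (r + r) ^ 3 := by gcongr
      _ = _ := by ring

lemma abs_axisKernel_le {r : ℝ} (hr : 1 ≤ r) : |axisKernel r| ≤ 4 / r ^ 2 := by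
  have h := norm_bandKernel_le (w := Complex.I * r) (by simp) (by simp [abs_of_nonneg (zero_le_one.trans hr), hr])
  rw [bandKernel_I] at h
  simpa [abs_of_nonneg (zero_le_one.trans hr)] using h

lemma tendsto_axisKernel : Tendsto axisKernel atTop (nhds 0) := by
  rw [tendsto_zero_iff_abs_tendsto_zero]
  refine squeeze_zero' (g := fun r : ℝ => 4 / r ^ 2) (by simp) ?_ ?_
  · filter_upwards [eventually_ge_atTop 1] with r hr using abs_axisKernel_le hr
  · exact Tendsto.const_div_atTop (tendsto_pow_atTop (by norm_num)) 4

lemma integrableOn_radialDensity : IntegrableOn radialDensity (Set.Ioi 0) := by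
  have := integrableOn_Ioi_deriv_of_nonpos (a := 0) (g := axisKernel) (g' := fun r => -radialDensity r)
    continuous_axisKernel.continuousWithinAt (fun x hx => hasDerivAt_axisKernel hx)
    (fun x hx => by simpa using radialDensity_nonneg (le_of_lt hx)) tendsto_axisKernel
  simpa using this.neg

lemma integral_radialDensity : ∫ r in Set.Ioi 0, radialDensity r = 1 := by
  have := integral_Ioi_of_hasDerivAt_of_nonpos (a := 0) (g := axisKernel)
    (g' := fun r => -radialDensity r)
    continuous_axisKernel.continuousWithinAt (fun x hx => hasDerivAt_axisKernel hx)
    (fun x hx => by simpa using radialDensity_nonneg (le_of_lt hx)) tendsto_axisKernel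
  rw [integral_neg, axisKernel_zero] at this
  linarith

lemma continuousOn_radialDensity : ContinuousOn radialDensity (Set.Ioi 0) := by
  unfold radialDensity
  refine ContinuousOn.div (by fun_prop) (by fun_prop) (fun x hx => by
    have : (0:ℝ) < x := hx
    positivity)

end

noncomputable section

lemma halfMean_eq {g : ℂ → ℂ} {δ : ℝ} (hδ : 0 < δ) (hg : DifferentiableOn ℂ g {w | -δ < w.re})
    {r : ℝ} (hr : 0 ≤ r) : halfMean g r = g 0 + (1 / Real.pi : ℂ) *
      ∫ v in (0 : ℝ)..r, (dslope g 0 (Complex.I * v) + dslope g 0 (-(Complex.I * v))) := by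
  have hU : IsOpen {w : ℂ | -δ < w.re} := isOpen_lt continuous_const Complex.continuous_re
  have hE : DifferentiableOn ℂ (dslope g 0) {w | -δ < w.re} :=
    (Complex.differentiableOn_dslope (hU.mem_nhds (by simpa using hδ))).2 hg
  set M : ℝ := r ^ 2 / δ + 1 with hM
  have hM0 : 0 < M := by positivity
  have hMδ : M * δ ≥ r ^ 2 := by rw [hM]; field_simp; nlinarith
  have hball : Metric.ball (M : ℂ) (M + δ) ⊆ {w : ℂ | -δ < w.re} := by
    intro w hw
    rw [mem_ball_iff_norm] at hw
    have := (abs_le.1 (Complex.abs_re_le_norm (w - M))).1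
    simp at this ⊢
    linarith
  have hmem : ∀ w : ℂ, 0 ≤ w.re → ‖w‖ ≤ r → w ∈ Metric.ball (M : ℂ) (M + δ) := by
    intro w h0 h1
    rw [mem_ball_iff_norm]
    refine lt_of_pow_lt_pow_left₀ 2 (by positivity) ?_
    have h2 : ‖w‖ ^ 2 ≤ r ^ 2 := by gcongr
    rw [Complex.sq_norm, Complex.normSq_apply] at h2 ⊢
    simp
    nlinarith
  obtain ⟨H, hH⟩ := (hE.mono hball).isExactOn_ball
  have hc : ContinuousOn (dslope g 0) {w | -δ < w.re} := hE.continuousOn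
  have hax : ∀ v : ℝ, (Complex.I * v) ∈ {w : ℂ | -δ < w.re} ∧ (-(Complex.I * v)) ∈ {w : ℂ | -δ < w.re} := by
    intro v; simp [hδ]
  have e1 : ∫ v in (0 : ℝ)..r, (dslope g 0 (Complex.I * v) + dslope g 0 (-(Complex.I * v))) =
      (H (Complex.I * r) - H (-(Complex.I * r))) / Complex.I := by
    have := intervalIntegral.integral_eq_sub_of_hasDerivAt (a := 0) (b := r)
      (f := fun v : ℝ => (H (Complex.I * v) - H (-(Complex.I * v))) / Complex.I)
      (f' := fun v : ℝ => dslope g 0 (Complex.I * v) + dslope g 0 (-(Complex.I * v))) ?_ ?_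
    · rw [this]; simp
    · intro v hv
      rw [Set.uIcc_of_le hr] at hv
      have a1 : HasDerivAt (fun v : ℝ => Complex.I * (v : ℂ)) Complex.I v := by
        simpa using (Complex.ofRealCLM.hasDerivAt (x := v)).const_mul Complex.I
      have a2 := (hH (Complex.I * v) (hmem _ (by simp) (by simpa [abs_of_nonneg hv.1] using hv.2))).comp v a1
      have a3 := (hH (-(Complex.I * v)) (hmem _ (by simp)
        (by simpa [abs_of_nonneg hv.1] using hv.2))).comp v a1.neg
      have := (a2.sub a3).div_const Complex.I
      refine this.congr_deriv ?_
      field_simp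
      ring
    · apply Continuous.intervalIntegrable
      refine (hc.comp_continuous (by fun_prop) fun v => (hax v).1).add
        (hc.comp_continuous (by fun_prop) fun v => (hax v).2)
  have hpt : ∀ θ ∈ Set.Icc (-(Real.pi/2)) (Real.pi/2), 0 ≤ ((r : ℂ) * Complex.exp (θ * Complex.I)).re ∧
      ‖(r : ℂ) * Complex.exp (θ * Complex.I)‖ ≤ r := by
    intro θ hθ
    constructor
    · rw [Complex.re_ofReal_mul, Complex.exp_ofReal_mul_I_re]
      exact mul_nonneg hr (Real.cos_nonneg_of_mem_Icc hθ)
    · simp [Complex.norm_exp_ofReal_mul_I, abs_of_nonneg hr]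
  have hpi : -(Real.pi/2) ≤ Real.pi/2 := by linarith [Real.pi_pos]
  have hgc : ContinuousOn (fun θ : ℝ => g (r * Complex.exp (θ * Complex.I)))
      (Set.uIcc (-(Real.pi/2)) (Real.pi/2)) := by
    rw [Set.uIcc_of_le hpi]
    refine hg.continuousOn.comp (by fun_prop) fun θ hθ => ?_
    have := (hpt θ hθ).1
    simp only [Set.mem_ofPred_eq]; linarith
  have e2 : ∫ θ in (-(Real.pi/2))..(Real.pi/2), (g (r * Complex.exp (θ * Complex.I)) - g 0) =
      (H (Complex.I * r) - H (-(Complex.I * r))) / Complex.I := by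
    have := intervalIntegral.integral_eq_sub_of_hasDerivAt (a := -(Real.pi/2)) (b := Real.pi/2)
      (f := fun θ : ℝ => H (r * Complex.exp (θ * Complex.I)) / Complex.I)
      (f' := fun θ : ℝ => g (r * Complex.exp (θ * Complex.I)) - g 0) ?_ ?_
    · rw [this, ← sub_div]
      push_cast
      rw [neg_mul, Complex.exp_neg, Complex.exp_pi_div_two_mul_I]
      simp [mul_comm]
    · intro θ hθ
      rw [Set.uIcc_of_le hpi] at hθ
      have a1 : HasDerivAt (fun θ : ℝ => (r : ℂ) * Complex.exp (θ * Complex.I))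
          (r * (Complex.exp (θ * Complex.I) * Complex.I)) θ := by
        have := ((Complex.ofRealCLM.hasDerivAt (x := θ)).mul_const Complex.I).cexp.const_mul (r : ℂ)
        simpa using this
      have a2 := ((hH _ (hmem _ (hpt θ hθ).1 (hpt θ hθ).2)).comp θ a1).div_const Complex.I
      refine a2.congr_deriv ?_
      have := sub_smul_dslope g 0 (r * Complex.exp (θ * Complex.I))
      rw [sub_zero, smul_eq_mul] at this
      rw [← this]
      field_simp
    · exact (hgc.sub continuousOn_const).intervalIntegrable
  rw [e1, ← e2, intervalIntegral.integral_sub hgc.intervalIntegrable (by simp), halfMean]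
  have : (Real.pi : ℂ) ≠ 0 := by exact_mod_cast Real.pi_ne_zero
  generalize ∫ θ in (-(Real.pi/2))..(Real.pi/2), g (r * Complex.exp (θ * Complex.I)) = J
  simp only [intervalIntegral.integral_const, Complex.real_smul]
  push_cast
  field_simp
  ring

lemma norm_halfMean_le {g : ℂ → ℂ} {B r : ℝ} (hr : 0 ≤ r)
    (hg : ∀ w : ℂ, 0 ≤ w.re → ‖w‖ = r → ‖g w‖ ≤ B) : ‖halfMean g r‖ ≤ B := by
  have hpi : -(Real.pi/2) ≤ Real.pi/2 := by linarith [Real.pi_pos]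
  rw [halfMean, norm_mul]
  have := intervalIntegral.norm_integral_le_of_norm_le_const (a := -(Real.pi/2)) (b := Real.pi/2)
    (f := fun θ : ℝ => g (r * Complex.exp (θ * Complex.I))) (C := B) ?_
  · have h2 : |Real.pi / 2 - -(Real.pi/2)| = Real.pi := by
      rw [abs_of_nonneg (by linarith)]; ring
    rw [h2] at this
    have h3 : ‖(1 / Real.pi : ℂ)‖ = 1 / Real.pi := by simp [abs_of_pos Real.pi_pos]
    rw [h3]
    calc _ ≤ 1 / Real.pi * (B * Real.pi) := by gcongr
      _ = B := by field_simp
  · intro θ hθ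
    rw [Set.uIoc_of_le hpi] at hθ
    apply hg
    · rw [Complex.re_ofReal_mul, Complex.exp_ofReal_mul_I_re]
      exact mul_nonneg hr (Real.cos_nonneg_of_mem_Icc ⟨hθ.1.le, hθ.2⟩)
    · simp [Complex.norm_exp_ofReal_mul_I, abs_of_nonneg hr]

lemma integral_inv_add_mul_I {c : ℝ} (hc : 0 < c) (Y : ℝ) :
    ∫ v in (-Y)..Y, (1 : ℂ) / (c + v * Complex.I) = (2 * Real.arctan (Y / c) : ℝ) := by
  have hne : ∀ v : ℝ, (c : ℂ) + v * Complex.I ≠ 0 := by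
    intro v h; have := congrArg Complex.re h; simp at this; linarith
  have := intervalIntegral.integral_eq_sub_of_hasDerivAt (a := -Y) (b := Y)
      (f := fun v : ℝ => (Real.arctan (v / c) : ℂ) - Complex.I / 2 * (Real.log (c ^ 2 + v ^ 2) : ℝ))
      (f' := fun v : ℝ => (1 : ℂ) / (c + v * Complex.I)) ?_ ?_
  · rw [this]
    rw [neg_div, Real.arctan_neg]; push_cast; ring_nf
  · intro v hv
    have a1 := ((Real.hasDerivAt_arctan (v / c)).comp v ((hasDerivAt_id v).div_const c)).ofReal_comp
    have hp : 0 < c ^ 2 + v ^ 2 := by positivity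
    have a2 := ((((hasDerivAt_id v).pow 2).const_add (c ^ 2)).log hp.ne').ofReal_comp
    have a3 := a1.sub (a2.const_mul (Complex.I / 2))
    refine a3.congr_deriv ?_
    have h2 := hne v
    have hp' : (c : ℂ) ^ 2 + v ^ 2 ≠ 0 := by exact_mod_cast hp.ne'
    have hc' : (c : ℂ) ≠ 0 := by exact_mod_cast hc.ne'
    have h3 : (1 : ℂ) + (v / c) ^ 2 ≠ 0 := by
      have : (0:ℝ) < 1 + (v / c) ^ 2 := by positivity
      exact_mod_cast this.ne'
    have h4 : (1 : ℂ) / (c + v * Complex.I) = (c - v * Complex.I) / (c ^ 2 + v ^ 2) := by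
      rw [div_eq_div_iff h2 hp']
      linear_combination (v : ℂ) ^ 2 * Complex.I_sq
    rw [h4]
    simp
    field_simp
  · apply Continuous.intervalIntegrable
    exact continuous_const.div (by fun_prop) hne

end

noncomputable section

lemma continuousOn_halfMean {g : ℂ → ℂ} {δ : ℝ} (hδ : 0 < δ)
    (hg : DifferentiableOn ℂ g {w | -δ < w.re}) : ContinuousOn (halfMean g) (Set.Ici 0) := by
  have hU : IsOpen {w : ℂ | -δ < w.re} := isOpen_lt continuous_const Complex.continuous_re
  have hc : ContinuousOn (dslope g 0) {w | -δ < w.re} :=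
    ((Complex.differentiableOn_dslope (hU.mem_nhds (by simpa using hδ))).2 hg).continuousOn
  have hcont : Continuous fun v : ℝ => dslope g 0 (Complex.I * v) + dslope g 0 (-(Complex.I * v)) :=
    (hc.comp_continuous (by fun_prop) fun v => by simpa using hδ).add
      (hc.comp_continuous (by fun_prop) fun v => by simpa using hδ)
  have h2 : Continuous fun r : ℝ => g 0 + (1 / Real.pi : ℂ) *
      ∫ v in (0 : ℝ)..r, (dslope g 0 (Complex.I * v) + dslope g 0 (-(Complex.I * v))) :=
    continuous_const.add (continuous_const.mul
      (intervalIntegral.continuous_primitive (fun a b => hcont.intervalIntegrable a b) 0))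
  exact h2.continuousOn.congr fun r hr => halfMean_eq hδ hg hr

lemma integrableOn_radialDensity_mul {f : ℝ → ℂ} (hf : ContinuousOn f (Set.Ioi 0)) {B : ℝ}
    (hB : ∀ r, 0 < r → ‖f r‖ ≤ B * (1 + r)) :
    IntegrableOn (fun r => (radialDensity r : ℂ) * f r) (Set.Ioi 0) := by
  have h1 : IntegrableOn (fun r : ℝ => 256 * B * (1 + r ^ 2)⁻¹) (Set.Ioi 0) :=
    (integrable_inv_one_add_sq.const_mul _).integrableOn
  refine Integrable.mono' h1 ?_ ?_
  · refine ContinuousOn.aestronglyMeasurable ?_ measurableSet_Ioi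
    exact (Complex.continuous_ofReal.comp_continuousOn continuousOn_radialDensity).mul hf
  · refine (ae_restrict_iff' measurableSet_Ioi).2 (Eventually.of_forall fun r hr => ?_)
    have hr : 0 < r := hr
    rw [norm_mul, Complex.norm_real, Real.norm_of_nonneg (radialDensity_nonneg hr.le)]
    have hB0 : 0 ≤ B := by
      have := (norm_nonneg _).trans (hB r hr)
      by_contra h; push Not at h; nlinarith
    calc _ ≤ 128 / (1 + r) ^ 3 * (B * (1 + r)) :=
          mul_le_mul (radialDensity_le hr) (hB r hr) (norm_nonneg _) (by positivity)
      _ = 128 * B * ((1 + r) ^ 2)⁻¹ := by field_simp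
      _ ≤ 128 * B * (1 + r ^ 2)⁻¹ := by gcongr; nlinarith
      _ ≤ _ := by
        have : 0 ≤ B * (1 + r ^ 2)⁻¹ := by positivity
        nlinarith

lemma one_add_sq_le_sq_norm {c : ℝ} (hc : 1 ≤ c) (v : ℝ) :
    1 + v ^ 2 ≤ ‖(c : ℂ) + v * Complex.I‖ ^ 2 := by
  rw [Complex.sq_norm, Complex.normSq_add_mul_I]; nlinarith

lemma one_le_norm_line {c : ℝ} (hc : 1 ≤ c) (v : ℝ) : 1 ≤ ‖(c : ℂ) + v * Complex.I‖ := by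
  have := one_add_sq_le_sq_norm hc v
  by_contra h
  push Not at h
  have : ‖(c : ℂ) + v * Complex.I‖ ^ 2 < 1 := by
    have := norm_nonneg ((c : ℂ) + v * Complex.I); nlinarith
  nlinarith [sq_nonneg v]

lemma norm_line_integrand_le {g : ℂ → ℂ} {c C : ℝ} (hc : 1 ≤ c) (hC : 0 ≤ C) (v : ℝ)
    (hg : ‖g (c + v * Complex.I)‖ ≤ C * (1 + ‖(c : ℂ) + v * Complex.I‖)) :
    ‖g (c + v * Complex.I) * bandKernel (c + v * Complex.I) / (c + v * Complex.I)‖ ≤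
      8 * C * Real.exp (2 * c) * (1 + v ^ 2)⁻¹ := by
  set w : ℂ := c + v * Complex.I with hw
  have h1 : 1 ≤ ‖w‖ := one_le_norm_line hc v
  have h2 := norm_bandKernel_le (w := w) (by simp [hw]; linarith) h1
  have h3 : w.re = c := by simp [hw]
  rw [h3] at h2
  have h0 : 0 < ‖w‖ := by linarith
  rw [norm_div, norm_mul]
  calc _ ≤ (C * (1 + ‖w‖)) * (4 * Real.exp (2 * c) / ‖w‖ ^ 2) / ‖w‖ := by gcongr
    _ ≤ (C * (‖w‖ + ‖w‖)) * (4 * Real.exp (2 * c) / ‖w‖ ^ 2) / ‖w‖ := by gcongr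
    _ = 8 * C * Real.exp (2 * c) * (‖w‖ ^ 2)⁻¹ := by field_simp; ring
    _ ≤ _ := by
      gcongr
      exact one_add_sq_le_sq_norm hc v

lemma integrable_line {g : ℂ → ℂ} {c C : ℝ} (hc : 1 ≤ c) (hC : 0 ≤ C)
    (hcont : Continuous fun v : ℝ => g (c + v * Complex.I))
    (hg : ∀ v : ℝ, ‖g (c + v * Complex.I)‖ ≤ C * (1 + ‖(c : ℂ) + v * Complex.I‖)) :
    Integrable fun v : ℝ => g (c + v * Complex.I) * bandKernel (c + v * Complex.I) /
      (c + v * Complex.I) := by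
  refine Integrable.mono' (integrable_inv_one_add_sq.const_mul (8 * C * Real.exp (2 * c))) ?_
    (Eventually.of_forall fun v => norm_line_integrand_le hc hC v (hg v))
  refine Continuous.aestronglyMeasurable ?_
  refine (hcont.mul (differentiable_bandKernel.continuous.comp (by fun_prop))).div (by fun_prop) ?_
  intro v h
  have := one_le_norm_line hc v
  rw [h] at this; simp at this; linarith

theorem integral_radialDensity_halfMean {g : ℂ → ℂ} {δ : ℝ} (hδ : 0 < δ)
    (hg : DifferentiableOn ℂ g {w | -δ < w.re}) {C : ℝ} (hC : 0 ≤ C)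
    (hgC : ∀ w : ℂ, 0 ≤ w.re → ‖g w‖ ≤ C * (1 + ‖w‖)) {c : ℝ} (hc : 1 ≤ c) :
    ∫ r in Set.Ioi (0 : ℝ), (radialDensity r : ℂ) * halfMean g r =
      (1 / Real.pi : ℂ) * ∫ v : ℝ, g (c + v * Complex.I) * bandKernel (c + v * Complex.I) /
        (c + v * Complex.I) := by
  have hU : IsOpen {w : ℂ | -δ < w.re} := isOpen_lt continuous_const Complex.continuous_re
  have hU0 : {w : ℂ | -δ < w.re} ∈ nhds (0 : ℂ) := hU.mem_nhds (by simpa using hδ)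
  set E : ℂ → ℂ := dslope (fun w => g w * bandKernel w) 0 with hEdef
  have hEd : DifferentiableOn ℂ E {w | -δ < w.re} :=
    (Complex.differentiableOn_dslope hU0).2 (hg.mul differentiable_bandKernel.differentiableOn)
  have hE0 : DifferentiableOn ℂ (dslope g 0) {w | -δ < w.re} :=
    (Complex.differentiableOn_dslope hU0).2 hg
  have hEval : ∀ w : ℂ, w ≠ 0 → E w = (g w * bandKernel w - g 0) / w := by
    intro w hw
    rw [hEdef, dslope_of_ne _ hw, slope_def_field]; simp [bandKernel_zero]
  set D : ℝ → ℂ := fun v => dslope g 0 (Complex.I * v) + dslope g 0 (-(Complex.I * v)) with hD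
  have hDc : Continuous D :=
    (hE0.continuousOn.comp_continuous (by fun_prop) fun v => by simpa using hδ).add
      (hE0.continuousOn.comp_continuous (by fun_prop) fun v => by simpa using hδ)
  have hEc : Continuous fun v : ℝ => E (Complex.I * v) :=
    hEd.continuousOn.comp_continuous (by fun_prop) fun v => by simpa using hδ
  have hEc' : Continuous fun v : ℝ => E (-(Complex.I * v)) :=
    hEd.continuousOn.comp_continuous (by fun_prop) fun v => by simpa using hδ
  have hEl : Continuous fun v : ℝ => E (c + v * Complex.I) :=
    hEd.continuousOn.comp_continuous (by fun_prop) fun v => by simp; linarith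
  have hgl : Continuous fun v : ℝ => g (c + v * Complex.I) :=
    hg.continuousOn.comp_continuous (by fun_prop) fun v => by simp; linarith
  have hDE : ∀ v : ℝ, (axisKernel v : ℂ) * D v = E (Complex.I * v) + E (-(Complex.I * v)) := by
    have key : ∀ v : ℝ, v ≠ 0 →
        (axisKernel v : ℂ) * D v = E (Complex.I * v) + E (-(Complex.I * v)) := by
      intro v hv
      have h0 : Complex.I * v ≠ 0 := by simp [hv]
      rw [hEval _ h0, hEval _ (neg_ne_zero.2 h0), bandKernel_neg, bandKernel_I, hD]
      simp only
      rw [dslope_of_ne _ h0, dslope_of_ne _ (neg_ne_zero.2 h0), slope_def_field, slope_def_field]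
      simp only [sub_zero]
      field_simp
      ring
    have h1 : Continuous fun v : ℝ => (axisKernel v : ℂ) * D v :=
      (Complex.continuous_ofReal.comp continuous_axisKernel).mul hDc
    have := Continuous.ext_on (dense_compl_singleton (0 : ℝ)) h1 (hEc.add hEc') fun v hv => key v hv
    exact fun v => congrFun this v
  have hparts : ∀ Y : ℝ, 0 ≤ Y → ∫ r in (0 : ℝ)..Y, (radialDensity r : ℂ) * halfMean g r =
      g 0 - axisKernel Y * halfMean g Y + (1 / Real.pi : ℂ) * ∫ v in (-Y)..Y, E (Complex.I * v) := by
    intro Y hY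
    have hhm : ∀ r, 0 ≤ r → halfMean g r = g 0 + (1 / Real.pi : ℂ) * ∫ v in (0 : ℝ)..r, D v :=
      fun r hr => halfMean_eq hδ hg hr
    set N : ℝ → ℂ := fun r => g 0 + (1 / Real.pi : ℂ) * ∫ v in (0 : ℝ)..r, D v with hN
    have hNd : ∀ r, HasDerivAt N ((1 / Real.pi : ℂ) * D r) r := fun r =>
      (((hDc.integral_hasStrictDerivAt 0 r).hasDerivAt).const_mul _).const_add _
    have e0 : ∫ r in (0 : ℝ)..Y, (radialDensity r : ℂ) * halfMean g r =
        ∫ r in (0 : ℝ)..Y, (radialDensity r : ℂ) * N r := by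
      refine intervalIntegral.integral_congr fun r hr => ?_
      rw [Set.uIcc_of_le hY] at hr
      rw [hhm r hr.1]
    have hkc : Continuous fun r : ℝ => (axisKernel r : ℂ) :=
      Complex.continuous_ofReal.comp continuous_axisKernel
    have e1 := intervalIntegral.integral_mul_deriv_eq_deriv_mul_of_hasDeriv_right (a := 0) (b := Y)
      (u := N) (u' := fun r => (1 / Real.pi : ℂ) * D r) (v := fun r : ℝ => (axisKernel r : ℂ))
      (v' := fun r : ℝ => -(radialDensity r : ℂ))
      (fun r _ => (hNd r).continuousAt.continuousWithinAt) hkc.continuousOn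
      (fun r _ => (hNd r).hasDerivWithinAt)
      (fun r hr => by
        rw [min_eq_left hY, max_eq_right hY] at hr
        have := (hasDerivAt_axisKernel hr.1).ofReal_comp
        exact (by simpa using this : HasDerivAt _ _ r).hasDerivWithinAt)
      ((continuous_const.mul hDc).intervalIntegrable _ _)
      (by
        rw [intervalIntegrable_iff_integrableOn_Ioc_of_le hY]
        exact ((integrableOn_radialDensity.mono_set Set.Ioc_subset_Ioi_self).ofReal).neg)
    have e2 : ∫ r in (0 : ℝ)..Y, N r * -(radialDensity r : ℂ) =
        -∫ r in (0 : ℝ)..Y, (radialDensity r : ℂ) * N r := by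
      rw [← intervalIntegral.integral_neg]; congr 1; ext r; ring
    have e3 : ∫ r in (0 : ℝ)..Y, (1 / Real.pi : ℂ) * D r * axisKernel r =
        (1 / Real.pi : ℂ) * ∫ v in (-Y)..Y, E (Complex.I * v) := by
      have a1 : ∀ r : ℝ, (1 / Real.pi : ℂ) * D r * axisKernel r =
          (1 / Real.pi : ℂ) * (E (Complex.I * r) + E (-(Complex.I * r))) := by
        intro r; rw [← hDE]; ring
      simp_rw [a1]
      rw [intervalIntegral.integral_const_mul, intervalIntegral.integral_add
        (hEc.intervalIntegrable _ _) (hEc'.intervalIntegrable _ _)]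
      have a2 := intervalIntegral.integral_comp_neg (a := 0) (b := Y) (fun v : ℝ => E (Complex.I * v))
      simp only [Complex.ofReal_neg, mul_neg, neg_zero] at a2
      rw [a2, add_comm, intervalIntegral.integral_add_adjacent_intervals
        (hEc.intervalIntegrable _ _) (hEc.intervalIntegrable _ _)]
    rw [e2, e3] at e1
    rw [e0, hhm Y hY]
    have e4 : N 0 = g 0 := by simp [hN]
    simp only [axisKernel_zero, e4] at e1
    push_cast at e1
    have e5 : N Y = g 0 + (1 / Real.pi : ℂ) * ∫ v in (0 : ℝ)..Y, D v := rfl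
    rw [← e5]
    linear_combination -e1
  have hrect : ∀ Y : ℝ, ∫ v in (-Y)..Y, E (Complex.I * v) =
      (∫ v in (-Y)..Y, E (c + v * Complex.I)) +
      Complex.I * ((∫ u in (0 : ℝ)..c, E (u + Y * Complex.I)) - ∫ u in (0 : ℝ)..c, E (u - Y * Complex.I)) := by
    intro Y
    have := Complex.integral_boundary_rect_eq_zero_of_differentiableOn E (-(Y * Complex.I))
      (c + Y * Complex.I) (hEd.mono ?_)
    · simp at this
      simp only [← sub_eq_add_neg] at this
      have hcomm : ∀ y : ℝ, Complex.I * (y : ℂ) = y * Complex.I := fun y => mul_comm _ _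
      simp_rw [hcomm]
      have hI : Complex.I * Complex.I = -1 := Complex.I_mul_I
      linear_combination Complex.I * this - ((∫ v in (-Y)..Y, E (c + v * Complex.I)) -
        (∫ v in (-Y)..Y, E (v * Complex.I))) * hI
    · intro w hw
      rw [Complex.mem_reProdIm] at hw
      have h1 := hw.1
      simp only [Complex.neg_re, Complex.mul_re, Complex.ofReal_re, Complex.I_re, Complex.ofReal_im,
        Complex.I_im, Complex.add_re] at h1
      rw [Set.uIcc_of_le (by linarith)] at h1
      have := h1.1
      simp at this ⊢
      linarith
  have hline : ∀ Y : ℝ, ∫ v in (-Y)..Y, E (c + v * Complex.I) =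
      (∫ v in (-Y)..Y, g (c + v * Complex.I) * bandKernel (c + v * Complex.I) / (c + v * Complex.I)) -
      g 0 * (2 * Real.arctan (Y / c) : ℝ) := by
    intro Y
    have hne : ∀ v : ℝ, (c : ℂ) + v * Complex.I ≠ 0 := by
      intro v h; have := congrArg Complex.re h; simp at this; linarith
    rw [← integral_inv_add_mul_I (by linarith) Y, ← intervalIntegral.integral_const_mul,
      ← intervalIntegral.integral_sub]
    · congr 1; ext v
      rw [hEval _ (hne v)]; ring
    · exact (integrable_line hc hC hgl (fun v => hgC _ (by simp; linarith))).intervalIntegrable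
    · apply Continuous.intervalIntegrable
      exact continuous_const.mul (continuous_const.div (by fun_prop) hne)
  have hYb : Tendsto (fun Y : ℝ => -Y) atTop atBot := tendsto_neg_atTop_atBot
  have hInt : IntegrableOn (fun r => (radialDensity r : ℂ) * halfMean g r) (Set.Ioi 0) := by
    refine integrableOn_radialDensity_mul
      ((continuousOn_halfMean hδ hg).mono Set.Ioi_subset_Ici_self) (B := C) fun r hr => ?_
    exact norm_halfMean_le hr.le fun w hw hwr => hwr ▸ hgC w hw
  have l1 := intervalIntegral_tendsto_integral_Ioi 0 hInt tendsto_id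
  have l2 := intervalIntegral_tendsto_integral
    (integrable_line hc hC hgl (fun v => hgC _ (by simp; linarith))) hYb tendsto_id
  have l3 : Tendsto (fun Y : ℝ => ((2 * Real.arctan (Y / c) : ℝ) : ℂ)) atTop (nhds (Real.pi : ℝ)) := by
    refine (Complex.continuous_ofReal.tendsto _).comp ?_
    have := ((Real.tendsto_arctan_atTop.mono_right nhdsWithin_le_nhds).comp
      (tendsto_id.atTop_div_const (by linarith : 0 < c))).const_mul 2
    rw [show 2 * (Real.pi / 2) = Real.pi by ring] at this
    exact this
  have l4 : Tendsto (fun Y : ℝ => (axisKernel Y : ℂ) * halfMean g Y) atTop (nhds 0) := by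
    refine squeeze_zero_norm' (a := fun Y : ℝ => 8 * C / Y) ?_ ?_
    · filter_upwards [eventually_ge_atTop 1] with Y hY
      have hY0 : 0 < Y := by linarith
      rw [norm_mul, Complex.norm_real, Real.norm_eq_abs]
      have h1 : ‖halfMean g Y‖ ≤ C * (1 + Y) :=
        norm_halfMean_le hY0.le fun w hw hwr => hwr ▸ hgC w hw
      calc _ ≤ 4 / Y ^ 2 * (C * (1 + Y)) := by gcongr; exact abs_axisKernel_le hY
        _ ≤ 4 / Y ^ 2 * (C * (Y + Y)) := by gcongr
        _ = _ := by field_simp; ring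
    · exact tendsto_const_nhds.div_atTop tendsto_id
  have l5 : Tendsto (fun Y : ℝ => Complex.I * ((∫ u in (0 : ℝ)..c, E (u + Y * Complex.I)) -
      ∫ u in (0 : ℝ)..c, E (u - Y * Complex.I))) atTop (nhds 0) := by
    have hb : ∀ Y : ℝ, c ≤ Y → ∀ u ∈ Set.uIoc 0 c, ∀ s : ℝ, |s| = Y → ‖E (u + s * Complex.I)‖ ≤
        (12 * C * Real.exp (2 * c) + ‖g 0‖) / Y := by
      intro Y hY u hu s hs
      rw [Set.uIoc_of_le (by linarith)] at hu
      have hY1 : 1 ≤ Y := by linarith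
      set w : ℂ := u + s * Complex.I with hw
      have hre : w.re = u := by simp [hw]
      have h1 : Y ≤ ‖w‖ := by
        have := Complex.abs_im_le_norm w
        simp [hw] at this ⊢; rw [hs] at this; exact this
      have h2 : 0 < ‖w‖ := by linarith
      have hw0 : w ≠ 0 := norm_pos_iff.1 h2
      have h3 := norm_bandKernel_le (w := w) (by rw [hre]; exact hu.1.le) (by linarith)
      rw [hEval w hw0, norm_div]
      have h4 : ‖g w * bandKernel w‖ ≤ 12 * C * Real.exp (2 * c) := by
        rw [norm_mul]
        calc _ ≤ (C * (1 + ‖w‖)) * (4 * Real.exp (2 * w.re) / ‖w‖ ^ 2) := by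
              gcongr; exact hgC w (by rw [hre]; exact hu.1.le)
          _ ≤ (C * (‖w‖ ^ 2 + ‖w‖ ^ 2)) * (4 * Real.exp (2 * c) / ‖w‖ ^ 2) := by
              gcongr
              · nlinarith
              · nlinarith
              · rw [hre]; exact hu.2
          _ = 8 * C * Real.exp (2 * c) := by field_simp; ring
          _ ≤ _ := by
            have : 0 ≤ C * Real.exp (2 * c) := by positivity
            nlinarith
      calc _ ≤ (12 * C * Real.exp (2 * c) + ‖g 0‖) / ‖w‖ := by
            gcongr; exact (norm_sub_le _ _).trans (add_le_add h4 le_rfl)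
        _ ≤ _ := by gcongr
    refine squeeze_zero_norm' (a := fun Y : ℝ => 2 * ((12 * C * Real.exp (2 * c) + ‖g 0‖) / Y * |c - 0|)) ?_ ?_
    · filter_upwards [eventually_ge_atTop c] with Y hY
      have hY0 : 0 ≤ Y := by linarith
      rw [norm_mul, Complex.norm_I, one_mul]
      have h1 := intervalIntegral.norm_integral_le_of_norm_le_const (a := 0) (b := c)
        (f := fun u : ℝ => E (u + Y * Complex.I)) fun u hu => hb Y hY u hu Y (abs_of_nonneg hY0)
      have h2 := intervalIntegral.norm_integral_le_of_norm_le_const (a := 0) (b := c)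
        (f := fun u : ℝ => E (u - Y * Complex.I)) (fun u hu => by
          have := hb Y hY u hu (-Y) (by rw [abs_neg, abs_of_nonneg hY0])
          simpa [sub_eq_add_neg] using this)
      refine (norm_sub_le _ _).trans ?_
      linarith
    · have : Tendsto (fun Y : ℝ => (12 * C * Real.exp (2 * c) + ‖g 0‖) / Y) atTop (nhds 0) :=
        tendsto_const_nhds.div_atTop tendsto_id
      simpa using (this.mul_const (|c - 0|)).const_mul 2
  have hpi : (Real.pi : ℂ) ≠ 0 := by exact_mod_cast Real.pi_ne_zero
  have l6 := (tendsto_const_nhds (x := g 0)).sub l4 |>.add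
    (((l2.sub (l3.const_mul (g 0))).add l5).const_mul (1 / Real.pi : ℂ))
  have l7 := l1.congr' (f₂ := fun Y => g 0 - axisKernel Y * halfMean g Y + (1 / Real.pi : ℂ) *
      ((∫ v in (-Y)..Y, g (c + v * Complex.I) * bandKernel (c + v * Complex.I) / (c + v * Complex.I)) -
      g 0 * (2 * Real.arctan (Y / c) : ℝ) + Complex.I * ((∫ u in (0 : ℝ)..c, E (u + Y * Complex.I)) -
      ∫ u in (0 : ℝ)..c, E (u - Y * Complex.I)))) (by
    filter_upwards [eventually_ge_atTop 0] with Y hY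
    simp only [id]
    rw [hparts Y hY, hrect, hline])
  have := tendsto_nhds_unique l7 l6
  rw [this]
  generalize ∫ v : ℝ, g (c + v * Complex.I) * bandKernel (c + v * Complex.I) / (c + v * Complex.I) = J
  field_simp
  ring

end

noncomputable section

lemma log_norm_le_circleAverage {F : ℂ → ℂ} (hF : Differentiable ℂ F) {c : ℂ} (hc : F c ≠ 0)
    {r : ℝ} (hr : 0 < r) : Real.log ‖F c‖ ≤ Real.circleAverage (fun z => Real.log ‖F z‖) c r := by
  have hA : AnalyticOnNhd ℂ F (Metric.closedBall c |r|) := fun z _ => hF.analyticAt z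
  rw [hA.circleAverage_log_norm hr.ne' hc]
  have hD := MeromorphicOn.AnalyticOnNhd.divisor_nonneg hA
  have : 0 ≤ ∑ᶠ (u : ℂ), ((MeromorphicOn.divisor F (Metric.closedBall c |r|)) u : ℝ) *
      Real.log (r * ‖c - u‖⁻¹) := by
    refine finsum_nonneg fun u => ?_
    by_cases hu : u ∈ Metric.closedBall c |r|
    · refine mul_nonneg (by exact_mod_cast hD u) ?_
      rcases eq_or_ne c u with rfl | hcu
      · simp
      · have h1 : 0 < ‖c - u‖ := norm_pos_iff.2 (sub_ne_zero.2 hcu)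
        refine Real.log_nonneg ?_
        rw [Metric.mem_closedBall, dist_comm, dist_eq_norm, abs_of_pos hr] at hu
        rw [← div_eq_mul_inv, one_le_div h1]; exact hu
    · rw [Function.locallyFinsuppWithin.apply_eq_zero_of_notMem _ hu]; simp
  linarith

/-- The mean of `f` over the right half of the circle of radius `r` about `c`. -/
def rightMean (f : ℂ → ℝ) (c : ℂ) (r : ℝ) : ℝ :=
  (1 / Real.pi) * ∫ θ in (-(Real.pi / 2))..(Real.pi / 2), f (c + r * Complex.exp (θ * Complex.I))

/-- The mean of `f` over the left half of the circle of radius `r` about `c`. -/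
def leftMean (f : ℂ → ℝ) (c : ℂ) (r : ℝ) : ℝ :=
  (1 / Real.pi) * ∫ θ in (-(Real.pi / 2))..(Real.pi / 2), f (c - r * Complex.exp (-(θ * Complex.I)))

lemma circleAverage_eq_half_add {f : ℂ → ℝ} {c : ℂ} {r : ℝ} (hf : CircleIntegrable f c r) :
    2 * Real.circleAverage f c r = rightMean f c r + leftMean f c r := by
  have hper : Function.Periodic (fun θ : ℝ => f (circleMap c r θ)) (2 * Real.pi) := fun θ => by
    simp only [periodic_circleMap c r θ]
  have h1 : ∫ θ in (0 : ℝ)..(2 * Real.pi), f (circleMap c r θ) =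
      ∫ θ in (-(Real.pi / 2))..(3 * Real.pi / 2), f (circleMap c r θ) := by
    have := hper.intervalIntegral_add_eq 0 (-(Real.pi / 2))
    rw [zero_add] at this
    rw [this]; congr 1; ring
  have hInt : ∀ a b : ℝ, IntervalIntegrable (fun θ : ℝ => f (circleMap c r θ)) volume a b :=
    fun a b => hper.intervalIntegrable₀ (by positivity) hf a b
  have h2 := intervalIntegral.integral_add_adjacent_intervals
    (hInt (-(Real.pi / 2)) (Real.pi / 2)) (hInt (Real.pi / 2) (3 * Real.pi / 2))
  have h3 : ∫ θ in (Real.pi / 2)..(3 * Real.pi / 2), f (circleMap c r θ) =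
      ∫ θ in (-(Real.pi / 2))..(Real.pi / 2), f (c - r * Complex.exp (-(θ * Complex.I))) := by
    have := intervalIntegral.integral_comp_sub_left (a := -(Real.pi / 2)) (b := Real.pi / 2)
      (fun θ : ℝ => f (circleMap c r θ)) Real.pi
    rw [show Real.pi - Real.pi / 2 = Real.pi / 2 by ring,
      show Real.pi - -(Real.pi / 2) = 3 * Real.pi / 2 by ring] at this
    rw [← this]
    congr 1; ext θ
    congr 1
    rw [circleMap]
    push_cast
    rw [sub_mul, sub_eq_add_neg, Complex.exp_add, Complex.exp_pi_mul_I]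
    ring
  rw [Real.circleAverage, h1, ← h2, h3, rightMean, leftMean]
  have h4 : ∀ θ : ℝ, circleMap c r θ = c + r * Complex.exp (θ * Complex.I) := fun θ => rfl
  simp only [h4]
  rw [smul_eq_mul]
  have := Real.pi_ne_zero
  generalize ∫ θ in (-(Real.pi / 2))..(Real.pi / 2), f (c + r * Complex.exp (θ * Complex.I)) = A
  generalize ∫ θ in (-(Real.pi / 2))..(Real.pi / 2), f (c - r * Complex.exp (-(θ * Complex.I))) = B
  field_simp

end

noncomputable section

/-- An entire function without zeros to the right of `1/2`, of polynomial growth there, whose values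
reflected in the line `Re s = 1/2` are controlled, and which to the right of `1` is
`(s - 1) ^ m` times the exponential of a generalised Dirichlet series. -/
structure EulerData {ι : Type} (F : ℂ → ℂ) (m : ℕ) (b : ι → ℂ) (ξ : ι → ℝ) (C : ℝ) : Prop where
  one_le : 1 ≤ C
  diff : Differentiable ℂ F
  ne_zero : ∀ s : ℂ, 1 / 2 < s.re → F s ≠ 0
  growth : ∀ s : ℂ, 1 / 2 ≤ s.re → ‖F s‖ ≤ C * (1 + ‖s‖) ^ 2
  fold : ∀ a y : ℝ, 0 ≤ a → ‖F (1 / 2 - a + y * Complex.I)‖ ≤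
    ‖F (1 / 2 + a + y * Complex.I)‖ * Real.exp (C + C * a * Real.log (|y| + a + 2))
  nonneg : ∀ i, 0 ≤ ξ i
  finite : ∀ X : ℝ, {i | ξ i ≤ X}.Finite
  summable : ∀ σ : ℝ, 1 < σ → Summable fun i => ‖b i‖ * Real.exp (-ξ i * σ)
  euler : ∀ s : ℂ, 1 < s.re →
    F s = (s - 1) ^ m * Complex.exp (∑' i, b i * Complex.exp (-ξ i * s))

lemma differentiableOn_of_exp_eq {U : Set ℂ} (hU : IsOpen U) {F G : ℂ → ℂ}
    (hF : DifferentiableOn ℂ F U) (hG : ContinuousOn G U)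
    (h : ∀ s ∈ U, Complex.exp (G s) = F s) : DifferentiableOn ℂ G U := by
  intro s₁ hs
  have hc : ContinuousAt G s₁ := hG.continuousAt (hU.mem_nhds hs)
  have hne : F s₁ ≠ 0 := by rw [← h s₁ hs]; exact Complex.exp_ne_zero _
  have hd : DifferentiableAt ℂ (fun s => G s₁ + Complex.log (F s / F s₁)) s₁ := by
    have hFd : DifferentiableAt ℂ F s₁ := hF.differentiableAt (hU.mem_nhds hs)
    refine (differentiableAt_const _).add ((hFd.div_const _).clog ?_)
    rw [div_self hne]; exact Complex.one_mem_slitPlane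
  have he : G =ᶠ[nhds s₁] fun s => G s₁ + Complex.log (F s / F s₁) := by
    have h1 : ∀ᶠ s in nhds s₁, ‖G s - G s₁‖ < 1 := by
      have : Tendsto (fun s => ‖G s - G s₁‖) (nhds s₁) (nhds 0) := by
        have := (hc.sub (continuousAt_const (y := G s₁))).norm
        simpa [ContinuousAt] using this
      exact this.eventually (gt_mem_nhds one_pos)
    filter_upwards [h1, hU.mem_nhds hs] with s hs1 hsU
    have him := (Complex.abs_im_le_norm (G s - G s₁)).trans hs1.le
    rw [abs_le] at him
    rw [← h s hsU, ← h s₁ hs, ← Complex.exp_sub, Complex.log_exp (by linarith [Real.pi_gt_three])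
      (by linarith [Real.pi_gt_three])]
    ring
  exact (hd.congr_of_eventuallyEq he).differentiableWithinAt

variable {ι : Type} {F : ℂ → ℂ} {m : ℕ} {b : ι → ℂ} {ξ : ι → ℝ} {C : ℝ}

lemma EulerData.norm_term (i : ι) (s : ℂ) :
    ‖b i * Complex.exp (-ξ i * s)‖ = ‖b i‖ * Real.exp (-ξ i * s.re) := by
  rw [norm_mul, Complex.norm_exp]; simp

lemma EulerData.norm_term_le (h : EulerData F m b ξ C) (i : ι) {s : ℂ} {σ : ℝ} (hs : σ ≤ s.re) :
    ‖b i * Complex.exp (-ξ i * s)‖ ≤ ‖b i‖ * Real.exp (-ξ i * σ) := by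
  rw [EulerData.norm_term]
  gcongr 1
  refine Real.exp_le_exp.2 ?_
  nlinarith [h.nonneg i]

lemma EulerData.differentiableOn_tsum (h : EulerData F m b ξ C) :
    DifferentiableOn ℂ (fun s => ∑' i, b i * Complex.exp (-ξ i * s)) {s | 1 < s.re} := by
  intro s hs
  have hs : 1 < s.re := hs
  set σ := (1 + s.re) / 2 with hσ
  have hU : IsOpen {w : ℂ | σ < w.re} := isOpen_lt continuous_const Complex.continuous_re
  have := Complex.differentiableOn_tsum_of_summable_norm (h.summable σ (by linarith))
    (F := fun i s => b i * Complex.exp (-ξ i * s)) (U := {w : ℂ | σ < w.re})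
    (fun i => by fun_prop) hU (fun i w hw => h.norm_term_le i (le_of_lt hw))
  exact (this.differentiableAt (hU.mem_nhds (show σ < s.re by linarith))).differentiableWithinAt

theorem EulerData.exists_log (h : EulerData F m b ξ C) : ∃ G : ℂ → ℂ,
    DifferentiableOn ℂ G {s | 1 / 2 < s.re} ∧ (∀ s : ℂ, 1 / 2 < s.re → Complex.exp (G s) = F s) ∧
    ∀ s : ℂ, 1 < s.re → G s = m * Complex.log (s - 1) + ∑' i, b i * Complex.exp (-ξ i * s) := by
  have hU : IsOpen {s : ℂ | 1 / 2 < s.re} := isOpen_lt continuous_const Complex.continuous_re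
  have hV : IsOpen {s : ℂ | 1 < s.re} := isOpen_lt continuous_const Complex.continuous_re
  have hsc : IsSimplyConnected {s : ℂ | 1 / 2 < s.re} := by
    have : ContractibleSpace {s : ℂ | 1 / 2 < s.re} :=
      (convex_halfSpace_re_gt (1 / 2)).contractibleSpace ⟨1, by norm_num⟩
    unfold IsSimplyConnected; infer_instance
  obtain ⟨G, hGc, hG⟩ := Complex.exists_continuousOn_eqOn_exp_comp hsc hU
    h.diff.continuous.continuousOn (by rintro ⟨s, hs, h0⟩; exact h.ne_zero s hs h0)
  have hGd := differentiableOn_of_exp_eq hU h.diff.differentiableOn hGc hG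
  set H : ℂ → ℂ := fun s => m * Complex.log (s - 1) + ∑' i, b i * Complex.exp (-ξ i * s) with hH
  have hHd : DifferentiableOn ℂ H {s | 1 < s.re} := by
    refine DifferentiableOn.add ?_ h.differentiableOn_tsum
    refine DifferentiableOn.const_mul (DifferentiableOn.clog (by fun_prop) fun s hs => ?_) _
    left
    have : 1 < s.re := hs
    simpa using this
  have hsub : {s : ℂ | 1 < s.re} ⊆ {s : ℂ | 1 / 2 < s.re} := fun s (hs : 1 < s.re) => by
    show 1 / 2 < s.re
    linarith
  have hHe : ∀ s : ℂ, 1 < s.re → Complex.exp (H s) = F s := by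
    intro s hs
    have : s - 1 ≠ 0 := by
      intro h0; have := congrArg Complex.re h0; simp at this; linarith
    rw [hH, h.euler s hs, Complex.exp_add, Complex.exp_nat_mul, Complex.exp_log this]
  have hD : DifferentiableOn ℂ (fun s => G s - H s) {s | 1 < s.re} := (hGd.mono hsub).sub hHd
  have hDe : ∀ s : ℂ, 1 < s.re → Complex.exp (G s - H s) = 1 := by
    intro s hs
    have := hG (hsub hs)
    simp only [Function.comp] at this
    rw [Complex.exp_sub, hHe s hs, this, div_self (h.ne_zero s (by linarith))]
  have hder : Set.EqOn (deriv fun s => G s - H s) 0 {s | 1 < s.re} := by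
    intro s hs
    have h1 := (hD.differentiableAt (hV.mem_nhds hs)).hasDerivAt.cexp
    have h2 : HasDerivAt (fun s => Complex.exp (G s - H s)) 0 s := by
      refine (hasDerivAt_const s (1 : ℂ)).congr_of_eventuallyEq ?_
      filter_upwards [hV.mem_nhds hs] with w hw using hDe w hw
    have h3 := h1.unique h2
    simpa [Complex.exp_ne_zero] using h3
  obtain ⟨a, ha⟩ := hV.exists_is_const_of_deriv_eq_zero
    (convex_halfSpace_re_gt 1).isPreconnected hD hder
  have ha1 : Complex.exp a = 1 := by
    rw [← ha 2 (by show 1 < (2 : ℂ).re; norm_num)]; exact hDe 2 (by norm_num)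
  refine ⟨fun s => G s - a, hGd.sub_const a, fun s hs => ?_, fun s hs => ?_⟩
  · rw [Complex.exp_sub, ha1, div_one]; exact hG hs
  · have := ha s hs
    simp only at this ⊢
    rw [← this]; ring

end

noncomputable section

variable {ι : Type} {F : ℂ → ℂ} {m : ℕ} {b : ι → ℂ} {ξ : ι → ℝ} {C : ℝ}

lemma norm_log_le (z : ℂ) : ‖Complex.log z‖ ≤ |Real.log ‖z‖| + Real.pi := by
  have h := Complex.norm_le_abs_re_add_abs_im (Complex.log z)
  rw [Complex.log_re, Complex.log_im] at h
  linarith [Complex.abs_arg_le_pi z]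

lemma EulerData.norm_tsum_le (h : EulerData F m b ξ C) {s : ℂ} {σ : ℝ} (hσ : 1 < σ) (hs : σ ≤ s.re) :
    ‖∑' i, b i * Complex.exp (-ξ i * s)‖ ≤ ∑' i, ‖b i‖ * Real.exp (-ξ i * σ) :=
  tsum_of_norm_bounded (h.summable σ hσ).hasSum fun i => h.norm_term_le i hs

lemma EulerData.log_growth (h : EulerData F m b ξ C) {G : ℂ → ℂ}
    (hGd : DifferentiableOn ℂ G {s | 1 / 2 < s.re})
    (hGe : ∀ s : ℂ, 1 / 2 < s.re → Complex.exp (G s) = F s)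
    (hG : ∀ s : ℂ, 1 < s.re → G s = m * Complex.log (s - 1) + ∑' i, b i * Complex.exp (-ξ i * s))
    {δ : ℝ} (hδ : 0 < δ) : ∃ B : ℝ, 0 ≤ B ∧ ∀ s : ℂ, 1 / 2 + δ ≤ s.re → ‖G s‖ ≤ B * (1 + ‖s‖) := by
  wlog hδ1 : δ ≤ 1 / 2 generalizing δ
  · obtain ⟨B, hB, hB'⟩ := this (δ := 1 / 2) (by norm_num) le_rfl
    exact ⟨B, hB, fun s hs => hB' s (by linarith)⟩
  set S : ℝ := ∑' i, ‖b i‖ * Real.exp (-ξ i * (3 / 2)) with hS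
  have hS0 : 0 ≤ S := tsum_nonneg fun i => by positivity
  have hright : ∀ s : ℂ, 3 / 2 ≤ s.re → ‖G s‖ ≤ (7 * m + S) * (1 + ‖s‖) := by
    intro s hs
    rw [hG s (by linarith)]
    have h1 : 1 / 2 ≤ ‖s - 1‖ := by
      have := Complex.re_le_norm (s - 1)
      simp at this; linarith
    have h2 : ‖s - 1‖ ≤ ‖s‖ + 1 := by simpa using norm_sub_le s 1
    have h3 : |Real.log ‖s - 1‖| ≤ ‖s‖ + 2 := by
      rw [abs_le]
      have hp : 0 < ‖s - 1‖ := by linarith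
      constructor
      · have := Real.one_sub_inv_le_log_of_pos hp
        have h4 : ‖s - 1‖⁻¹ ≤ 2 := by
          rw [inv_le_comm₀ hp (by norm_num)]; linarith
        linarith [norm_nonneg s]
      · have := Real.log_le_sub_one_of_pos hp
        linarith
    have h4 := norm_log_le (s - 1)
    have h5 := h.norm_tsum_le (by norm_num : (1 : ℝ) < 3 / 2) hs
    have hs0 := norm_nonneg s
    calc _ ≤ ‖(m : ℂ) * Complex.log (s - 1)‖ + ‖∑' i, b i * Complex.exp (-ξ i * s)‖ := norm_add_le _ _
      _ ≤ m * (7 * (1 + ‖s‖)) + S * (1 + ‖s‖) := by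
        refine add_le_add ?_ (h5.trans (by nlinarith))
        rw [norm_mul, Complex.norm_natCast]
        gcongr
        linarith [Real.pi_lt_four]
      _ = _ := by ring
  set A : ℝ := 7 * m + S with hA
  have hA0 : 0 ≤ A := by positivity
  have hC := h.one_le
  refine ⟨A + 8 / δ * (C + 10 + 3 * A), by positivity, fun s hs => ?_⟩
  rcases le_total (3 / 2) s.re with h32 | h32
  · refine (hright s h32).trans ?_
    gcongr
    have : 0 ≤ 8 / δ * (C + 10 + 3 * A) := by positivity
    linarith
  · set y := s.im with hy
    set R : ℝ := 3 / 2 - δ / 2 with hR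
    set M : ℝ := C + 2 * (5 + |y|) with hM
    have hM0 : 0 < M := by positivity
    set c : ℂ := 2 + y * Complex.I with hc
    have hmem : ∀ z ∈ Metric.ball (0 : ℂ) R, 1 / 2 < (c + z).re := by
      intro z hz
      rw [mem_ball_zero_iff] at hz
      have := (abs_le.1 (Complex.abs_re_le_norm z)).1
      simp [hc]
      linarith
    have hz : (c + ((s.re - 2 : ℝ) : ℂ)) = s := by
      apply Complex.ext <;> simp [hc, hy]
    have hzn : ‖((s.re - 2 : ℝ) : ℂ)‖ ≤ 3 / 2 - δ := by
      rw [Complex.norm_real, Real.norm_eq_abs, abs_le]; constructor <;> linarith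
    have key := Complex.borelCaratheodory (f := fun z => G (c + z)) (M := M) (R := R)
      (z := ((s.re - 2 : ℝ) : ℂ)) hM0
      (hGd.comp (by fun_prop) fun z hz => hmem z hz) (by
        intro z hz
        have h1 := hmem z hz
        rw [mem_ball_zero_iff] at hz
        show (G (c + z)).re ≤ M
        have h2 : Real.exp (G (c + z)).re ≤ C * (1 + ‖c + z‖) ^ 2 := by
          rw [← Complex.norm_exp, hGe _ h1]; exact h.growth _ h1.le
        have h3 : 1 + ‖c + z‖ ≤ 5 + |y| := by
          have a1 := norm_add_le c z
          have a2 : ‖c‖ ≤ 2 + |y| := by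
            have := norm_add_le (2 : ℂ) (y * Complex.I)
            simpa using this
          linarith
        have h4 : Real.log (C * (1 + ‖c + z‖) ^ 2) ≤ C + 2 * (1 + ‖c + z‖) := by
          rw [Real.log_mul (by positivity) (by positivity), Real.log_pow]
          have a1 := Real.log_le_sub_one_of_pos (show 0 < C by linarith)
          have a2 := Real.log_le_sub_one_of_pos (show 0 < 1 + ‖c + z‖ by positivity)
          push_cast
          linarith
        have h5 := (Real.le_log_iff_exp_le (by positivity)).2 h2
        linarith)
      (by linarith) (by rw [mem_ball_zero_iff]; linarith)
    simp only [hz, add_zero] at key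
    have hcR := hright c (by norm_num [hc])
    have hcn : ‖c‖ ≤ 2 + |y| := by
      have := norm_add_le (2 : ℂ) (y * Complex.I)
      simpa using this
    have hys : |y| ≤ ‖s‖ := Complex.abs_im_le_norm s
    have hGc : ‖G c‖ ≤ 3 * A * (1 + ‖s‖) := by
      refine hcR.trans ?_
      rw [mul_comm 3 A, mul_assoc]
      gcongr
      have := norm_nonneg s
      linarith
    have hMs : M ≤ (C + 10) * (1 + ‖s‖) := by
      have := norm_nonneg s
      nlinarith
    have hRz : δ / 2 ≤ R - ‖((s.re - 2 : ℝ) : ℂ)‖ := by linarith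
    have hzn2 : ‖((s.re - 2 : ℝ) : ℂ)‖ ≤ 2 := by linarith
    calc ‖G s‖ ≤ _ := key
      _ ≤ 2 * M * 2 / (δ / 2) + ‖G c‖ * (2 + 2) / (δ / 2) := by
        gcongr
        linarith
      _ = 8 / δ * (M + ‖G c‖) := by field_simp; ring
      _ ≤ 8 / δ * ((C + 10) * (1 + ‖s‖) + 3 * A * (1 + ‖s‖)) := by gcongr
      _ = (8 / δ * (C + 10 + 3 * A)) * (1 + ‖s‖) := by ring
      _ ≤ _ := by gcongr; linarith

end

noncomputable section

lemma norm_integral_line_le {g : ℂ → ℂ} {c C : ℝ} (hc : 1 ≤ c) (hC : 0 ≤ C)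
    (hg : ∀ v : ℝ, ‖g (c + v * Complex.I)‖ ≤ C * (1 + ‖(c : ℂ) + v * Complex.I‖)) :
    ‖∫ v : ℝ, g (c + v * Complex.I) * bandKernel (c + v * Complex.I) / (c + v * Complex.I)‖ ≤
      8 * C * Real.exp (2 * c) * Real.pi := by
  have := norm_integral_le_of_norm_le (integrable_inv_one_add_sq.const_mul (8 * C * Real.exp (2 * c)))
    (Eventually.of_forall fun v => norm_line_integrand_le hc hC v (hg v))
  rwa [integral_const_mul, integral_univ_inv_one_add_sq] at this

/-- The radial transform of `exp (-ξ w)`, supported on `ξ < 2`. -/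
def bandTransform (ξ : ℝ) : ℂ :=
  ∫ r in Set.Ioi (0 : ℝ), (radialDensity r : ℂ) * halfMean (fun w => Complex.exp (-ξ * w)) r

lemma norm_exp_neg_mul_le {ξ : ℝ} (hξ : 0 ≤ ξ) {w : ℂ} (hw : 0 ≤ w.re) :
    ‖Complex.exp (-ξ * w)‖ ≤ 1 := by
  rw [Complex.norm_exp]
  simp
  positivity

lemma norm_bandTransform_le {ξ : ℝ} (hξ : 0 ≤ ξ) : ‖bandTransform ξ‖ ≤ 1 := by
  rw [← integral_radialDensity]
  refine norm_integral_le_of_norm_le integrableOn_radialDensity ?_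
  refine (ae_restrict_iff' measurableSet_Ioi).2 (Eventually.of_forall fun r hr => ?_)
  have hr : 0 < r := hr
  rw [norm_mul, Complex.norm_real, Real.norm_of_nonneg (radialDensity_nonneg hr.le)]
  refine mul_le_of_le_one_right (radialDensity_nonneg hr.le) ?_
  exact norm_halfMean_le hr.le fun w hw _ => norm_exp_neg_mul_le hξ hw

lemma bandTransform_eq {ξ : ℝ} (hξ : 0 ≤ ξ) {c : ℝ} (hc : 1 ≤ c) : bandTransform ξ =
    (1 / Real.pi : ℂ) * ∫ v : ℝ, Complex.exp (-ξ * (c + v * Complex.I)) *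
      bandKernel (c + v * Complex.I) / (c + v * Complex.I) := by
  refine integral_radialDensity_halfMean (g := fun w => Complex.exp (-ξ * w)) one_pos (by fun_prop)
    zero_le_one (fun w hw => ?_) hc
  have := norm_exp_neg_mul_le hξ hw
  linarith [norm_nonneg w]

lemma bandTransform_eq_zero {ξ : ℝ} (hξ : 2 ≤ ξ) : bandTransform ξ = 0 := by
  have hb : ∀ c : ℝ, 1 ≤ c → ‖bandTransform ξ‖ ≤ 4 / c := by
    intro c hc
    have hc0 : 0 < c := by linarith
    rw [bandTransform_eq (by linarith) hc, norm_mul]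
    have h1 : ‖(1 / Real.pi : ℂ)‖ = 1 / Real.pi := by simp [abs_of_pos Real.pi_pos]
    have h2 := norm_integral_le_of_norm_le (integrable_inv_one_add_sq.const_mul (4 / c))
      (f := fun v : ℝ => Complex.exp (-ξ * (c + v * Complex.I)) *
        bandKernel (c + v * Complex.I) / (c + v * Complex.I)) (Eventually.of_forall fun v => by
        set w : ℂ := c + v * Complex.I with hw
        have hre : w.re = c := by simp [hw]
        have hcw : c ≤ ‖w‖ := by rw [← hre]; exact Complex.re_le_norm w
        have h3 := norm_bandKernel_le (w := w) (by rw [hre]; linarith) (by linarith)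
        rw [hre] at h3
        have h4 : ‖Complex.exp (-ξ * w)‖ ≤ Real.exp (-(2 * c)) := by
          rw [Complex.norm_exp]
          refine Real.exp_le_exp.2 ?_
          simp [hre]; nlinarith
        have h0 : 0 < ‖w‖ := by linarith
        rw [norm_div, norm_mul]
        calc _ ≤ Real.exp (-(2 * c)) * (4 * Real.exp (2 * c) / ‖w‖ ^ 2) / c := by gcongr
          _ = 4 / c * (‖w‖ ^ 2)⁻¹ := by rw [Real.exp_neg]; field_simp
          _ ≤ _ := by gcongr; exact one_add_sq_le_sq_norm hc v)
    rw [integral_const_mul, integral_univ_inv_one_add_sq] at h2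
    rw [h1]
    calc _ ≤ 1 / Real.pi * (4 / c * Real.pi) := by gcongr
      _ = _ := by field_simp
  have : Tendsto (fun c : ℝ => 4 / c) atTop (nhds 0) := tendsto_const_nhds.div_atTop tendsto_id
  have h0 : ‖bandTransform ξ‖ ≤ 0 := ge_of_tendsto this (by
    filter_upwards [eventually_ge_atTop 1] with c hc using hb c hc)
  exact norm_le_zero_iff.1 h0

lemma bandTransform_zero : bandTransform 0 = 1 := by
  have h1 : ∀ r : ℝ, halfMean (fun w => Complex.exp (-(0 : ℝ) * w)) r = 1 := by
    intro r
    have : (Real.pi : ℂ) ≠ 0 := by exact_mod_cast Real.pi_ne_zero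
    simp [halfMean, this]
  rw [bandTransform]
  simp only [h1, mul_one]
  rw [integral_complex_ofReal, integral_radialDensity]
  simp

lemma abs_log_le_sqrt {x : ℝ} (hx : 1 / 2 ≤ x) : |Real.log x| ≤ 2 * √x + 1 := by
  have h0 : 0 < x := by linarith
  rw [abs_le]
  constructor
  · have h1 := Real.one_sub_inv_le_log_of_pos h0
    have h2 : x⁻¹ ≤ 2 := by rw [inv_le_comm₀ h0 (by norm_num)]; linarith
    linarith [Real.sqrt_nonneg x]
  · have h1 := Real.log_sqrt h0.le
    have h2 := Real.log_le_sub_one_of_pos (Real.sqrt_pos.2 h0)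
    linarith

lemma norm_log_add_sub_le {a z : ℂ} (ha : |a.re| ≤ 1 / 2) (ht : 1 ≤ a.im) (hz : z.re = 1) :
    ‖Complex.log (a + z) - Complex.log a‖ ≤ 30 * ‖z‖ / √a.im := by
  set t := a.im with ht'
  have ht0 : 0 < t := by linarith
  have hsq : 0 < √t := Real.sqrt_pos.2 ht0
  have hss : √t * √t = t := Real.mul_self_sqrt ht0.le
  have hz1 : 1 ≤ ‖z‖ := by rw [← hz]; exact Complex.re_le_norm z
  rcases le_or_gt ‖z‖ (t / 2) with h | h
  · have hconv : Convex ℝ {w : ℂ | t / 2 ≤ w.im} := convex_halfSpace_im_ge (t / 2)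
    have him : ∀ w : ℂ, t / 2 ≤ w.im → w ∈ Complex.slitPlane := fun w hw =>
      Or.inr (by linarith : (0:ℝ) < w.im).ne'
    have := hconv.norm_image_sub_le_of_norm_hasDerivWithin_le (f := Complex.log)
      (f' := fun w => w⁻¹) (C := 2 / t) (x := a) (y := a + z)
      (fun w hw => (Complex.hasDerivAt_log (him w hw)).hasDerivWithinAt)
      (fun w hw => by
        have hw : t / 2 ≤ w.im := hw
        have h1 := (le_abs_self _).trans (Complex.abs_im_le_norm w)
        rw [norm_inv, inv_le_comm₀ (by linarith) (by positivity), inv_div]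
        linarith)
      (by show t / 2 ≤ a.im; linarith)
      (by
        have := (abs_le.1 ((Complex.abs_im_le_norm z).trans h)).1
        show t / 2 ≤ (a + z).im
        rw [Complex.add_im]; linarith)
    rw [add_sub_cancel_left] at this
    refine this.trans ?_
    rw [div_mul_eq_mul_div, div_le_div_iff₀ ht0 hsq]
    have h1 : 1 ≤ √t := by rwa [Real.one_le_sqrt]
    nlinarith [mul_nonneg (norm_nonneg z) hsq.le, mul_le_mul_of_nonneg_left h1 (mul_nonneg (norm_nonneg z) hsq.le)]
  · have hn : ‖a‖ ≤ 1 / 2 + t := by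
      have := Complex.norm_le_abs_re_add_abs_im a
      rw [← ht', abs_of_pos ht0] at this; linarith
    have hn1 : 1 / 2 ≤ ‖a‖ := by
      have := (le_abs_self _).trans (Complex.abs_im_le_norm a); linarith
    have hn2 : 1 / 2 ≤ ‖a + z‖ := by
      have := (le_abs_self _).trans (Complex.abs_re_le_norm (a + z))
      rw [Complex.add_re, hz] at this
      have := (abs_le.1 ha).1; linarith
    have hn3 : ‖a + z‖ ≤ 4 * ‖z‖ := (norm_add_le a z).trans (by linarith)
    have hb : ∀ w : ℂ, 1 / 2 ≤ ‖w‖ → ‖w‖ ≤ 4 * ‖z‖ → ‖Complex.log w‖ ≤ 9 * √‖z‖ := by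
      intro w h1 h2
      have h3 := abs_log_le_sqrt h1
      have h4 := Real.sqrt_le_sqrt h2
      rw [Real.sqrt_mul (by norm_num), show (4 : ℝ) = 2 ^ 2 by norm_num,
        Real.sqrt_sq (by norm_num)] at h4
      have h5 : 1 ≤ √‖z‖ := by rwa [Real.one_le_sqrt]
      linarith [norm_log_le w, Real.pi_lt_d2]
    have h1 := (norm_sub_le _ _).trans (add_le_add (hb _ hn2 hn3) (hb _ hn1 (by linarith)))
    refine h1.trans ?_
    rw [le_div_iff₀ hsq]
    have h2 : √t ≤ √2 * √‖z‖ := by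
      rw [← Real.sqrt_mul (by norm_num)]; exact Real.sqrt_le_sqrt (by linarith)
    have h3 : √2 ≤ 3 / 2 := by
      rw [Real.sqrt_le_left (by norm_num)]; norm_num
    have h4 := Real.mul_self_sqrt (norm_nonneg z)
    have h5 := Real.sqrt_nonneg ‖z‖
    nlinarith [mul_le_mul_of_nonneg_left h2 h5, mul_le_mul_of_nonneg_right h3 (mul_nonneg h5 h5)]

end

noncomputable section

variable {ι : Type} {F : ℂ → ℂ} {m : ℕ} {b : ι → ℂ} {ξ : ι → ℝ} {C : ℝ}

lemma EulerData.countable (h : EulerData F m b ξ C) : Countable ι := by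
  rw [← Set.countable_univ_iff]
  have : (Set.univ : Set ι) = ⋃ n : ℕ, {i | ξ i ≤ n} := by
    ext i
    simp only [Set.mem_univ, Set.mem_iUnion, Set.mem_ofPred_eq, true_iff]
    exact exists_nat_ge (ξ i)
  rw [this]
  exact Set.countable_iUnion fun n => (h.finite n).countable

/-- The part of the Dirichlet series with frequencies at most `2 L`, smoothed by `bandTransform`. -/
def EulerData.bandSum (h : EulerData F m b ξ C) (L : ℝ) (s : ℂ) : ℂ :=
  ∑ i ∈ (h.finite (2 * L)).toFinset, b i * Complex.exp (-ξ i * s) * bandTransform (ξ i / L)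

lemma EulerData.integral_line_series (h : EulerData F m b ξ C) {L : ℝ} (hL : 1 ≤ L) {s₀ : ℂ}
    (hs : 1 / 2 ≤ s₀.re) :
    Integrable (fun v : ℝ => (∑' i, b i * Complex.exp (-ξ i * (s₀ + (L + v * Complex.I) / L))) *
        bandKernel (L + v * Complex.I) / (L + v * Complex.I)) ∧
    (1 / Real.pi : ℂ) * ∫ v : ℝ, (∑' i, b i * Complex.exp (-ξ i * (s₀ + (L + v * Complex.I) / L))) *
        bandKernel (L + v * Complex.I) / (L + v * Complex.I) = h.bandSum L s₀ := by
  have := h.countable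
  have hL0 : (L : ℂ) ≠ 0 := by exact_mod_cast (by linarith : L ≠ 0)
  have hLp : 0 < L := by linarith
  set S : ℝ := ∑' i, ‖b i‖ * Real.exp (-ξ i * (3 / 2)) with hS
  have hsum := h.summable (3 / 2) (by norm_num)
  have hS0 : 0 ≤ S := tsum_nonneg fun i => by positivity
  have hre : ∀ v : ℝ, 3 / 2 ≤ (s₀ + (L + v * Complex.I) / L).re := by
    intro v
    have : ((L + v * Complex.I) / (L : ℂ)).re = 1 := by
      rw [Complex.div_ofReal_re]; simp [hLp.ne']
    rw [Complex.add_re, this]; linarith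
  have hb : ∀ i, ∀ v : ℝ, ‖b i * Complex.exp (-ξ i * (s₀ + (L + v * Complex.I) / L))‖ ≤
      (‖b i‖ * Real.exp (-ξ i * (3 / 2))) * (1 + ‖(L : ℂ) + v * Complex.I‖) := by
    intro i v
    refine (h.norm_term_le i (hre v)).trans ?_
    refine le_mul_of_one_le_right (by positivity) ?_
    linarith [norm_nonneg ((L : ℂ) + v * Complex.I)]
  have hcts : ∀ i, Continuous fun v : ℝ =>
      b i * Complex.exp (-ξ i * (s₀ + (L + v * Complex.I) / L)) := by
    intro i; fun_prop
  have hInt : ∀ i, Integrable fun v : ℝ =>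
      b i * Complex.exp (-ξ i * (s₀ + (L + v * Complex.I) / L)) *
        bandKernel (L + v * Complex.I) / (L + v * Complex.I) := fun i =>
    integrable_line (g := fun w => b i * Complex.exp (-ξ i * (s₀ + w / L))) hL (by positivity)
      (hcts i) (hb i)
  have hnorm : Summable fun i => ∫ v : ℝ, ‖b i * Complex.exp (-ξ i * (s₀ + (L + v * Complex.I) / L)) *
        bandKernel (L + v * Complex.I) / (L + v * Complex.I)‖ := by
    refine Summable.of_nonneg_of_le (fun i => integral_nonneg fun v => norm_nonneg _) (fun i => ?_)
      (hsum.mul_left (8 * Real.exp (2 * L) * Real.pi))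
    have := integral_mono_of_nonneg (μ := volume)
      (Eventually.of_forall fun v : ℝ => norm_nonneg (b i * Complex.exp (-ξ i * (s₀ +
        (L + v * Complex.I) / L)) * bandKernel (L + v * Complex.I) / (L + v * Complex.I)))
      (integrable_inv_one_add_sq.const_mul (8 * (‖b i‖ * Real.exp (-ξ i * (3 / 2))) *
        Real.exp (2 * L)))
      (Eventually.of_forall fun v : ℝ => norm_line_integrand_le
        (g := fun w => b i * Complex.exp (-ξ i * (s₀ + w / L))) hL (by positivity) v (hb i v))
    rw [integral_const_mul, integral_univ_inv_one_add_sq] at this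
    refine this.trans (le_of_eq (by ring))
  have hHS := hasSum_integral_of_summable_integral_norm hInt hnorm
  have htsum : ∀ v : ℝ, ∑' i, b i * Complex.exp (-ξ i * (s₀ + (L + v * Complex.I) / L)) *
        bandKernel (L + v * Complex.I) / (L + v * Complex.I) =
      (∑' i, b i * Complex.exp (-ξ i * (s₀ + (L + v * Complex.I) / L))) *
        bandKernel (L + v * Complex.I) / (L + v * Complex.I) := by
    intro v
    rw [mul_div_assoc, ← tsum_mul_right]
    simp only [mul_div_assoc]
  simp only [htsum] at hHS
  constructor
  · refine integrable_line (g := fun w => ∑' i, b i * Complex.exp (-ξ i * (s₀ + w / L))) hL hS0 ?_ ?_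
    · refine ContinuousOn.comp_continuous h.differentiableOn_tsum.continuousOn
        (f := fun v : ℝ => s₀ + (L + v * Complex.I) / L) (by fun_prop) fun v => ?_
      show 1 < (s₀ + (L + v * Complex.I) / L).re
      linarith [hre v]
    · intro v
      refine (h.norm_tsum_le (by norm_num) (hre v)).trans ?_
      refine le_mul_of_one_le_right hS0 ?_
      linarith [norm_nonneg ((L : ℂ) + v * Complex.I)]
  · have hterm : ∀ i, (∫ v : ℝ, b i * Complex.exp (-ξ i * (s₀ + (L + v * Complex.I) / L)) *
        bandKernel (L + v * Complex.I) / (L + v * Complex.I)) =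
        Real.pi * (b i * Complex.exp (-ξ i * s₀) * bandTransform (ξ i / L)) := by
      intro i
      rw [bandTransform_eq (div_nonneg (h.nonneg i) hLp.le) hL]
      have : ∀ v : ℝ, b i * Complex.exp (-ξ i * (s₀ + (L + v * Complex.I) / L)) *
        bandKernel (L + v * Complex.I) / (L + v * Complex.I) = (b i * Complex.exp (-ξ i * s₀)) *
          (Complex.exp (-(ξ i / L : ℝ) * (L + v * Complex.I)) *
            bandKernel (L + v * Complex.I) / (L + v * Complex.I)) := by
        intro v
        have : -(ξ i : ℂ) * (s₀ + (L + v * Complex.I) / L) = -ξ i * s₀ +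
            -(ξ i / L : ℝ) * (L + v * Complex.I) := by push_cast; ring
        rw [this, Complex.exp_add]; ring
      simp only [this]
      rw [integral_const_mul]
      have hp : (Real.pi : ℂ) ≠ 0 := by exact_mod_cast Real.pi_ne_zero
      generalize (∫ v : ℝ, Complex.exp (-(ξ i / L : ℝ) * (L + v * Complex.I)) *
            bandKernel (L + v * Complex.I) / (L + v * Complex.I)) = J
      field_simp
    rw [← hHS.tsum_eq]
    simp only [hterm]
    rw [tsum_mul_left, ← mul_assoc]
    have hp : (Real.pi : ℂ) ≠ 0 := by exact_mod_cast Real.pi_ne_zero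
    rw [one_div, inv_mul_cancel₀ hp, one_mul, EulerData.bandSum]
    refine tsum_eq_sum fun i hi => ?_
    rw [Set.Finite.mem_toFinset, Set.mem_ofPred_eq, not_le] at hi
    rw [bandTransform_eq_zero, mul_zero]
    rw [le_div_iff₀ hLp]; exact hi.le

lemma EulerData.exists_integral_halfMean_log (h : EulerData F m b ξ C) {G : ℂ → ℂ}
    (hGd : DifferentiableOn ℂ G {s | 1 / 2 < s.re})
    (hGe : ∀ s : ℂ, 1 / 2 < s.re → Complex.exp (G s) = F s)
    (hG : ∀ s : ℂ, 1 < s.re → G s = m * Complex.log (s - 1) + ∑' i, b i * Complex.exp (-ξ i * s))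
    {δ t L : ℝ} (hδ : 0 < δ) (hδ1 : δ ≤ 1 / 2) (ht : 1 ≤ t) (hL : 1 ≤ L) (hLt : Real.exp (4 * L) ≤ t) :
    (∫ r in Set.Ioi (0 : ℝ), (radialDensity r : ℂ) *
        halfMean (fun w => G (1 / 2 + δ + t * Complex.I + w / L)) r).re ≤
      m * Real.log ‖-1 / 2 + δ + t * Complex.I‖ + m * 240 +
        (h.bandSum L (1 / 2 + δ + t * Complex.I)).re := by
  set s₀ : ℂ := 1 / 2 + δ + t * Complex.I with hs₀
  have hs₀re : s₀.re = 1 / 2 + δ := by simp [hs₀]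
  have hs₀im : s₀.im = t := by simp [hs₀]
  have hLp : 0 < L := by linarith
  obtain ⟨B, hB0, hB⟩ := h.log_growth hGd hGe hG hδ
  have hmain := integral_radialDensity_halfMean (g := fun w => G (s₀ + w / L)) (δ := δ)
    (C := B * (1 + ‖s₀‖)) (c := L) hδ
    (hGd.comp (by fun_prop) fun w hw => by
      have hw : -δ < w.re := hw
      show 1 / 2 < (s₀ + w / L).re
      rw [Complex.add_re, Complex.div_ofReal_re, hs₀re]
      have : -δ < w.re / L := by
        rw [lt_div_iff₀ hLp]; nlinarith
      linarith)
    (by positivity)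
    (fun w hw => by
      refine (hB _ ?_).trans ?_
      · rw [Complex.add_re, Complex.div_ofReal_re, hs₀re]
        have : 0 ≤ w.re / L := by positivity
        linarith
      · rw [mul_assoc]
        gcongr
        have h1 := norm_add_le s₀ (w / L)
        have h2 : ‖w / L‖ ≤ ‖w‖ := by
          rw [norm_div, Complex.norm_real, Real.norm_of_nonneg hLp.le]
          exact div_le_self (norm_nonneg _) hL
        nlinarith [norm_nonneg s₀, norm_nonneg w])
    hL
  rw [hmain]
  obtain ⟨hI, hS⟩ := h.integral_line_series hL (s₀ := s₀) (by rw [hs₀re]; linarith)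
  set a : ℂ := s₀ - 1 with ha
  have hare : a.re = -1 / 2 + δ := by rw [ha, Complex.sub_re, hs₀re]; simp; ring
  have haim : a.im = t := by rw [ha, Complex.sub_im, hs₀im]; simp
  have hzre : ∀ v : ℝ, ((L + v * Complex.I) / (L : ℂ)).re = 1 := by
    intro v
    rw [Complex.div_ofReal_re]; simp [hLp.ne']
  have hst : 0 < √t := Real.sqrt_pos.2 (by linarith)
  set D : ℝ := 30 / (L * √t) with hD
  have hD0 : 0 ≤ D := by positivity
  have hdiff : ∀ v : ℝ, ‖Complex.log (a + (L + v * Complex.I) / L) - Complex.log a‖ ≤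
      D * (1 + ‖(L : ℂ) + v * Complex.I‖) := by
    intro v
    refine (norm_log_add_sub_le (a := a) (by rw [hare, abs_le]; constructor <;> linarith)
      (by rw [haim]; exact ht) (hzre v)).trans ?_
    rw [haim, norm_div, Complex.norm_real, Real.norm_of_nonneg hLp.le, hD]
    have := norm_nonneg ((L : ℂ) + v * Complex.I)
    rw [show 30 * (‖(L : ℂ) + v * Complex.I‖ / L) / √t = 30 / (L * √t) * ‖(L : ℂ) + v * Complex.I‖ by
      field_simp]
    gcongr
    linarith
  have hcts : Continuous fun v : ℝ => Complex.log (a + (L + v * Complex.I) / L) - Complex.log a := by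
    refine Continuous.sub (Continuous.clog (by fun_prop) fun v => ?_) continuous_const
    left
    rw [Complex.add_re, hzre, hare]; linarith
  have hI1 := integrable_line (g := fun w => Complex.log (a + w / L) - Complex.log a) hL hD0 hcts hdiff
  have hI0 := integrable_line (g := fun _ => (1 : ℂ)) hL zero_le_one (by fun_prop) (fun v => by
    have := norm_nonneg ((L : ℂ) + v * Complex.I); simp)
  have hone : (1 / Real.pi : ℂ) * ∫ v : ℝ, (1 : ℂ) * bandKernel (L + v * Complex.I) /
      (L + v * Complex.I) = 1 := by
    have := bandTransform_eq (le_refl 0) hL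
    rw [bandTransform_zero] at this
    simpa using this.symm
  have hE := norm_integral_line_le (g := fun w => Complex.log (a + w / L) - Complex.log a) hL hD0 hdiff
  have hsplit : ∀ v : ℝ, G (s₀ + (L + v * Complex.I) / L) * bandKernel (L + v * Complex.I) /
      (L + v * Complex.I) =
      (m * (((Complex.log (a + (L + v * Complex.I) / L) - Complex.log a) *
        bandKernel (L + v * Complex.I) / (L + v * Complex.I)) +
        Complex.log a * ((1 : ℂ) * bandKernel (L + v * Complex.I) / (L + v * Complex.I)))) +
      (∑' i, b i * Complex.exp (-ξ i * (s₀ + (L + v * Complex.I) / L))) *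
        bandKernel (L + v * Complex.I) / (L + v * Complex.I) := by
    intro v
    rw [hG _ (by rw [Complex.add_re, hzre, hs₀re]; linarith),
      show s₀ + (L + v * Complex.I) / L - 1 = a + (L + v * Complex.I) / L by rw [ha]; ring]
    ring
  simp only [hsplit]
  have hI2 : Integrable fun v : ℝ => (Complex.log (a + (L + v * Complex.I) / L) - Complex.log a) *
        bandKernel (L + v * Complex.I) / (L + v * Complex.I) +
        Complex.log a * ((1 : ℂ) * bandKernel (L + v * Complex.I) / (L + v * Complex.I)) :=
    hI1.add (hI0.const_mul _)
  rw [integral_add (hI2.const_mul _) hI, mul_add, hS, integral_const_mul,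
    integral_add hI1 (hI0.const_mul _), integral_const_mul]
  set J₁ : ℂ := ∫ v : ℝ, (Complex.log (a + (L + v * Complex.I) / L) - Complex.log a) *
        bandKernel (L + v * Complex.I) / (L + v * Complex.I) with hJ₁
  set J₀ : ℂ := ∫ v : ℝ, (1 : ℂ) * bandKernel (L + v * Complex.I) / (L + v * Complex.I) with hJ₀
  have hre : (1 / Real.pi : ℂ) * (m * (J₁ + Complex.log a * J₀)) + h.bandSum L s₀ =
      m * ((1 / Real.pi : ℂ) * J₁) + m * Complex.log a + h.bandSum L s₀ := by
    linear_combination (m * Complex.log a) * hone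
  rw [hre, Complex.add_re, Complex.add_re]
  have hm1 : ((m : ℂ) * ((1 / Real.pi : ℂ) * J₁)).re ≤ m * 240 := by
    refine (Complex.re_le_norm _).trans ?_
    rw [norm_mul, Complex.norm_natCast]
    refine mul_le_mul_of_nonneg_left ?_ (Nat.cast_nonneg _)
    have h1 : ‖(1 / Real.pi : ℂ)‖ = 1 / Real.pi := by simp [abs_of_pos Real.pi_pos]
    have h2 : Real.exp (2 * L) ≤ √t := by
      rw [Real.le_sqrt (Real.exp_pos _).le (by linarith), ← Real.exp_nat_mul]
      refine le_trans (le_of_eq ?_) hLt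
      congr 1; push_cast; ring
    rw [norm_mul, h1]
    have hpi := Real.pi_pos
    calc _ ≤ 1 / Real.pi * (8 * D * Real.exp (2 * L) * Real.pi) := by gcongr
      _ = 8 * D * Real.exp (2 * L) := by field_simp
      _ ≤ 8 * D * √t := by gcongr
      _ = 240 / L := by rw [hD]; field_simp; norm_num
      _ ≤ 240 := div_le_self (by norm_num) hL
  have hm2 : ((m : ℂ) * Complex.log a).re = m * Real.log ‖-1 / 2 + δ + t * Complex.I‖ := by
    rw [← Complex.ofReal_natCast, Complex.re_ofReal_mul, Complex.log_re,
      show a = -1 / 2 + δ + t * Complex.I by rw [ha, hs₀]; ring]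
  rw [hm2]
  linarith

end

noncomputable section

lemma countable_zeros {F : ℂ → ℂ} (hF : Differentiable ℂ F) {c : ℂ} (hc : F c ≠ 0) :
    {z | F z = 0}.Countable := by
  have hA : AnalyticOnNhd ℂ F Set.univ := fun z _ => hF.analyticAt z
  have h0 := hA.preimage_zero_mem_codiscrete hc
  have : {z | F z = 0} ⊆ ⋃ n : ℕ, Metric.closedBall (0 : ℂ) n \ (F ⁻¹' {0})ᶜ := by
    intro z hz
    obtain ⟨n, hn⟩ := exists_nat_ge ‖z‖
    exact Set.mem_iUnion.2 ⟨n, by simpa using hn, by simpa using hz⟩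
  refine Set.Countable.mono this (Set.countable_iUnion fun n => Set.Finite.countable ?_)
  exact (isCompact_closedBall _ _).finite_sdiff_of_mem_codiscreteWithin
    (Filter.codiscreteWithin_mono (Set.subset_univ _) h0)

lemma integral_le_of_tendsto_of_lower {f : ℕ → ℝ → ℝ} {g k : ℝ → ℝ} {μ : Measure ℝ}
    (hf : ∀ n, Integrable (f n) μ) (hg : Integrable g μ) (hk : Integrable k μ)
    (hlow : ∀ n, ∀ᵐ x ∂μ, -k x ≤ f n x)
    (hlim : ∀ᵐ x ∂μ, ∃ l, Tendsto (fun n => f n x) atTop (nhds l) ∧ g x ≤ l)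
    {R : ℕ → ℝ} {R₀ : ℝ} (hR : ∀ n, ∫ x, f n x ∂μ ≤ R n) (hR₀ : Tendsto R atTop (nhds R₀)) :
    ∫ x, g x ∂μ ≤ R₀ := by
  have hpos : ∀ n, 0 ≤ᵐ[μ] fun x => f n x + k x := fun n => by
    filter_upwards [hlow n] with x hx
    simp only [Pi.zero_apply]; linarith
  have h1 : ∫⁻ x, ENNReal.ofReal (g x + k x) ∂μ ≤ ENNReal.ofReal (R₀ + ∫ x, k x ∂μ) := by
    calc ∫⁻ x, ENNReal.ofReal (g x + k x) ∂μ
        ≤ ∫⁻ x, liminf (fun n => ENNReal.ofReal (f n x + k x)) atTop ∂μ := by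
          refine lintegral_mono_ae ?_
          filter_upwards [hlim] with x ⟨l, hl, hgl⟩
          have : Tendsto (fun n => ENNReal.ofReal (f n x + k x)) atTop
              (nhds (ENNReal.ofReal (l + k x))) :=
            (ENNReal.continuous_ofReal.tendsto _).comp (hl.add_const _)
          rw [this.liminf_eq]
          exact ENNReal.ofReal_le_ofReal (by linarith)
      _ ≤ liminf (fun n => ∫⁻ x, ENNReal.ofReal (f n x + k x) ∂μ) atTop :=
          lintegral_liminf_le' fun n => ((hf n).add hk).1.aemeasurable.ennreal_ofReal
      _ ≤ liminf (fun n => ENNReal.ofReal (R n + ∫ x, k x ∂μ)) atTop := by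
          refine liminf_le_liminf (Eventually.of_forall fun n => ?_)
          have hi : Integrable (fun x => f n x + k x) μ := (hf n).add hk
          rw [← ofReal_integral_eq_lintegral_ofReal hi (hpos n)]
          refine ENNReal.ofReal_le_ofReal ?_
          rw [integral_add (hf n) hk]
          linarith [hR n]
      _ = _ := ((ENNReal.continuous_ofReal.tendsto _).comp (hR₀.add_const _)).liminf_eq
  have h2 : 0 ≤ R₀ + ∫ x, k x ∂μ := by
    refine ge_of_tendsto' (hR₀.add_const _) fun n => ?_
    have := integral_nonneg_of_ae (hpos n)
    rw [integral_add (hf n) hk] at this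
    linarith [hR n]
  have h3 : ∫ x, (g x + k x) ∂μ ≤ R₀ + ∫ x, k x ∂μ := by
    have hi : Integrable (fun x => g x + k x) μ := hg.add hk
    rw [integral_eq_lintegral_pos_part_sub_lintegral_neg_part hi]
    have := ENNReal.toReal_mono ENNReal.ofReal_ne_top h1
    rw [ENNReal.toReal_ofReal h2] at this
    refine le_trans (sub_le_self _ ENNReal.toReal_nonneg) this
  rw [integral_add hg hk] at h3
  linarith

variable {ι : Type} {F : ℂ → ℂ} {m : ℕ} {b : ι → ℂ} {ξ : ι → ℝ} {C : ℝ}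

lemma continuousOn_log_norm {U : Set ℂ} (hF : Differentiable ℂ F) (hU : ∀ z ∈ U, F z ≠ 0) :
    ContinuousOn (fun z => Real.log ‖F z‖) U :=
  ContinuousOn.log hF.continuous.norm.continuousOn fun z hz => norm_ne_zero_iff.2 (hU z hz)

lemma circleIntegrable_log_norm (hF : Differentiable ℂ F) (c : ℂ) (r : ℝ) :
    CircleIntegrable (fun z => Real.log ‖F z‖) c r :=
  MeromorphicOn.circleIntegrable_log_norm fun z _ => (hF.analyticAt z).meromorphicAt

lemma left_point (δ t r θ : ℝ) : (1 / 2 + δ + t * Complex.I : ℂ) - r * Complex.exp (-(θ * Complex.I)) =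
    1 / 2 - ((r * Real.cos θ - δ : ℝ) : ℂ) + ((t + r * Real.sin θ : ℝ) : ℂ) * Complex.I := by
  rw [show -((θ : ℂ) * Complex.I) = ((-θ : ℝ) : ℂ) * Complex.I by push_cast; ring, Complex.exp_mul_I]
  rw [← Complex.ofReal_cos, ← Complex.ofReal_sin, Real.cos_neg, Real.sin_neg]
  push_cast; ring_nf

lemma right_point (δ t r θ : ℝ) : (1 / 2 + δ + t * Complex.I : ℂ) + r * Complex.exp (θ * Complex.I) =
    1 / 2 + ((r * Real.cos θ + δ : ℝ) : ℂ) + ((t + r * Real.sin θ : ℝ) : ℂ) * Complex.I := by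
  rw [Complex.exp_mul_I, ← Complex.ofReal_cos, ← Complex.ofReal_sin]
  push_cast; ring_nf

lemma abs_add_sin_le {t r θ : ℝ} (ht : 0 ≤ t) (hr : 0 ≤ r) : |t + r * Real.sin θ| ≤ t + r := by
  have h1 := Real.sin_le_one θ
  have h2 := Real.neg_one_le_sin θ
  rw [abs_le]; constructor <;> nlinarith

/-- Jensen's inequality combined with the reflection bound, on a circle free of zeros. -/
lemma EulerData.log_norm_le_rightMean (h : EulerData F m b ξ C) {t r : ℝ} (ht : 0 ≤ t) (hr : 0 < r)
    (h0 : F (1 / 2 + t * Complex.I) ≠ 0)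
    (hz : ∀ z : ℂ, ‖z - (1 / 2 + t * Complex.I)‖ = r → F z ≠ 0) :
    Real.log ‖F (1 / 2 + t * Complex.I)‖ ≤
      rightMean (fun z => Real.log ‖F z‖) (1 / 2 + t * Complex.I) r +
        (C + C * r * Real.log (t + 2 * r + 2)) := by
  set c : ℂ := 1 / 2 + t * Complex.I with hc
  have hcc : c = 1 / 2 + ((0 : ℝ) : ℂ) + t * Complex.I := by simp [hc]
  set u : ℂ → ℝ := fun z => Real.log ‖F z‖ with hu
  have hC := h.one_le
  set E : ℝ := C + C * r * Real.log (t + 2 * r + 2) with hE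
  have hl0 : 0 ≤ Real.log (t + 2 * r + 2) := Real.log_nonneg (by linarith)
  have hE0 : 0 ≤ E := by positivity
  have h1 := log_norm_le_circleAverage h.diff h0 hr
  have h2 := circleAverage_eq_half_add (circleIntegrable_log_norm h.diff c r)
  have hcont : ∀ f : ℝ → ℂ, Continuous f → (∀ θ, ‖f θ - c‖ = r) → Continuous fun θ => u (f θ) := by
    intro f hf hfr
    exact (continuousOn_log_norm (U := {z | ‖z - c‖ = r}) h.diff (fun z hz' => hz z hz')).comp_continuous
      hf hfr
  have hn : ∀ θ : ℝ, ‖(r : ℂ) * Complex.exp (θ * Complex.I)‖ = r := by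
    intro θ; simp [Complex.norm_exp_ofReal_mul_I, abs_of_pos hr]
  have hn' : ∀ θ : ℝ, ‖(r : ℂ) * Complex.exp (-(θ * Complex.I))‖ = r := by
    intro θ
    have := hn (-θ)
    rwa [show ((-θ : ℝ) : ℂ) * Complex.I = -(θ * Complex.I) by push_cast; ring] at this
  have hcr := hcont (fun θ => c + r * Complex.exp (θ * Complex.I)) (by fun_prop) (fun θ => by
    simp only [add_sub_cancel_left]; exact hn θ)
  have hcl := hcont (fun θ => c - r * Complex.exp (-(θ * Complex.I))) (by fun_prop) (fun θ => by
    rw [sub_sub_cancel_left, norm_neg]; exact hn' θ)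
  have h3 : leftMean u c r ≤ rightMean u c r + E := by
    have hle : -(Real.pi / 2) ≤ Real.pi / 2 := by linarith [Real.pi_pos]
    have := intervalIntegral.integral_mono_on (μ := volume) hle (hcl.intervalIntegrable _ _)
      ((hcr.add_const E).intervalIntegrable _ _) (fun θ hθ => by
        have hcos : 0 ≤ Real.cos θ := Real.cos_nonneg_of_mem_Icc hθ
        have h4 := h.fold (r * Real.cos θ) (t + r * Real.sin θ) (by positivity)
        have hL := left_point 0 t r θ
        have hR := right_point 0 t r θ
        rw [← hcc, sub_zero] at hL
        rw [← hcc, add_zero] at hR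
        rw [← hL, ← hR] at h4
        have hneL : F (c - r * Complex.exp (-(θ * Complex.I))) ≠ 0 := hz _ (by
          rw [sub_sub_cancel_left, norm_neg]; exact hn' θ)
        have hneR : F (c + r * Complex.exp (θ * Complex.I)) ≠ 0 := hz _ (by
          rw [add_sub_cancel_left]; exact hn θ)
        have h5 := Real.log_le_log (norm_pos_iff.2 hneL) h4
        rw [Real.log_mul (norm_ne_zero_iff.2 hneR) (Real.exp_pos _).ne', Real.log_exp] at h5
        refine h5.trans ?_
        have hl1 : 0 ≤ Real.log (|t + r * Real.sin θ| + r * Real.cos θ + 2) := Real.log_nonneg (by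
          have := mul_nonneg hr.le hcos
          linarith [abs_nonneg (t + r * Real.sin θ)])
        simp only [hu, hE]
        have hcos1 := Real.cos_le_one θ
        have h6 := abs_add_sin_le (θ := θ) ht hr.le
        have h7 : r * Real.cos θ ≤ r := by nlinarith
        have h8 : Real.log (|t + r * Real.sin θ| + r * Real.cos θ + 2) ≤ Real.log (t + 2 * r + 2) :=
          Real.log_le_log (by positivity) (by linarith)
        gcongr)
    rw [intervalIntegral.integral_add (hcr.intervalIntegrable _ _) (by simp),
      intervalIntegral.integral_const] at this
    rw [leftMean, rightMean]
    have hpi := Real.pi_pos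
    calc _ ≤ 1 / Real.pi * _ := mul_le_mul_of_nonneg_left this (by positivity)
      _ = _ := by
        rw [smul_eq_mul]
        generalize (∫ x in (-(Real.pi / 2))..(Real.pi / 2), u (c + r * Complex.exp (x * Complex.I))) = J
        field_simp; ring
  have h4 : u c = Real.log ‖F c‖ := rfl
  rw [← hu] at h1 h2
  linarith

lemma EulerData.tendsto_rightMean (h : EulerData F m b ξ C) {t r : ℝ} (hr : 0 < r)
    (hz : ∀ z : ℂ, ‖z - (1 / 2 + t * Complex.I)‖ = r → F z ≠ 0)
    {δ : ℕ → ℝ} (hδ : ∀ n, 0 < δ n) (hδ1 : ∀ n, δ n ≤ 1) (hδ0 : Tendsto δ atTop (nhds 0)) :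
    Tendsto (fun n => rightMean (fun z => Real.log ‖F z‖) (1 / 2 + δ n + t * Complex.I) r) atTop
      (nhds (rightMean (fun z => Real.log ‖F z‖) (1 / 2 + t * Complex.I) r)) := by
  set f : ℝ × ℝ → ℝ := fun p => Real.log ‖F (1 / 2 + p.1 + t * Complex.I +
    r * Complex.exp (p.2 * Complex.I))‖ with hf
  have hne : ∀ p ∈ Set.Icc (0 : ℝ) 1 ×ˢ Set.Icc (-(Real.pi / 2)) (Real.pi / 2),
      F (1 / 2 + p.1 + t * Complex.I + r * Complex.exp (p.2 * Complex.I)) ≠ 0 := by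
    rintro ⟨d, θ⟩ ⟨⟨hd0, hd1⟩, hθ⟩
    have hcos : 0 ≤ Real.cos θ := Real.cos_nonneg_of_mem_Icc hθ
    simp only
    rcases eq_or_lt_of_le hd0 with rfl | hd
    · refine hz _ ?_
      rw [show (1 / 2 + ((0 : ℝ) : ℂ) + t * Complex.I + r * Complex.exp (θ * Complex.I)) -
        (1 / 2 + t * Complex.I) = r * Complex.exp (θ * Complex.I) by push_cast; ring]
      simp [Complex.norm_exp_ofReal_mul_I, abs_of_pos hr]
    · refine h.ne_zero _ ?_
      rw [right_point]
      simp
      positivity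
  have hcf : ContinuousOn f (Set.Icc (0 : ℝ) 1 ×ˢ Set.Icc (-(Real.pi / 2)) (Real.pi / 2)) := by
    refine ContinuousOn.log (Continuous.continuousOn ?_) fun p hp => norm_ne_zero_iff.2 (hne p hp)
    exact (h.diff.continuous.comp (by fun_prop)).norm
  obtain ⟨K, hK⟩ := (isCompact_Icc.prod isCompact_Icc).exists_bound_of_continuousOn hcf
  have hle : -(Real.pi / 2) ≤ Real.pi / 2 := by linarith [Real.pi_pos]
  have hslice : ∀ d ∈ Set.Icc (0 : ℝ) 1, ContinuousOn (fun θ => f (d, θ))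
      (Set.Icc (-(Real.pi / 2)) (Real.pi / 2)) := fun d hd =>
    hcf.comp (by fun_prop) fun θ hθ => ⟨hd, hθ⟩
  unfold rightMean
  refine Tendsto.const_mul _ ?_
  have := intervalIntegral.tendsto_integral_filter_of_dominated_convergence (μ := volume)
    (F := fun n θ => f (δ n, θ)) (f := fun θ => f (0, θ)) (l := atTop) (a := -(Real.pi / 2))
    (b := Real.pi / 2) (fun _ => K)
    (Eventually.of_forall fun n => by
      rw [Set.uIoc_of_le hle]
      exact ((hslice _ ⟨(hδ n).le, hδ1 n⟩).mono Set.Ioc_subset_Icc_self).aestronglyMeasurable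
        measurableSet_Ioc)
    (Eventually.of_forall fun n => Eventually.of_forall fun θ hθ => by
      rw [Set.uIoc_of_le hle] at hθ
      exact hK _ ⟨⟨(hδ n).le, hδ1 n⟩, Set.Ioc_subset_Icc_self hθ⟩)
    (by simp)
    (Eventually.of_forall fun θ hθ => by
      rw [Set.uIoc_of_le hle] at hθ
      have hθ := Set.Ioc_subset_Icc_self hθ
      have h1 := hcf (0, θ) ⟨⟨le_rfl, zero_le_one⟩, hθ⟩
      refine h1.tendsto.comp ?_
      refine tendsto_nhdsWithin_iff.2 ⟨?_, Eventually.of_forall fun n => ⟨⟨(hδ n).le, hδ1 n⟩, hθ⟩⟩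
      exact hδ0.prodMk_nhds tendsto_const_nhds)
  simpa [hf] using this

end

noncomputable section

variable {ι : Type} {F : ℂ → ℂ} {m : ℕ} {b : ι → ℂ} {ξ : ι → ℝ} {C : ℝ}

lemma log_le_two_mul_sqrt {x : ℝ} (hx : 0 < x) : Real.log x ≤ 2 * √x := by
  have h1 := Real.log_sqrt hx.le
  have h2 := Real.log_le_sub_one_of_pos (Real.sqrt_pos.2 hx)
  linarith

lemma EulerData.log_norm_le_of_half_le (h : EulerData F m b ξ C) {z : ℂ} (hz : 1 / 2 ≤ z.re) :
    Real.log ‖F z‖ ≤ (C + 2) * (1 + ‖z‖) := by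
  have hC := h.one_le
  rcases eq_or_ne (F z) 0 with h0 | h0
  · rw [h0, norm_zero, Real.log_zero]; positivity
  · have h1 := Real.log_le_log (norm_pos_iff.2 h0) (h.growth z hz)
    rw [Real.log_mul (by positivity) (by positivity), Real.log_pow] at h1
    have a1 := Real.log_le_sub_one_of_pos (show 0 < C by linarith)
    have a2 := Real.log_le_sub_one_of_pos (show 0 < 1 + ‖z‖ by positivity)
    push_cast at h1
    nlinarith [norm_nonneg z]

lemma EulerData.log_norm_le (h : EulerData F m b ξ C) (z : ℂ) :
    Real.log ‖F z‖ ≤ (7 * C + 4) * ((1 + ‖z‖) * √(1 + ‖z‖)) := by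
  have hC := h.one_le
  have hn := norm_nonneg z
  have hq1 : 1 ≤ √(1 + ‖z‖) := by rw [Real.one_le_sqrt]; linarith
  have hq : 1 + ‖z‖ ≤ (1 + ‖z‖) * √(1 + ‖z‖) := le_mul_of_one_le_right (by positivity) hq1
  rcases eq_or_ne (F z) 0 with h0 | h0
  · rw [h0, norm_zero, Real.log_zero]; positivity
  rcases le_or_gt (1 / 2) z.re with hz | hz
  · refine (h.log_norm_le_of_half_le hz).trans ?_
    gcongr <;> linarith
  · set a : ℝ := 1 / 2 - z.re with ha
    have h1 := h.fold a z.im (by linarith)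
    have hzz : (1 / 2 - a + z.im * Complex.I : ℂ) = z := by
      apply Complex.ext <;> simp [ha]
    rw [hzz] at h1
    set z' : ℂ := 1 / 2 + a + z.im * Complex.I with hz'
    have hne : F z' ≠ 0 := by
      intro h2
      rw [h2, norm_zero, zero_mul] at h1
      exact h0 (norm_le_zero_iff.1 h1)
    have h2 := Real.log_le_log (norm_pos_iff.2 h0) h1
    rw [Real.log_mul (norm_ne_zero_iff.2 hne) (Real.exp_pos _).ne', Real.log_exp] at h2
    have h3 := h.log_norm_le_of_half_le (z := z') (by simp [hz']; linarith)
    have hx := (abs_le.1 (Complex.abs_re_le_norm z)).1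
    have hy := Complex.abs_im_le_norm z
    have ha1 : a ≤ 1 + ‖z‖ := by linarith
    have ha0 : 0 < a := by linarith
    have h4 : ‖z'‖ ≤ 1 + 2 * ‖z‖ := by
      have := Complex.norm_le_abs_re_add_abs_im z'
      have e1 : z'.re = 1 / 2 + a := by simp [hz']
      have e2 : z'.im = z.im := by simp [hz']
      rw [e1, e2, abs_of_pos (by linarith)] at this
      linarith
    have hlt : |z.im| + a + 2 ≤ 4 * (1 + ‖z‖) := by linarith
    have h5 : Real.log (|z.im| + a + 2) ≤ 4 * √(1 + ‖z‖) := by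
      refine (log_le_two_mul_sqrt (by positivity)).trans ?_
      have := Real.sqrt_le_sqrt hlt
      rw [Real.sqrt_mul (by norm_num), show (4 : ℝ) = 2 ^ 2 by norm_num,
        Real.sqrt_sq (by norm_num)] at this
      linarith
    have h6 : C * a * Real.log (|z.im| + a + 2) ≤ C * (1 + ‖z‖) * (4 * √(1 + ‖z‖)) := by
      have : 0 ≤ Real.log (|z.im| + a + 2) := Real.log_nonneg (by linarith [abs_nonneg z.im])
      gcongr
    have h7 : (C + 2) * (1 + ‖z'‖) ≤ (C + 2) * (2 * ((1 + ‖z‖) * √(1 + ‖z‖))) := by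
      gcongr; linarith
    nlinarith

lemma EulerData.le_rightMean (h : EulerData F m b ξ C) {c : ℂ} {r : ℝ} (hr : 0 < r) (hc : F c ≠ 0) :
    2 * Real.log ‖F c‖ - (7 * C + 4) * ((1 + ‖c‖ + r) * √(1 + ‖c‖ + r)) ≤
      rightMean (fun z => Real.log ‖F z‖) c r := by
  have hC := h.one_le
  set M : ℝ := (7 * C + 4) * ((1 + ‖c‖ + r) * √(1 + ‖c‖ + r)) with hM
  have hM0 : 0 ≤ M := by positivity
  have h1 := log_norm_le_circleAverage h.diff hc hr
  have h2 := circleAverage_eq_half_add (circleIntegrable_log_norm h.diff c r)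
  have h3 : leftMean (fun z => Real.log ‖F z‖) c r ≤ M := by
    have hle : -(Real.pi / 2) ≤ Real.pi / 2 := by linarith [Real.pi_pos]
    have hpi := Real.pi_pos
    have hI : ∫ θ in (-(Real.pi / 2))..(Real.pi / 2),
        Real.log ‖F (c - r * Complex.exp (-(θ * Complex.I)))‖ ≤ Real.pi * M := by
      by_cases hi : IntervalIntegrable (fun θ : ℝ =>
        Real.log ‖F (c - r * Complex.exp (-(θ * Complex.I)))‖) volume (-(Real.pi / 2)) (Real.pi / 2)
      · have := intervalIntegral.integral_mono_on (μ := volume) hle hi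
          (intervalIntegrable_const (c := M)) (fun θ hθ => by
            refine (h.log_norm_le _).trans ?_
            have : ‖c - r * Complex.exp (-(θ * Complex.I))‖ ≤ ‖c‖ + r := by
              refine (norm_sub_le _ _).trans ?_
              rw [norm_mul, Complex.norm_exp]
              simp [abs_of_pos hr]
            have h5 : 1 + ‖c - r * Complex.exp (-(θ * Complex.I))‖ ≤ 1 + ‖c‖ + r := by linarith
            rw [hM]
            gcongr)
        rw [intervalIntegral.integral_const, smul_eq_mul] at this
        refine this.trans (le_of_eq (by ring))
      · rw [intervalIntegral.integral_undef hi]; positivity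
    rw [leftMean]
    calc _ ≤ 1 / Real.pi * (Real.pi * M) := by gcongr
      _ = M := by field_simp
  linarith

lemma continuousOn_radialDensity_mul_sqrt :
    ContinuousOn (fun x => radialDensity x * ((1 + x) * √(1 + x))) (Set.Ioi 0) :=
  continuousOn_radialDensity.mul (by fun_prop)

lemma integrableOn_radialDensity_mul_sqrt :
    IntegrableOn (fun x => radialDensity x * ((1 + x) * √(1 + x))) (Set.Ioi 0) := by
  have h1 : IntegrableOn (fun x : ℝ => 128 * (x + 1) ^ (-(3 / 2) : ℝ)) (Set.Ioi 0) :=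
    (integrableOn_add_rpow_Ioi_of_lt (by norm_num) (by norm_num)).const_mul _
  refine Integrable.mono' h1
    (continuousOn_radialDensity_mul_sqrt.aestronglyMeasurable measurableSet_Ioi) ?_
  refine (ae_restrict_iff' measurableSet_Ioi).2 (Eventually.of_forall fun x hx => ?_)
  have hx : 0 < x := hx
  have h2 := radialDensity_le hx
  have h3 := radialDensity_nonneg hx.le
  rw [Real.norm_of_nonneg (by positivity)]
  calc _ ≤ 128 / (1 + x) ^ 3 * ((1 + x) * √(1 + x)) := by gcongr
    _ = 128 * (√(1 + x) / (1 + x) ^ 2) := by field_simp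
    _ = _ := by
      rw [show (-(3 / 2) : ℝ) = 1 / 2 - (2 : ℕ) by norm_num, Real.rpow_sub (by positivity),
        Real.rpow_natCast, ← Real.sqrt_eq_rpow, add_comm x 1]

lemma integrableOn_radialDensity_mul_one_add :
    IntegrableOn (fun x => radialDensity x * (1 + x)) (Set.Ioi 0) := by
  refine Integrable.mono' integrableOn_radialDensity_mul_sqrt
    ((continuousOn_radialDensity.mul (by fun_prop)).aestronglyMeasurable measurableSet_Ioi) ?_
  refine (ae_restrict_iff' measurableSet_Ioi).2 (Eventually.of_forall fun x hx => ?_)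
  have hx : 0 < x := hx
  have h3 := radialDensity_nonneg hx.le
  rw [Real.norm_of_nonneg (by positivity)]
  refine mul_le_mul_of_nonneg_left (le_mul_of_one_le_right (by positivity) ?_) h3
  rw [Real.one_le_sqrt]; linarith

end

noncomputable section

variable {ι : Type} {F : ℂ → ℂ} {m : ℕ} {b : ι → ℂ} {ξ : ι → ℝ} {C : ℝ}

lemma re_halfMean_log {G : ℂ → ℂ} (hGd : DifferentiableOn ℂ G {s | 1 / 2 < s.re})
    (hGe : ∀ s : ℂ, 1 / 2 < s.re → Complex.exp (G s) = F s) {c : ℂ} (hc : 1 / 2 < c.re) {L r : ℝ}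
    (hL : 0 < L) (hr : 0 < r) :
    (halfMean (fun w => G (c + w / L)) r).re = rightMean (fun z => Real.log ‖F z‖) c (r / L) := by
  have hle : -(Real.pi / 2) ≤ Real.pi / 2 := by linarith [Real.pi_pos]
  have hpt : ∀ θ : ℝ, c + r * Complex.exp (θ * Complex.I) / L =
      c + ((r / L : ℝ) : ℂ) * Complex.exp (θ * Complex.I) := by
    intro θ; push_cast; ring
  have hre : ∀ θ ∈ Set.uIcc (-(Real.pi / 2)) (Real.pi / 2),
      1 / 2 < (c + r * Complex.exp (θ * Complex.I) / L).re := by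
    intro θ hθ
    rw [Set.uIcc_of_le hle] at hθ
    have hcos : 0 ≤ Real.cos θ := Real.cos_nonneg_of_mem_Icc hθ
    rw [hpt, Complex.add_re, Complex.re_ofReal_mul, Complex.exp_ofReal_mul_I_re]
    have : 0 ≤ r / L * Real.cos θ := by positivity
    linarith
  have hcont : ContinuousOn (fun θ : ℝ => G (c + r * Complex.exp (θ * Complex.I) / L))
      (Set.uIcc (-(Real.pi / 2)) (Real.pi / 2)) :=
    hGd.continuousOn.comp (by fun_prop) hre
  have h1 := Complex.reCLM.intervalIntegral_comp_comm
    (hcont.intervalIntegrable (μ := volume))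
  rw [halfMean, rightMean, show (1 / Real.pi : ℂ) = ((1 / Real.pi : ℝ) : ℂ) by push_cast; rfl,
    Complex.re_ofReal_mul]
  congr 1
  rw [← Complex.reCLM_apply, ← h1]
  refine intervalIntegral.integral_congr fun θ hθ => ?_
  simp only [Complex.reCLM_apply]
  rw [← hpt, ← hGe _ (hre θ hθ), Complex.norm_exp, Real.log_exp]

theorem EulerData.exists_log_norm_le (h : EulerData F m b ξ C) : ∃ K : ℝ, ∀ t L : ℝ, 1 ≤ t → 1 ≤ L →
    Real.exp (4 * L) ≤ t → F (1 / 2 + t * Complex.I) ≠ 0 →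
    Real.log ‖F (1 / 2 + t * Complex.I)‖ ≤ m * Real.log ‖(-1 / 2 + t * Complex.I : ℂ)‖ +
      (h.bandSum L (1 / 2 + t * Complex.I)).re + K + K * (Real.log (t + 2) / L) := by
  obtain ⟨G, hGd, hGe, hG⟩ := h.exists_log
  have hC := h.one_le
  set Q₁ : ℝ := ∫ x in Set.Ioi 0, radialDensity x * (1 + x) with hQ₁
  set Q₂ : ℝ := ∫ x in Set.Ioi 0, radialDensity x * ((1 + x) * √(1 + x)) with hQ₂
  have hQ₁0 : 0 ≤ Q₁ := setIntegral_nonneg measurableSet_Ioi fun x hx => by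
    have hx : 0 < x := hx
    have := radialDensity_nonneg hx.le
    positivity
  have hQ₂0 : 0 ≤ Q₂ := setIntegral_nonneg measurableSet_Ioi fun x hx => by
    have hx : 0 < x := hx
    have := radialDensity_nonneg hx.le
    positivity
  refine ⟨m * 240 + C + C * Q₁ + 2 * C * Q₂, fun t L ht hL hLt hne => ?_⟩
  have hLp : 0 < L := by linarith
  set c : ℂ := 1 / 2 + t * Complex.I with hc
  set u : ℂ → ℝ := fun z => Real.log ‖F z‖ with hu
  have hc0 : (1 / 2 + ((0 : ℝ) : ℂ) + t * Complex.I) = c := by simp [hc]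
  have hcu : Tendsto (fun d : ℝ => u (1 / 2 + d + t * Complex.I)) (nhds 0) (nhds (u c)) := by
    have h1 : ContinuousAt (fun d : ℝ => u (1 / 2 + d + t * Complex.I)) 0 := by
      refine ContinuousAt.log ?_ ?_
      · exact (h.diff.continuous.comp (by fun_prop : Continuous fun d : ℝ =>
          (1 / 2 + d + t * Complex.I : ℂ))).norm.continuousAt
      · rw [hc0]; exact norm_ne_zero_iff.2 hne
    have h2 := h1.tendsto
    simpa only [hc0] using h2
  have hev : ∀ᶠ d : ℝ in nhds 0, u c - 1 ≤ u (1 / 2 + d + t * Complex.I) :=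
    (hcu.eventually (lt_mem_nhds (by linarith : u c - 1 < u c))).mono fun d hd => hd.le
  obtain ⟨d₀, hd₀, hd₀'⟩ := Metric.eventually_nhds_iff.1 hev
  set d : ℝ := min (d₀ / 2) (1 / 2) with hd
  have hdp : 0 < d := by positivity
  set δ : ℕ → ℝ := fun n => d / (n + 1) with hδ
  have hδp : ∀ n, 0 < δ n := fun n => by simp only [hδ]; positivity
  have hδd : ∀ n, δ n ≤ d := fun n => by
    simp only [hδ]
    refine div_le_self hdp.le ?_
    linarith [(Nat.cast_nonneg n : (0 : ℝ) ≤ n)]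
  have hδ2 : ∀ n, δ n ≤ 1 / 2 := fun n => (hδd n).trans (min_le_right _ _)
  have hδu : ∀ n, u c - 1 ≤ u (1 / 2 + δ n + t * Complex.I) := fun n => by
    refine hd₀' ?_
    rw [dist_zero_right, Real.norm_of_nonneg (hδp n).le]
    have := (hδd n).trans (min_le_left _ _)
    linarith
  have hδ0 : Tendsto δ atTop (nhds 0) :=
    tendsto_const_nhds.div_atTop (tendsto_atTop_add_const_right _ _ tendsto_natCast_atTop_atTop)
  set B : ℕ → ℝ → ℝ := fun n x => rightMean u (1 / 2 + δ n + t * Complex.I) (x / L) with hB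
  set f : ℕ → ℝ → ℝ := fun n x => ((radialDensity x : ℂ) *
    halfMean (fun w => G (1 / 2 + δ n + t * Complex.I + w / L)) x).re with hf
  have hfB : ∀ n x, 0 < x → f n x = radialDensity x * B n x := by
    intro n x hx
    simp only [hf, hB]
    rw [Complex.re_ofReal_mul, re_halfMean_log hGd hGe (by simp; exact hδp n) hLp hx]
  have hfi' : ∀ n, IntegrableOn (fun x => (radialDensity x : ℂ) *
    halfMean (fun w => G (1 / 2 + δ n + t * Complex.I + w / L)) x) (Set.Ioi 0) := by
    intro n
    set s₀ : ℂ := 1 / 2 + δ n + t * Complex.I with hs₀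
    have hs₀re : s₀.re = 1 / 2 + δ n := by simp [hs₀]
    obtain ⟨A, hA0, hA⟩ := h.log_growth hGd hGe hG (hδp n)
    refine integrableOn_radialDensity_mul (B := A * (1 + ‖s₀‖))
      ((continuousOn_halfMean (hδp n) ?_).mono Set.Ioi_subset_Ici_self) fun r hr => ?_
    · refine hGd.comp (by fun_prop) fun w hw => ?_
      have hw : -δ n < w.re := hw
      show 1 / 2 < (s₀ + w / L).re
      rw [Complex.add_re, Complex.div_ofReal_re, hs₀re]
      have : -δ n < w.re / L := by
        rw [lt_div_iff₀ hLp]; nlinarith [hδp n]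
      linarith
    · refine norm_halfMean_le hr.le fun w hw hwr => ?_
      refine (hA _ ?_).trans ?_
      · rw [Complex.add_re, Complex.div_ofReal_re, hs₀re]
        have : 0 ≤ w.re / L := by positivity
        linarith
      · rw [mul_assoc]
        gcongr
        have h1 := norm_add_le s₀ (w / L)
        have h2 : ‖w / L‖ ≤ r := by
          rw [norm_div, Complex.norm_real, Real.norm_of_nonneg hLp.le, hwr]
          exact div_le_self hr.le hL
        nlinarith [norm_nonneg s₀]
  have hfi : ∀ n, Integrable (f n) (volume.restrict (Set.Ioi 0)) := fun n => (hfi' n).re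
  set M : ℝ := (7 * C + 4) * ((t + 3) * √(t + 3)) + 2 * |u c| + 2 with hM
  have hM0 : 0 ≤ M := by positivity
  set E : ℝ → ℝ := fun x => C + C / L * ((1 + x) * Real.log (t + 2) + 2 * ((1 + x) * √(1 + x))) with hE
  set g : ℝ → ℝ := fun x => (u c - C) * radialDensity x -
    (C / L * Real.log (t + 2) * (radialDensity x * (1 + x)) +
      2 * C / L * (radialDensity x * ((1 + x) * √(1 + x)))) with hg
  have hgE : ∀ x, g x = radialDensity x * (u c - E x) := fun x => by
    simp only [hg, hE]; ring
  have i0 := integrableOn_radialDensity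
  have i1 := integrableOn_radialDensity_mul_one_add
  have i2 := integrableOn_radialDensity_mul_sqrt
  have j0 := i0.const_mul (u c - C)
  have j1 := i1.const_mul (C / L * Real.log (t + 2))
  have j2 := i2.const_mul (2 * C / L)
  have hgi : Integrable g (volume.restrict (Set.Ioi 0)) := j0.sub (j1.add j2)
  have hgint : ∫ x in Set.Ioi 0, g x = (u c - C) - (C / L * Real.log (t + 2) * Q₁ + 2 * C / L * Q₂) := by
    have j12 : Integrable (fun x => C / L * Real.log (t + 2) * (radialDensity x * (1 + x)) +
      2 * C / L * (radialDensity x * ((1 + x) * √(1 + x)))) (volume.restrict (Set.Ioi 0)) := j1.add j2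
    simp only [hg]
    rw [integral_sub j0 j12, integral_add j1 j2, integral_const_mul, integral_const_mul,
      integral_const_mul, integral_radialDensity, mul_one]
  have hmain := integral_le_of_tendsto_of_lower (f := f) (g := g)
    (k := fun x => M * (radialDensity x * ((1 + x) * √(1 + x))))
    (μ := volume.restrict (Set.Ioi 0)) hfi hgi (i2.const_mul M)
    (fun n => by
      refine (ae_restrict_iff' measurableSet_Ioi).2 (Eventually.of_forall fun x hx => ?_)
      have hx : 0 < x := hx
      have hρ := radialDensity_nonneg hx.le
      rw [hfB n x hx, show -(M * (radialDensity x * ((1 + x) * √(1 + x)))) =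
        radialDensity x * (-(M * ((1 + x) * √(1 + x)))) by ring]
      refine mul_le_mul_of_nonneg_left ?_ hρ
      have h1 := h.le_rightMean (c := 1 / 2 + δ n + t * Complex.I) (r := x / L) (by positivity)
        (h.ne_zero _ (by simp; exact hδp n))
      refine le_trans ?_ h1
      have h2 : ‖(1 / 2 + δ n + t * Complex.I : ℂ)‖ ≤ 1 + t := by
        have h3 := Complex.norm_le_abs_re_add_abs_im (1 / 2 + δ n + t * Complex.I : ℂ)
        have e1 : (1 / 2 + δ n + t * Complex.I : ℂ).re = 1 / 2 + δ n := by simp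
        have e2 : (1 / 2 + δ n + t * Complex.I : ℂ).im = t := by simp
        rw [e1, e2, abs_of_pos (by linarith [hδp n]), abs_of_pos (by linarith)] at h3
        linarith [hδ2 n]
      have h3 : x / L ≤ x := div_le_self hx.le hL
      have h4 : 1 + ‖(1 / 2 + δ n + t * Complex.I : ℂ)‖ + x / L ≤ (t + 3) * (1 + x) := by nlinarith
      have h5 : (1 + ‖(1 / 2 + δ n + t * Complex.I : ℂ)‖ + x / L) *
          √(1 + ‖(1 / 2 + δ n + t * Complex.I : ℂ)‖ + x / L) ≤
          ((t + 3) * √(t + 3)) * ((1 + x) * √(1 + x)) := by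
        calc _ ≤ ((t + 3) * (1 + x)) * √((t + 3) * (1 + x)) := by gcongr
          _ = _ := by rw [Real.sqrt_mul (by linarith)]; ring
      have h6 : 1 ≤ (1 + x) * √(1 + x) := by
        have : 1 ≤ √(1 + x) := by rw [Real.one_le_sqrt]; linarith
        nlinarith
      have h7 := hδu n
      have h8 := neg_abs_le (u c)
      have h9 : (7 * C + 4) * ((1 + ‖(1 / 2 + δ n + t * Complex.I : ℂ)‖ + x / L) *
          √(1 + ‖(1 / 2 + δ n + t * Complex.I : ℂ)‖ + x / L)) ≤
          (7 * C + 4) * (((t + 3) * √(t + 3)) * ((1 + x) * √(1 + x))) := by gcongr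
      have h10 : 2 * |u c| + 2 ≤ (2 * |u c| + 2) * ((1 + x) * √(1 + x)) :=
        le_mul_of_one_le_right (by positivity) h6
      simp only [hM]
      simp only [hu] at h7 h8 h10 ⊢
      linarith)
    (by
      have hcount : (((fun z : ℂ => L * ‖z - c‖) '' {z | F z = 0})).Countable :=
        (countable_zeros h.diff hne).image _
      have hae : ∀ᵐ x ∂(volume.restrict (Set.Ioi (0 : ℝ))),
          x ∉ (fun z : ℂ => L * ‖z - c‖) '' {z | F z = 0} :=
        ae_restrict_of_ae (measure_eq_zero_iff_ae_notMem.1 (hcount.measure_zero _))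
      filter_upwards [hae, ae_restrict_mem measurableSet_Ioi] with x hx hx0
      have hx0 : 0 < x := hx0
      have hρ := radialDensity_nonneg hx0.le
      have hr : 0 < x / L := by positivity
      have hz : ∀ z : ℂ, ‖z - c‖ = x / L → F z ≠ 0 := by
        intro z hz h0
        exact hx ⟨z, h0, by simp only [hz]; field_simp⟩
      refine ⟨radialDensity x * rightMean u c (x / L), ?_, ?_⟩
      · refine Tendsto.congr (fun n => (hfB n x hx0).symm) ?_
        exact (h.tendsto_rightMean hr hz hδp (fun n => (hδ2 n).trans (by norm_num)) hδ0).const_mul _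
      · rw [hgE]
        refine mul_le_mul_of_nonneg_left ?_ hρ
        have h1 := h.log_norm_le_rightMean (by linarith : (0 : ℝ) ≤ t) hr hne hz
        have h3 : C * (x / L) * Real.log (t + 2 * (x / L) + 2) ≤
            C / L * ((1 + x) * Real.log (t + 2) + 2 * ((1 + x) * √(1 + x))) := by
          have hxl : x / L ≤ x := div_le_self hx0.le hL
          have h4 : Real.log (t + 2 * (x / L) + 2) ≤ Real.log (t + 2) + 2 * √(1 + x) := by
            calc _ ≤ Real.log ((t + 2) * (1 + x)) := Real.log_le_log (by positivity) (by nlinarith)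
              _ = Real.log (t + 2) + Real.log (1 + x) := Real.log_mul (by positivity) (by positivity)
              _ ≤ _ := by gcongr; exact log_le_two_mul_sqrt (by linarith)
          have h5 : 0 ≤ Real.log (t + 2) + 2 * √(1 + x) := by
            have : 0 ≤ Real.log (t + 2) := Real.log_nonneg (by linarith)
            positivity
          calc _ ≤ C * (x / L) * (Real.log (t + 2) + 2 * √(1 + x)) := by gcongr
            _ = C / L * (x * (Real.log (t + 2) + 2 * √(1 + x))) := by ring
            _ ≤ C / L * ((1 + x) * (Real.log (t + 2) + 2 * √(1 + x))) := by gcongr; linarith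
            _ = _ := by ring
        simp only [hE]
        linarith)
    (R := fun n => m * Real.log ‖(-1 / 2 + δ n + t * Complex.I : ℂ)‖ + m * 240 +
        (h.bandSum L (1 / 2 + δ n + t * Complex.I)).re)
    (R₀ := m * Real.log ‖(-1 / 2 + t * Complex.I : ℂ)‖ + m * 240 + (h.bandSum L c).re)
    (fun n => by
      refine le_trans (le_of_eq ?_)
        (h.exists_integral_halfMean_log hGd hGe hG (hδp n) (hδ2 n) ht hL hLt)
      simp only [hf]
      exact integral_re (hfi' n))
    (by
      have hcont : ContinuousAt (fun d : ℝ => m * Real.log ‖(-1 / 2 + d + t * Complex.I : ℂ)‖ + m * 240 +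
        (h.bandSum L (1 / 2 + d + t * Complex.I)).re) 0 := by
        refine ContinuousAt.add (ContinuousAt.add (continuousAt_const.mul (ContinuousAt.log
          (by fun_prop) ?_)) continuousAt_const) ?_
        · refine norm_ne_zero_iff.2 fun h0 => ?_
          have := congrArg Complex.im h0
          simp at this; linarith
        · unfold EulerData.bandSum
          fun_prop
      have h1 := hcont.tendsto
      simp only [Complex.ofReal_zero, add_zero] at h1
      exact h1.comp hδ0)
  rw [hgint] at hmain
  have hlog : 0 ≤ Real.log (t + 2) := Real.log_nonneg (by linarith)
  have e1 : C / L * Real.log (t + 2) * Q₁ = C * Q₁ * (Real.log (t + 2) / L) := by ring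
  have e2 : 2 * C / L * Q₂ ≤ 2 * C * Q₂ := by
    rw [div_mul_eq_mul_div]; exact div_le_self (by positivity) hL
  have e3 : C * Q₁ * (Real.log (t + 2) / L) ≤
      (m * 240 + C + C * Q₁ + 2 * C * Q₂) * (Real.log (t + 2) / L) := by
    gcongr
    have : (0 : ℝ) ≤ m * 240 := by positivity
    have : 0 ≤ 2 * C * Q₂ := by positivity
    linarith
  have e4 : 0 ≤ C * Q₁ := by positivity
  show u c ≤ _
  linarith

end

noncomputable section

lemma norm_Gamma_le_Gamma_re {z : ℂ} (hz : 0 < z.re) : ‖Complex.Gamma z‖ ≤ Real.Gamma z.re := by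
  rw [Complex.Gamma_eq_integral hz, Real.Gamma_eq_integral hz, Complex.GammaIntegral]
  refine (norm_integral_le_integral_norm _).trans (le_of_eq ?_)
  refine setIntegral_congr_fun measurableSet_Ioi fun x hx => ?_
  have hx : 0 < x := hx
  simp only [norm_mul, Complex.norm_real, Complex.norm_cpow_eq_rpow_re_of_pos hx]
  simp [abs_of_pos (Real.exp_pos _)]

lemma exists_Gamma_le_strip : ∃ M : ℝ, 0 ≤ M ∧ ∀ x ∈ Set.Icc (1 / 2 : ℝ) (3 / 2), Real.Gamma x ≤ M := by
  have hc : ContinuousOn Real.Gamma (Set.Icc (1 / 2 : ℝ) (3 / 2)) := by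
    intro x hx
    refine (Real.differentiableAt_Gamma fun n => ?_).continuousAt.continuousWithinAt
    have : (0 : ℝ) ≤ n := n.cast_nonneg
    have := hx.1
    intro h; linarith
  obtain ⟨M, hM⟩ := isCompact_Icc.exists_bound_of_continuousOn hc
  exact ⟨M, (norm_nonneg _).trans (hM (1 / 2) (by norm_num)), fun x hx => (le_abs_self _).trans (hM x hx)⟩

lemma norm_Gamma_half_add_le (y : ℝ) :
    ‖Complex.Gamma (1 / 2 + y * Complex.I)‖ ≤ 3 * Real.exp (-(Real.pi * y / 2)) := by
  have h1 : Complex.Gamma (1 / 2 + y * Complex.I) * Complex.Gamma (1 / 2 - y * Complex.I) =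
      Real.pi / Real.cosh (Real.pi * y) := by
    have := Complex.Gamma_mul_Gamma_one_sub (1 / 2 + y * Complex.I)
    rw [show (1 - (1 / 2 + y * Complex.I) : ℂ) = 1 / 2 - y * Complex.I by ring] at this
    rw [this]
    congr 1
    rw [show (Real.pi * (1 / 2 + y * Complex.I) : ℂ) = (Real.pi * y : ℂ) * Complex.I + Real.pi / 2 by ring,
      Complex.sin_add_pi_div_two, Complex.cos_mul_I]
    push_cast; rfl
  have h2 : Complex.Gamma (1 / 2 - y * Complex.I) =
      (starRingEnd ℂ) (Complex.Gamma (1 / 2 + y * Complex.I)) := by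
    rw [← Complex.Gamma_conj]
    congr 1
    simp [sub_eq_add_neg, Complex.conj_ofNat]
  rw [h2, Complex.mul_conj, ← Complex.ofReal_div, Complex.ofReal_inj, Complex.normSq_eq_norm_sq] at h1
  have h3 : Real.exp (Real.pi * y) / 2 ≤ Real.cosh (Real.pi * y) := by
    rw [Real.cosh_eq]; linarith [Real.exp_pos (-(Real.pi * y))]
  have h4 : Real.pi / Real.cosh (Real.pi * y) ≤ (3 * Real.exp (-(Real.pi * y / 2))) ^ 2 := by
    rw [div_le_iff₀ (Real.cosh_pos _)]
    have h5 : (3 * Real.exp (-(Real.pi * y / 2))) ^ 2 * (Real.exp (Real.pi * y) / 2) = 9 / 2 := by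
      rw [mul_pow, ← Real.exp_nat_mul]
      have : Real.exp ((2 : ℕ) * -(Real.pi * y / 2)) * Real.exp (Real.pi * y) = 1 := by
        rw [← Real.exp_add, ← Real.exp_zero]; congr 1; push_cast; ring
      linear_combination (9 / 2) * this
    have h6 := mul_le_mul_of_nonneg_left h3 (sq_nonneg (3 * Real.exp (-(Real.pi * y / 2))))
    linarith [Real.pi_lt_four]
  exact le_of_sq_le_sq (h1.trans_le h4) (by positivity)

lemma add_mul_exp_neg_sq_le (y₀ y : ℝ) (h : 0 ≤ y₀) :
    (1 / 2 + |y|) * Real.exp (-(y - y₀) ^ 2) ≤ 2 + y₀ := by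
  have h1 : |y| ≤ y₀ + |y - y₀| := by
    have := abs_add_le y₀ (y - y₀)
    rwa [add_sub_cancel, abs_of_nonneg h] at this
  have h2 : 1 + (y - y₀) ^ 2 ≤ Real.exp ((y - y₀) ^ 2) := by
    linarith [Real.add_one_le_exp ((y - y₀) ^ 2)]
  have h3 : |y - y₀| ≤ 1 + (y - y₀) ^ 2 := by
    rw [← sq_abs]; nlinarith [sq_nonneg (|y - y₀| - 1), abs_nonneg (y - y₀)]
  rw [Real.exp_neg, ← div_eq_mul_inv, div_le_iff₀ (Real.exp_pos _)]
  nlinarith [sq_nonneg (y - y₀)]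

lemma norm_Gamma_strip_le {a y₀ : ℝ} (ha : a ∈ Set.Icc (0 : ℝ) 1) (hy : 0 ≤ y₀) :
    ‖Complex.Gamma (1 / 2 + a + y₀ * Complex.I)‖ ≤ 9 * (2 + y₀) ^ a * Real.exp (-(Real.pi * y₀ / 2)) := by
  obtain ⟨M, hM0, hM⟩ := exists_Gamma_le_strip
  set f : ℂ → ℂ := fun z => Complex.Gamma (1 / 2 + z) *
    Complex.exp (-(Real.pi / 2) * z * Complex.I + (z - y₀ * Complex.I) ^ 2 - z * Real.log (2 + y₀)) with hf
  have hexp : ∀ z : ℂ, ‖Complex.exp (-(Real.pi / 2) * z * Complex.I + (z - y₀ * Complex.I) ^ 2 -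
      z * Real.log (2 + y₀))‖ = Real.exp (Real.pi * z.im / 2 + z.re ^ 2 - (z.im - y₀) ^ 2 -
        z.re * Real.log (2 + y₀)) := by
    intro z
    rw [Complex.norm_exp]
    congr 1
    simp only [pow_two, Complex.add_re, Complex.sub_re, Complex.mul_re, Complex.sub_im, Complex.mul_im,
      Complex.neg_re, Complex.neg_im, Complex.I_re, Complex.I_im, Complex.ofReal_re, Complex.ofReal_im]
    simp only [← Complex.ofReal_ofNat, ← Complex.ofReal_div, Complex.ofReal_re, Complex.ofReal_im]
    ring
  have hlog : 0 ≤ Real.log (2 + y₀) := Real.log_nonneg (by linarith)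
  have hexplog : Real.exp (Real.log (2 + y₀)) = 2 + y₀ := Real.exp_log (by linarith)
  have he1 : Real.exp 1 ≤ 3 := by linarith [Real.exp_one_lt_d9]
  have hbd : ∀ z : ℂ, 0 ≤ z.re → z.re ≤ 1 → ‖f z‖ ≤
      M * Real.exp (Real.pi * y₀ / 2 + Real.pi ^ 2 / 16 + 1) := by
    intro z h0 h1
    simp only [hf]
    rw [norm_mul, hexp]
    have hre : (1 / 2 + z).re = 1 / 2 + z.re := by simp
    have h2 := norm_Gamma_le_Gamma_re (z := 1 / 2 + z) (by rw [hre]; linarith)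
    rw [hre] at h2
    refine mul_le_mul (h2.trans (hM _ ⟨by linarith, by linarith⟩)) (Real.exp_le_exp.2 ?_)
      (Real.exp_pos _).le hM0
    have h3 := sq_nonneg (z.im - y₀ - Real.pi / 4)
    have h4 : 0 ≤ z.re * Real.log (2 + y₀) := by positivity
    nlinarith
  have hmain : ∀ z : ℂ, 0 ≤ z.re → z.re ≤ 1 → ‖f z‖ ≤ 9 := by
    intro z h0 h1
    refine PhragmenLindelof.vertical_strip (a := 0) (b := 1) (f := f) ?_ ?_ ?_ ?_ h0 h1
    · refine DifferentiableOn.diffContOnCl fun w hw => ?_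
      have hcl : closure (Complex.re ⁻¹' Set.Ioo (0 : ℝ) 1) ⊆ Complex.re ⁻¹' Set.Icc (0 : ℝ) 1 :=
        closure_minimal (Set.preimage_mono Set.Ioo_subset_Icc_self)
          (isClosed_Icc.preimage Complex.continuous_re)
      have hw := hcl hw
      have hg : DifferentiableAt ℂ Complex.Gamma (1 / 2 + w) := by
        refine Complex.differentiableAt_Gamma _ fun n h => ?_
        have := congrArg Complex.re h
        simp at this
        have h3 : (0 : ℝ) ≤ n := n.cast_nonneg
        have h4 : 0 ≤ w.re := hw.1
        linarith
      have hg' : DifferentiableAt ℂ (fun w => Complex.Gamma (1 / 2 + w)) w :=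
        hg.comp w (by fun_prop)
      exact (hg'.mul (by fun_prop)).differentiableWithinAt
    · refine ⟨1, by linarith [Real.pi_gt_three], 0, ?_⟩
      refine Asymptotics.IsBigO.of_bound (M * Real.exp (Real.pi * y₀ / 2 + Real.pi ^ 2 / 16 + 1)) ?_
      refine eventually_inf_principal.2 (Eventually.of_forall fun w hw => ?_)
      have hw : 0 < w.re ∧ w.re < 1 := hw
      simpa using hbd w hw.1.le hw.2.le
    · intro w hw
      simp only [hf]
      have hw' : w = w.im * Complex.I := by apply Complex.ext <;> simp [hw]
      rw [norm_mul, hexp, hw]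
      have h2 := norm_Gamma_half_add_le w.im
      rw [← hw'] at h2
      calc _ ≤ 3 * Real.exp (-(Real.pi * w.im / 2)) * Real.exp (Real.pi * w.im / 2) := by
            gcongr; nlinarith [sq_nonneg (w.im - y₀)]
        _ = 3 := by rw [mul_assoc, ← Real.exp_add]; simp
        _ ≤ 9 := by norm_num
    · intro w hw
      simp only [hf]
      have hw' : 1 / 2 + w = (1 / 2 + w.im * Complex.I) + 1 := by
        apply Complex.ext <;> simp [hw]
      rw [norm_mul, hexp, hw, hw', Complex.Gamma_add_one _ (fun h => by
        have := congrArg Complex.re h; simp at this), norm_mul]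
      have h2 := norm_Gamma_half_add_le w.im
      have h3 : ‖(1 / 2 + w.im * Complex.I : ℂ)‖ ≤ 1 / 2 + |w.im| := by
        have := Complex.norm_le_abs_re_add_abs_im (1 / 2 + w.im * Complex.I : ℂ)
        have e1 : (1 / 2 + w.im * Complex.I : ℂ).re = 1 / 2 := by simp
        have e2 : (1 / 2 + w.im * Complex.I : ℂ).im = w.im := by simp
        rwa [e1, e2, abs_of_pos (by norm_num : (0 : ℝ) < 1 / 2)] at this
      have h4 := add_mul_exp_neg_sq_le y₀ w.im hy
      calc _ ≤ (1 / 2 + |w.im|) * (3 * Real.exp (-(Real.pi * w.im / 2))) *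
              Real.exp (Real.pi * w.im / 2 + 1 ^ 2 - (w.im - y₀) ^ 2 - 1 * Real.log (2 + y₀)) := by gcongr
        _ = 3 * Real.exp 1 * ((1 / 2 + |w.im|) * Real.exp (-(w.im - y₀) ^ 2)) / (2 + y₀) := by
            rw [show Real.pi * w.im / 2 + 1 ^ 2 - (w.im - y₀) ^ 2 - 1 * Real.log (2 + y₀) =
              Real.pi * w.im / 2 + 1 + -(w.im - y₀) ^ 2 + -Real.log (2 + y₀) by ring,
              Real.exp_add, Real.exp_add, Real.exp_add, Real.exp_neg (Real.log _), hexplog, Real.exp_neg]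
            field_simp
        _ ≤ 3 * Real.exp 1 * (2 + y₀) / (2 + y₀) := by gcongr
        _ = 3 * Real.exp 1 := by field_simp
        _ ≤ 9 := by linarith
  have h1 := hmain (a + y₀ * Complex.I) (by simpa using ha.1) (by simpa using ha.2)
  simp only [hf] at h1
  rw [norm_mul, hexp] at h1
  have e1 : (a + y₀ * Complex.I : ℂ).re = a := by simp
  have e2 : (a + y₀ * Complex.I : ℂ).im = y₀ := by simp
  rw [e1, e2, ← add_assoc] at h1
  have h2 : Real.exp (Real.pi * y₀ / 2 - a * Real.log (2 + y₀)) ≤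
      Real.exp (Real.pi * y₀ / 2 + a ^ 2 - (y₀ - y₀) ^ 2 - a * Real.log (2 + y₀)) :=
    Real.exp_le_exp.2 (by nlinarith [sq_nonneg a])
  have h3 := (mul_le_mul_of_nonneg_left h2 (norm_nonneg (Complex.Gamma (1 / 2 + a + y₀ * Complex.I)))).trans h1
  rw [← le_div_iff₀ (Real.exp_pos _)] at h3
  refine h3.trans (le_of_eq ?_)
  rw [Real.rpow_def_of_pos (by linarith), mul_assoc, ← Real.exp_add, div_eq_mul_inv, ← Real.exp_neg]
  congr 2; ring

lemma norm_Gamma_le_of_nonneg (n : ℕ) : ∀ a y : ℝ, 0 ≤ y → (n : ℝ) ≤ a → a ≤ n + 1 →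
    ‖Complex.Gamma (1 / 2 + a + y * Complex.I)‖ ≤
      9 * (2 + a + y) ^ a * Real.exp (-(Real.pi * y / 2)) := by
  induction n with
  | zero =>
    intro a y hy h0 h1
    simp only [Nat.cast_zero, zero_add] at h0 h1
    refine (norm_Gamma_strip_le ⟨h0, h1⟩ hy).trans ?_
    gcongr
    linarith
  | succ n ih =>
    intro a y hy h0 h1
    push_cast at h0 h1
    have hn : (0 : ℝ) ≤ n := n.cast_nonneg
    have h2 := ih (a - 1) y hy (by linarith) (by linarith)
    have e : (1 / 2 + a + y * Complex.I : ℂ) = (1 / 2 + ((a - 1 : ℝ) : ℂ) + y * Complex.I) + 1 := by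
      push_cast; ring
    have hre : (1 / 2 + ((a - 1 : ℝ) : ℂ) + y * Complex.I : ℂ).re = 1 / 2 + (a - 1) := by simp
    have him : (1 / 2 + ((a - 1 : ℝ) : ℂ) + y * Complex.I : ℂ).im = y := by simp
    rw [e, Complex.Gamma_add_one _ (fun h => by rw [h] at hre; simp at hre; linarith), norm_mul]
    have h3 := Complex.norm_le_abs_re_add_abs_im (1 / 2 + ((a - 1 : ℝ) : ℂ) + y * Complex.I : ℂ)
    rw [hre, him, abs_of_nonneg (by linarith), abs_of_nonneg hy] at h3
    calc _ ≤ (2 + a + y) * (9 * (2 + a + y) ^ (a - 1) * Real.exp (-(Real.pi * y / 2))) := by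
          refine mul_le_mul (by linarith) (h2.trans ?_) (norm_nonneg _) (by linarith)
          gcongr <;> linarith
      _ = _ := by
          have : (2 + a + y) ^ a = (2 + a + y) ^ (a - 1) * (2 + a + y) := by
            rw [← Real.rpow_add_one (by linarith)]; congr 1; ring
          rw [this]; ring

theorem norm_Gamma_le {a : ℝ} (ha : 0 ≤ a) (y : ℝ) :
    ‖Complex.Gamma (1 / 2 + a + y * Complex.I)‖ ≤
      9 * Real.exp (a * Real.log (|y| + a + 2)) * Real.exp (-(Real.pi * |y| / 2)) := by
  have h1 := norm_Gamma_le_of_nonneg ⌊a⌋₊ a |y| (abs_nonneg y) (Nat.floor_le ha)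
    (Nat.lt_floor_add_one a).le
  rw [Real.rpow_def_of_pos (by positivity), mul_comm (Real.log _),
    show 2 + a + |y| = |y| + a + 2 by ring] at h1
  refine le_trans (le_of_eq ?_) h1
  rcases le_total 0 y with hy | hy
  · rw [abs_of_nonneg hy]
  · rw [abs_of_nonpos hy, ← RCLike.norm_conj, ← Complex.Gamma_conj]
    congr 2
    simp [Complex.conj_ofNat]

end

noncomputable section

open DirichletCharacter in
lemma LFunction_conj {N : ℕ} [NeZero N] (χ : DirichletCharacter ℂ N) {s : ℂ} (hs : s ≠ 1) :
    LFunction χ⁻¹ (starRingEnd ℂ s) = starRingEnd ℂ (LFunction χ s) := by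
  have hpc : IsPreconnected ({1}ᶜ : Set ℂ) :=
    (isConnected_compl_singleton_of_one_lt_rank (rank_real_complex ▸ Nat.one_lt_ofNat) _)
      |>.isPreconnected
  have hne : 2 ∈ ({1}ᶜ : Set ℂ) := by simp
  have hconj : ∀ z : ℂ, z ∈ ({1}ᶜ : Set ℂ) → starRingEnd ℂ z ≠ 1 := fun z hz h => by
    refine hz ?_
    rw [Set.mem_singleton_iff, ← Complex.conj_conj z, h, map_one]
  have key : Set.EqOn (LFunction χ⁻¹) (starRingEnd ℂ ∘ LFunction χ ∘ starRingEnd ℂ) {1}ᶜ := by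
    refine AnalyticOnNhd.eqOn_of_preconnected_of_eventuallyEq (𝕜 := ℂ) ?_ ?_ hpc hne ?_
    · exact DifferentiableOn.analyticOnNhd (fun s hs =>
        (differentiableAt_LFunction _ _ (.inl hs)).differentiableWithinAt) isOpen_compl_singleton
    · refine DifferentiableOn.analyticOnNhd (fun s hs => ?_) isOpen_compl_singleton
      have := (differentiableAt_LFunction χ _ (.inl (hconj s hs))).conj_conj
      rw [Complex.conj_conj] at this
      exact this.differentiableWithinAt
    · refine eventually_of_mem ((Complex.continuous_re.isOpen_preimage _ isOpen_Ioi).mem_nhds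
        (by simp : 1 < (2 : ℂ).re)) fun z (hz : 1 < z.re) => ?_
      simp only [Function.comp_apply]
      rw [LFunction_eq_LSeries _ hz, LFunction_eq_LSeries _ (by simpa using hz), LSeries, LSeries,
        Complex.conj_tsum]
      refine tsum_congr fun n => ?_
      rcases eq_or_ne n 0 with rfl | hn
      · simp
      · rw [LSeries.term_of_ne_zero hn, LSeries.term_of_ne_zero hn, map_div₀, ← MulChar.star_apply' χ,
          RCLike.star_def]
        congr 1
        rw [Complex.cpow_conj _ _ (by rw [Complex.natCast_arg]; exact Real.pi_pos.ne), Complex.conj_conj,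
          Complex.conj_natCast]
  have h1 : starRingEnd ℂ s ∈ ({1}ᶜ : Set ℂ) := fun h => hs (by
    rw [Set.mem_singleton_iff] at h; rw [← Complex.conj_conj s, h, map_one])
  have := key h1
  simpa using this

lemma norm_cexp_mul_I_le (z : ℂ) : ‖Complex.exp (z * Complex.I)‖ ≤ Real.exp |z.im| := by
  rw [Complex.norm_exp]
  refine Real.exp_le_exp.2 ?_
  simpa using neg_le_abs z.im

lemma norm_ccos_le (z : ℂ) : ‖Complex.cos z‖ ≤ Real.exp |z.im| := by
  rw [Complex.cos, norm_div, Complex.norm_ofNat]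
  have h1 := norm_cexp_mul_I_le z
  have h2 := norm_cexp_mul_I_le (-z)
  rw [Complex.neg_im, abs_neg] at h2
  have := norm_add_le (Complex.exp (z * Complex.I)) (Complex.exp (-z * Complex.I))
  linarith

lemma norm_csin_le (z : ℂ) : ‖Complex.sin z‖ ≤ Real.exp |z.im| := by
  rw [Complex.sin, norm_div, Complex.norm_ofNat, norm_mul, Complex.norm_I, mul_one]
  have h1 := norm_cexp_mul_I_le z
  have h2 := norm_cexp_mul_I_le (-z)
  rw [Complex.neg_im, abs_neg] at h2
  have := norm_sub_le (Complex.exp (-z * Complex.I)) (Complex.exp (z * Complex.I))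
  linarith

lemma inv_even_iff {N : ℕ} (χ : DirichletCharacter ℂ N) : χ⁻¹.Even ↔ χ.Even := by
  simp [DirichletCharacter.Even, MulChar.inv_apply_eq_inv']

open DirichletCharacter in
/-- Functional equation of a primitive Dirichlet `L`-function in asymmetric form. -/
lemma LFunction_one_sub_eq {N : ℕ} [NeZero N] {χ : DirichletCharacter ℂ N} (hχ : χ.IsPrimitive)
    {s : ℂ} (hs : 0 < s.re) (h1 : s ≠ 1 ∨ N ≠ 1) :
    LFunction χ (1 - s) = N ^ (s - 1 / 2) * rootNumber χ * LFunction χ⁻¹ s * Complex.Gammaℂ s *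
      (if χ.Even then Complex.cos (Real.pi * s / 2) else Complex.sin (Real.pi * s / 2)) := by
  have hs0 : ∀ n : ℕ, s ≠ -n := fun n h => by
    rw [h] at hs
    have : (0 : ℝ) ≤ n := n.cast_nonneg
    simp at hs; linarith
  have hsne : s ≠ 0 := by simpa using hs0 0
  rw [LFunction_eq_completed_div_gammaFactor χ (1 - s) (h1.imp_left fun h => sub_ne_zero.2 h.symm),
    hχ.completedLFunction_one_sub]
  have h2 := LFunction_eq_completed_div_gammaFactor χ⁻¹ s (.inl hsne)
  by_cases he : χ.Even
  · have he' := (inv_even_iff χ).2 he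
    have hg : Complex.Gammaℝ s ≠ 0 := Complex.Gammaℝ_ne_zero_of_re_pos hs
    rw [he'.gammaFactor_def, eq_div_iff hg] at h2
    rw [← h2, he.gammaFactor_def, div_eq_mul_inv, Complex.inv_Gammaℝ_one_sub hs0, if_pos he]
    field_simp
  · have ho : χ.Odd := χ.even_or_odd.resolve_left he
    have ho' : χ⁻¹.Odd := χ⁻¹.even_or_odd.resolve_left (fun h => he ((inv_even_iff χ).1 h))
    have hg : Complex.Gammaℝ (s + 1) ≠ 0 := Complex.Gammaℝ_ne_zero_of_re_pos (by simp; linarith)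
    rw [ho'.gammaFactor_def, eq_div_iff hg] at h2
    rw [← h2, ho.gammaFactor_def, div_eq_mul_inv, show (1 - s + 1 : ℂ) = 2 - s by ring,
      Complex.inv_Gammaℝ_two_sub hs0, if_neg he]
    field_simp

open DirichletCharacter in
lemma exists_LFunction_fold_of_isPrimitive {N : ℕ} [NeZero N] {χ : DirichletCharacter ℂ N}
    (hχ : χ.IsPrimitive) : ∃ C : ℝ, 1 ≤ C ∧ ∀ a y : ℝ, 0 ≤ a → (a ≠ 1 / 2 ∨ y ≠ 0 ∨ N ≠ 1) →
      ‖LFunction χ (1 / 2 - a + y * Complex.I)‖ ≤ ‖LFunction χ (1 / 2 + a + y * Complex.I)‖ *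
        Real.exp (C + C * a * Real.log (|y| + a + 2)) := by
  have hN : (1 : ℝ) ≤ N := by exact_mod_cast NeZero.one_le
  have hN0 : (0 : ℝ) < N := by linarith
  have hlogN : 0 ≤ Real.log N := Real.log_nonneg hN
  have hlog2 : 0 < Real.log 2 := Real.log_pos one_lt_two
  set R : ℝ := ‖rootNumber χ‖ with hR
  have hR0 : 0 ≤ R := norm_nonneg _
  refine ⟨18 * R + Real.log N / Real.log 2 + 1, by have : 0 ≤ Real.log N / Real.log 2 := by positivity
                                                   linarith, fun a y ha hay => ?_⟩
  set s : ℂ := 1 / 2 + a - y * Complex.I with hs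
  have hre : s.re = 1 / 2 + a := by simp [hs]
  have him : s.im = -y := by simp [hs]
  have e1 : (1 / 2 - a + y * Complex.I : ℂ) = 1 - s := by rw [hs]; ring
  have e2 : starRingEnd ℂ (1 / 2 + a + y * Complex.I : ℂ) = s := by
    apply Complex.ext <;> simp [hs, Complex.conj_ofNat]
  have hs1 : (1 / 2 + a + y * Complex.I : ℂ) ≠ 1 ∨ N ≠ 1 := by
    by_cases hN1 : N = 1
    · left
      intro h
      have h1 := congrArg Complex.re h
      have h2 := congrArg Complex.im h
      simp at h1 h2
      rcases hay with hay | hay | hay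
      · exact hay (by linarith)
      · exact hay h2
      · exact hay hN1
    · exact .inr hN1
  have hs1' : s ≠ 1 ∨ N ≠ 1 := hs1.imp_left fun h h' => h (by
    rw [← Complex.conj_conj (1 / 2 + a + y * Complex.I), e2, h', map_one])
  have hL : ‖LFunction χ⁻¹ s‖ = ‖LFunction χ (1 / 2 + a + y * Complex.I)‖ := by
    by_cases h : (1 / 2 + a + y * Complex.I : ℂ) = 1
    · have hs1 : s = 1 := by rw [← e2, h, map_one]
      have hN1 : N ≠ 1 := hs1'.resolve_left (fun h => h hs1)
      have hχ1 : χ ≠ 1 := fun h => hN1 (by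
        rw [IsPrimitive, h, conductor_one] at hχ
        · exact hχ.symm)
      rw [h, hs1]
      have hcont : ContinuousAt (fun z : ℂ => LFunction χ⁻¹ z) 1 :=
        (differentiable_LFunction (inv_ne_one.2 hχ1)).continuous.continuousAt
      have hcont2 : ContinuousAt (fun z : ℂ => LFunction χ z) 1 :=
        (differentiable_LFunction hχ1).continuous.continuousAt
      have t1 : Tendsto (fun z : ℂ => ‖LFunction χ⁻¹ (starRingEnd ℂ z)‖) (nhdsWithin 1 {1}ᶜ)
          (nhds ‖LFunction χ⁻¹ 1‖) := by
        have : Tendsto (fun z : ℂ => starRingEnd ℂ z) (nhds 1) (nhds 1) := by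
          have := Complex.continuous_conj.tendsto (1 : ℂ)
          rwa [map_one] at this
        exact ((hcont.tendsto.comp this).norm).mono_left nhdsWithin_le_nhds
      have t2 : Tendsto (fun z : ℂ => ‖LFunction χ z‖) (nhdsWithin 1 {1}ᶜ)
          (nhds ‖LFunction χ 1‖) := hcont2.tendsto.norm.mono_left nhdsWithin_le_nhds
      refine tendsto_nhds_unique t1 (t2.congr' ?_)
      filter_upwards [self_mem_nhdsWithin] with z hz
      rw [LFunction_conj χ hz, RCLike.norm_conj]
    · rw [← e2, LFunction_conj χ h, RCLike.norm_conj]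
  have hpi : (Real.pi * s / 2 : ℂ).im = -(Real.pi * y / 2) := by
    rw [show (Real.pi * s / 2 : ℂ) = ((Real.pi / 2 : ℝ) : ℂ) * s by push_cast; ring,
      Complex.im_ofReal_mul, him]
    ring
  have habs : |(Real.pi * s / 2 : ℂ).im| = Real.pi * |y| / 2 := by
    rw [hpi, abs_neg, abs_div, abs_mul, abs_of_pos Real.pi_pos, abs_two]
  have htrig : ‖(if χ.Even then Complex.cos (Real.pi * s / 2) else Complex.sin (Real.pi * s / 2))‖ ≤
      Real.exp (Real.pi * |y| / 2) := by
    rw [← habs]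
    split_ifs
    · exact norm_ccos_le _
    · exact norm_csin_le _
  have hG : ‖Complex.Gammaℂ s‖ ≤ 2 * (9 * Real.exp (a * Real.log (|y| + a + 2)) *
      Real.exp (-(Real.pi * |y| / 2))) := by
    have h1 := norm_Gamma_le ha (-y)
    rw [abs_neg, show (1 / 2 + a + ((-y : ℝ) : ℂ) * Complex.I : ℂ) = s by rw [hs]; push_cast; ring] at h1
    rw [Complex.Gammaℂ_def, norm_mul, norm_mul, Complex.norm_ofNat]
    have h2 : ‖(2 * Real.pi : ℂ) ^ (-s)‖ ≤ 1 := by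
      rw [show (2 * Real.pi : ℂ) = ((2 * Real.pi : ℝ) : ℂ) by push_cast; rfl,
        Complex.norm_cpow_eq_rpow_re_of_pos (by positivity)]
      refine Real.rpow_le_one_of_one_le_of_nonpos (by linarith [Real.pi_gt_three]) ?_
      rw [Complex.neg_re, hre]; linarith
    calc _ ≤ 2 * 1 * ‖Complex.Gamma s‖ := by gcongr
      _ ≤ _ := by rw [mul_one]; gcongr
  have hNp : ‖(N : ℂ) ^ (s - 1 / 2)‖ = Real.exp (a * Real.log N) := by
    rw [show (N : ℂ) = ((N : ℝ) : ℂ) by simp, Complex.norm_cpow_eq_rpow_re_of_pos hN0,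
      Real.rpow_def_of_pos hN0, mul_comm]
    congr 2
    simp [hre]
  rw [e1, LFunction_one_sub_eq hχ (by rw [hre]; linarith) hs1', norm_mul, norm_mul, norm_mul, norm_mul, hL,
    hNp, ← hR]
  set X := ‖LFunction χ (1 / 2 + a + y * Complex.I)‖ with hX
  have hll : Real.log 2 ≤ Real.log (|y| + a + 2) :=
    Real.log_le_log (by norm_num) (by linarith [abs_nonneg y])
  calc _ ≤ Real.exp (a * Real.log N) * R * X * (2 * (9 * Real.exp (a * Real.log (|y| + a + 2)) *
      Real.exp (-(Real.pi * |y| / 2)))) * Real.exp (Real.pi * |y| / 2) := by gcongr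
    _ = X * ((18 * R) * Real.exp (a * Real.log N + a * Real.log (|y| + a + 2))) := by
        rw [Real.exp_neg, Real.exp_add]
        field_simp
        ring
    _ ≤ X * (Real.exp (18 * R) * Real.exp (a * Real.log N + a * Real.log (|y| + a + 2))) := by
        gcongr
        linarith [Real.add_one_le_exp (18 * R)]
    _ ≤ _ := by
        rw [← Real.exp_add]
        have h3 : 0 ≤ Real.log N / Real.log 2 := by positivity
        have h5 : a * Real.log N ≤ Real.log N / Real.log 2 * a * Real.log (|y| + a + 2) := by
          calc a * Real.log N = Real.log N / Real.log 2 * a * Real.log 2 := by field_simp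
            _ ≤ _ := by gcongr
        have h6 : 0 ≤ 18 * R * a * Real.log (|y| + a + 2) := by
          have := hlog2.le.trans hll
          positivity
        refine mul_le_mul_of_nonneg_left (Real.exp_le_exp.2 ?_) (norm_nonneg _)
        nlinarith

end

noncomputable section

lemma norm_one_sub_mul_cpow_fold {p : ℕ} (hp : p.Prime) {c : ℂ} (hc : ‖c‖ ≤ 1) {a y : ℝ} (ha : 0 ≤ a) :
    ‖1 - c * (p : ℂ) ^ (-(1 / 2 - a + y * Complex.I))‖ ≤
      ‖1 - c * (p : ℂ) ^ (-(1 / 2 + a + y * Complex.I))‖ * Real.exp (10 + a * Real.log p) := by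
  have hp2 : (2 : ℝ) ≤ p := by exact_mod_cast hp.two_le
  have hp0 : (0 : ℝ) < p := by linarith
  have hn : ∀ z : ℂ, ‖(p : ℂ) ^ z‖ = Real.exp (z.re * Real.log p) := fun z => by
    rw [show (p : ℂ) = ((p : ℝ) : ℂ) by simp, Complex.norm_cpow_eq_rpow_re_of_pos hp0,
      Real.rpow_def_of_pos hp0, mul_comm]
  have hlog : 0 ≤ Real.log p := Real.log_nonneg (by linarith)
  have h1 : ‖(p : ℂ) ^ (-(1 / 2 - a + y * Complex.I))‖ ≤ Real.exp (a * Real.log p) := by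
    rw [hn]
    refine Real.exp_le_exp.2 ?_
    have : (-(1 / 2 - a + y * Complex.I) : ℂ).re = a - 1 / 2 := by simp
    rw [this]; nlinarith
  have h2 : ‖(p : ℂ) ^ (-(1 / 2 + a + y * Complex.I))‖ ≤ 3 / 4 := by
    rw [hn]
    have : (-(1 / 2 + a + y * Complex.I) : ℂ).re = -(1 / 2 + a) := by simp
    rw [this]
    have h3 : Real.log 2 ≤ Real.log p := Real.log_le_log (by norm_num) hp2
    have h4 := Real.log_two_gt_d9
    have h5 : 0.6931471803 / 2 ≤ (1 / 2 + a) * Real.log p := by nlinarith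
    have h6 := Real.add_one_le_exp ((1 / 2 + a) * Real.log p)
    rw [neg_mul, Real.exp_neg]
    calc _ ≤ ((4 : ℝ) / 3)⁻¹ := by gcongr; norm_num at h5 ⊢; linarith
      _ = _ := by norm_num
  have h3 : 1 ≤ Real.exp (a * Real.log p) := Real.one_le_exp (by positivity)
  have h4 : ‖1 - c * (p : ℂ) ^ (-(1 / 2 - a + y * Complex.I))‖ ≤ 2 * Real.exp (a * Real.log p) := by
    refine (norm_sub_le _ _).trans ?_
    rw [norm_one, norm_mul]
    have : ‖c‖ * ‖(p : ℂ) ^ (-(1 / 2 - a + y * Complex.I))‖ ≤ 1 * Real.exp (a * Real.log p) := by gcongr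
    linarith
  have h5 : 1 / 4 ≤ ‖1 - c * (p : ℂ) ^ (-(1 / 2 + a + y * Complex.I))‖ := by
    have := norm_sub_norm_le (1 : ℂ) (c * (p : ℂ) ^ (-(1 / 2 + a + y * Complex.I)))
    rw [norm_one, norm_mul] at this
    have h6 : ‖c‖ * ‖(p : ℂ) ^ (-(1 / 2 + a + y * Complex.I))‖ ≤ 1 * (3 / 4) := by gcongr
    linarith
  have h6 : (8 : ℝ) ≤ Real.exp 10 := by linarith [Real.add_one_le_exp (10 : ℝ)]
  rw [Real.exp_add]
  calc _ ≤ 1 / 4 * (8 * Real.exp (a * Real.log p)) := by linarith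
    _ ≤ _ := by gcongr

lemma prod_fold {ι : Type} (S : Finset ι) (f g e : ι → ℝ) (hf : ∀ i ∈ S, 0 ≤ f i)
    (h : ∀ i ∈ S, f i ≤ g i * Real.exp (e i)) :
    ∏ i ∈ S, f i ≤ (∏ i ∈ S, g i) * Real.exp (∑ i ∈ S, e i) := by
  rw [Real.exp_sum, ← Finset.prod_mul_distrib]
  exact Finset.prod_le_prod hf h

open DirichletCharacter in
lemma exists_LFunction_fold {q : ℕ} [NeZero q] (χ : DirichletCharacter ℂ q) :
    ∃ C : ℝ, 1 ≤ C ∧ ∀ a y : ℝ, 0 ≤ a → (a ≠ 1 / 2 ∨ y ≠ 0 ∨ χ ≠ 1) →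
      ‖LFunction χ (1 / 2 - a + y * Complex.I)‖ ≤ ‖LFunction χ (1 / 2 + a + y * Complex.I)‖ *
        Real.exp (C + C * a * Real.log (|y| + a + 2)) := by
  have : NeZero χ.conductor := ⟨χ.conductor_ne_zero⟩
  obtain ⟨C, hC1, hC⟩ := exists_LFunction_fold_of_isPrimitive χ.primitiveCharacter_isPrimitive
  set D : ℝ := ∑ p ∈ q.primeFactors, (10 + Real.log p / Real.log 2) with hD
  have hlog2 : 0 < Real.log 2 := Real.log_pos one_lt_two
  have hD0 : 0 ≤ D := Finset.sum_nonneg fun p hp => by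
    have : 0 ≤ Real.log p := Real.log_natCast_nonneg p
    positivity
  refine ⟨C + D, by linarith, fun a y ha hay => ?_⟩
  have hprim : χ ≠ 1 → χ.primitiveCharacter ≠ 1 := fun h h' => h (by
    rw [← changeLevel_primitiveCharacter χ, h', changeLevel_one])
  have hcond : χ ≠ 1 → χ.conductor ≠ 1 := fun h h' => h (eq_one_iff_conductor_eq_one.2 h')
  have h1 : χ.primitiveCharacter ≠ 1 ∨ (1 / 2 - a + y * Complex.I : ℂ) ≠ 1 := by
    right
    intro h
    have := congrArg Complex.re h
    simp at this; linarith
  have h2 : χ.primitiveCharacter ≠ 1 ∨ (1 / 2 + a + y * Complex.I : ℂ) ≠ 1 := by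
    by_cases hχ : χ = 1
    · right
      intro h
      have e1 := congrArg Complex.re h
      have e2 := congrArg Complex.im h
      simp at e1 e2
      rcases hay with hay | hay | hay
      · exact hay (by linarith)
      · exact hay e2
      · exact hay hχ
    · exact .inl (hprim hχ)
  have e1 := LFunction_changeLevel χ.conductor_dvd_level χ.primitiveCharacter h1
  have e2 := LFunction_changeLevel χ.conductor_dvd_level χ.primitiveCharacter h2
  rw [changeLevel_primitiveCharacter] at e1 e2
  rw [e1, e2, norm_mul, norm_mul, norm_prod, norm_prod]
  have h3 := hC a y ha (by
    rcases hay with h | h | h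
    · exact .inl h
    · exact .inr (.inl h)
    · exact .inr (.inr (hcond h)))
  have h4 := prod_fold q.primeFactors
    (fun p => ‖1 - χ.primitiveCharacter p * (p : ℂ) ^ (-(1 / 2 - a + y * Complex.I))‖)
    (fun p => ‖1 - χ.primitiveCharacter p * (p : ℂ) ^ (-(1 / 2 + a + y * Complex.I))‖)
    (fun p => 10 + a * Real.log p) (fun _ _ => norm_nonneg _)
    (fun p hp => norm_one_sub_mul_cpow_fold (Nat.prime_of_mem_primeFactors hp)
      (χ.primitiveCharacter.norm_le_one _) ha)
  have hll : Real.log 2 ≤ Real.log (|y| + a + 2) :=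
    Real.log_le_log (by norm_num) (by linarith [abs_nonneg y])
  have h5 : ∑ p ∈ q.primeFactors, (10 + a * Real.log p) ≤ D + D * a * Real.log (|y| + a + 2) := by
    rw [hD, Finset.sum_mul, Finset.sum_mul, ← Finset.sum_add_distrib]
    refine Finset.sum_le_sum fun p _ => ?_
    have h6 : 0 ≤ Real.log p := Real.log_natCast_nonneg p
    have h7 : 0 ≤ Real.log p / Real.log 2 := by positivity
    have h8 : a * Real.log p ≤ Real.log p / Real.log 2 * a * Real.log (|y| + a + 2) := by
      calc a * Real.log p = Real.log p / Real.log 2 * a * Real.log 2 := by field_simp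
        _ ≤ _ := by gcongr
    have h9 : 0 ≤ 10 * a * Real.log (|y| + a + 2) := by
      have := hlog2.le.trans hll
      positivity
    nlinarith
  calc _ ≤ (‖LFunction χ.primitiveCharacter (1 / 2 + a + y * Complex.I)‖ *
        Real.exp (C + C * a * Real.log (|y| + a + 2))) * ((∏ p ∈ q.primeFactors,
          ‖1 - χ.primitiveCharacter p * (p : ℂ) ^ (-(1 / 2 + a + y * Complex.I))‖) *
            Real.exp (D + D * a * Real.log (|y| + a + 2))) := by
        refine mul_le_mul h3 (h4.trans ?_) (Finset.prod_nonneg fun _ _ => norm_nonneg _) (by positivity)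
        gcongr
    _ = _ := by
        rw [show (C + D) + (C + D) * a * Real.log (|y| + a + 2) =
          (C + C * a * Real.log (|y| + a + 2)) + (D + D * a * Real.log (|y| + a + 2)) by ring,
          Real.exp_add (C + _)]
        ring

/-- The `L`-function of `χ`, with its pole removed. -/
def entireL {q : ℕ} [NeZero q] (χ : DirichletCharacter ℂ q) : ℂ → ℂ :=
  if χ = 1 then DirichletCharacter.LFunctionTrivChar₁ q else DirichletCharacter.LFunction χ

/-- The order of the pole of the `L`-function of `χ` at `1`. -/
def poleOrder {q : ℕ} (χ : DirichletCharacter ℂ q) : ℕ := if χ = 1 then 1 else 0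

variable {q : ℕ} [NeZero q] (χ : DirichletCharacter ℂ q)

lemma differentiable_entireL : Differentiable ℂ (entireL χ) := by
  unfold entireL
  split_ifs with h
  · exact DirichletCharacter.differentiable_LFunctionTrivChar₁ q
  · exact DirichletCharacter.differentiable_LFunction h

lemma entireL_eq {s : ℂ} (hs : s ≠ 1) :
    entireL χ s = (s - 1) ^ poleOrder χ * DirichletCharacter.LFunction χ s := by
  unfold entireL poleOrder
  split_ifs with h
  · rw [h, pow_one]
    exact Function.update_of_ne hs _ _
  · simp

lemma entireL_one_ne_zero : entireL χ 1 ≠ 0 := by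
  unfold entireL
  split_ifs with h
  · exact DirichletCharacter.LFunctionTrivChar₁_apply_one_ne_zero q
  · exact DirichletCharacter.LFunction_ne_zero_of_one_le_re χ (.inl h) (by simp)

lemma entireL_ne_zero (hGRH : GRHmod q) {s : ℂ} (hs : 1 / 2 < s.re) : entireL χ s ≠ 0 := by
  rcases eq_or_ne s 1 with rfl | h1
  · exact entireL_one_ne_zero χ
  rw [entireL_eq χ h1]
  refine mul_ne_zero (pow_ne_zero _ (sub_ne_zero.2 h1)) fun h0 => ?_
  rcases lt_or_ge s.re 1 with h | h
  · have := hGRH χ s h0 (by linarith) h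
    linarith
  · exact DirichletCharacter.LFunction_ne_zero_of_one_le_re χ (.inr h1) h h0

lemma exists_entireL_fold : ∃ C : ℝ, 1 ≤ C ∧ ∀ a y : ℝ, 0 ≤ a →
    ‖entireL χ (1 / 2 - a + y * Complex.I)‖ ≤ ‖entireL χ (1 / 2 + a + y * Complex.I)‖ *
      Real.exp (C + C * a * Real.log (|y| + a + 2)) := by
  obtain ⟨C, hC1, hC⟩ := exists_LFunction_fold χ
  by_cases hχ : χ = 1
  swap
  · refine ⟨C, hC1, fun a y ha => ?_⟩
    simpa only [entireL, if_neg hχ] using hC a y ha (.inr (.inr hχ))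
  have hcont := (differentiable_entireL χ).continuous
  obtain ⟨r, hr0, hr⟩ : ∃ r > 0, ∀ z : ℂ, dist z 1 < r → ‖entireL χ 1‖ / 2 < ‖entireL χ z‖ := by
    have h1 : ‖entireL χ 1‖ / 2 < ‖entireL χ 1‖ := by
      have := norm_pos_iff.2 (entireL_one_ne_zero χ); linarith
    exact Metric.eventually_nhds_iff.1 (hcont.norm.continuousAt.eventually (lt_mem_nhds h1))
  obtain ⟨M, hM⟩ := (isCompact_closedBall (0 : ℂ) r).exists_bound_of_continuousOn hcont.continuousOn
  have hc0 := norm_pos_iff.2 (entireL_one_ne_zero χ)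
  set c := ‖entireL χ 1‖ / 2 with hc
  have hcp : 0 < c := by positivity
  have hM0 : 0 ≤ M := (norm_nonneg _).trans (hM 0 (by simp [hr0.le]))
  refine ⟨C + M / c + (4 + 4 / r), by have : 0 ≤ M / c := by positivity
                                      have : 0 ≤ 4 / r := by positivity
                                      linarith, fun a y ha => ?_⟩
  have hll : 0 ≤ Real.log (|y| + a + 2) := Real.log_nonneg (by linarith [abs_nonneg y])
  have hMc : 0 ≤ M / c := by positivity
  have h4r : 0 ≤ 4 / r := by positivity
  have hexp0 : 0 ≤ (C + M / c + (4 + 4 / r)) * a * Real.log (|y| + a + 2) := by positivity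
  have hexp1 : 0 ≤ (M / c + (4 + 4 / r)) * a * Real.log (|y| + a + 2) := by positivity
  set s : ℂ := 1 / 2 + a + y * Complex.I with hs
  set s' : ℂ := 1 / 2 - a + y * Complex.I with hs'
  have hconj : s' = 1 - starRingEnd ℂ s := by
    apply Complex.ext <;> simp [hs, hs', Complex.conj_ofNat]
    ring
  rcases lt_or_ge (dist s 1) r with hlt | hge
  · have h1 : ‖entireL χ s'‖ ≤ M := by
      refine hM _ ?_
      rw [mem_closedBall_zero_iff, hconj, ← RCLike.norm_conj, map_sub, map_one, Complex.conj_conj,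
        norm_sub_rev, ← dist_eq_norm]
      exact hlt.le
    calc ‖entireL χ s'‖ ≤ c * (M / c) := by rw [mul_div_cancel₀ _ hcp.ne']; exact h1
      _ ≤ ‖entireL χ s‖ * Real.exp (M / c) := by
          gcongr
          · exact (hr s hlt).le
          · linarith [Real.add_one_le_exp (M / c)]
      _ ≤ _ := by gcongr; linarith
  · have hs1 : s ≠ 1 := fun h => by rw [h, dist_self] at hge; linarith
    have hs1' : s' ≠ 1 := fun h => by
      have := congrArg Complex.re h
      simp [hs'] at this; linarith
    have hcondn : a ≠ 1 / 2 ∨ y ≠ 0 ∨ χ ≠ 1 := by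
      by_contra! hcon
      refine hs1 ?_
      rw [hs, hcon.1, hcon.2.1]; push_cast; ring
    have h1 := hC a y ha hcondn
    rw [entireL_eq χ hs1, entireL_eq χ hs1', poleOrder, if_pos hχ, pow_one, pow_one, norm_mul, norm_mul]
    have h2 : ‖s' - 1‖ ≤ ‖s - 1‖ * (4 + 4 / r) := by
      have hge : r ≤ ‖s - 1‖ := by rwa [dist_eq_norm] at hge
      have h3 : ‖s' - 1‖ ≤ ‖s - 1‖ + 2 * a := by
        have : s' - 1 = (s - 1) - ((2 * a : ℝ) : ℂ) := by rw [hs, hs']; push_cast; ring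
        rw [this]
        refine (norm_sub_le _ _).trans (le_of_eq ?_)
        rw [Complex.norm_real, Real.norm_of_nonneg (by positivity)]
      rcases le_total a 2 with h | h
      · have : 4 ≤ ‖s - 1‖ * (4 / r) := by
          rw [← mul_div_assoc, le_div_iff₀ hr0]; linarith
        nlinarith [norm_nonneg (s - 1)]
      · have h4 : a - 1 / 2 ≤ ‖s - 1‖ := by
          refine le_trans (le_of_eq ?_) (Complex.re_le_norm (s - 1))
          simp [hs]; ring
        have : 0 ≤ ‖s - 1‖ * (4 / r) := by positivity
        nlinarith
    calc _ ≤ (‖s - 1‖ * (4 + 4 / r)) * (‖DirichletCharacter.LFunction χ s‖ *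
          Real.exp (C + C * a * Real.log (|y| + a + 2))) := by gcongr
      _ ≤ (‖s - 1‖ * Real.exp (4 + 4 / r)) * (‖DirichletCharacter.LFunction χ s‖ *
          Real.exp (C + C * a * Real.log (|y| + a + 2))) := by
          gcongr
          linarith [Real.add_one_le_exp (4 + 4 / r)]
      _ = ‖s - 1‖ * ‖DirichletCharacter.LFunction χ s‖ *
          Real.exp ((4 + 4 / r) + (C + C * a * Real.log (|y| + a + 2))) := by
          rw [Real.exp_add (4 + 4 / r)]; ring
      _ ≤ _ := by
          refine mul_le_mul_of_nonneg_left (Real.exp_le_exp.2 ?_) (by positivity)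
          have : (C + M / c + (4 + 4 / r)) * a * Real.log (|y| + a + 2) =
            C * a * Real.log (|y| + a + 2) + (M / c + (4 + 4 / r)) * a * Real.log (|y| + a + 2) := by ring
          linarith

end

noncomputable section

lemma exists_norm_sum_Icc_sub_le_of_periodic {f : ℕ → ℂ} {q : ℕ} (hq : q ≠ 0) (hf : Function.Periodic f q) :
    ∃ (c : ℂ) (B : ℝ), 0 ≤ B ∧ ∀ n : ℕ, ‖∑ k ∈ Finset.Icc 1 n, f k - c * n‖ ≤ B := by
  have hd : ∀ n, ∑ k ∈ Finset.range q, f (n + k + 1) = ∑ k ∈ Finset.range q, f (k + 1) := by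
    intro n
    induction n with
    | zero => simp
    | succ n ih =>
      rw [← ih]
      have h1 := Finset.sum_range_succ (fun k => f (n + k + 1)) q
      have h2 := Finset.sum_range_succ' (fun k => f (n + k + 1)) q
      have h3 : f (n + q + 1) = f (n + 0 + 1) := by
        rw [show n + q + 1 = n + 0 + 1 + q by ring, hf]
      rw [h1, h3] at h2
      rw [add_right_cancel h2]
      exact Finset.sum_congr rfl fun k _ => by congr 1; ring
  set c : ℂ := (∑ k ∈ Finset.range q, f (k + 1)) / q with hc
  have hS : ∀ n, ∑ k ∈ Finset.Icc 1 n, f k = ∑ k ∈ Finset.range n, f (k + 1) := fun n => by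
    induction n with
    | zero => simp
    | succ n ih => rw [Finset.sum_Icc_succ_top (by omega), ih, Finset.sum_range_succ]
  have hg : Function.Periodic (fun n : ℕ => ∑ k ∈ Finset.Icc 1 n, f k - c * n) q := fun n => by
    have hq' : (q : ℂ) ≠ 0 := by exact_mod_cast hq
    have : c * q = ∑ k ∈ Finset.range q, f (k + 1) := div_mul_cancel₀ _ hq'
    simp only [hS]
    rw [Finset.sum_range_add, hd, ← this]
    push_cast; ring
  refine ⟨c, ∑ n ∈ Finset.range q, ‖∑ k ∈ Finset.Icc 1 n, f k - c * n‖,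
    Finset.sum_nonneg fun _ _ => norm_nonneg _, fun n => ?_⟩
  have h1 := hg.map_mod_nat n
  rw [← h1]
  exact Finset.single_le_sum (f := fun n : ℕ => ‖∑ k ∈ Finset.Icc 1 n, f k - c * n‖)
    (fun _ _ => norm_nonneg _) (Finset.mem_range.2 (Nat.mod_lt _ (Nat.pos_of_ne_zero hq)))

lemma exists_norm_sum_floor_sub_le_of_periodic {f : ℕ → ℂ} {q : ℕ} (hq : q ≠ 0) (hf : Function.Periodic f q) :
    ∃ (c : ℂ) (B : ℝ), 0 ≤ B ∧ ∀ t : ℝ, 0 ≤ t → ‖∑ k ∈ Finset.Icc 1 ⌊t⌋₊, f k - c * t‖ ≤ B := by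
  obtain ⟨c, B, hB0, hB⟩ := exists_norm_sum_Icc_sub_le_of_periodic hq hf
  refine ⟨c, B + ‖c‖, by positivity, fun t ht => ?_⟩
  have h1 : ∑ k ∈ Finset.Icc 1 ⌊t⌋₊, f k - c * t =
      (∑ k ∈ Finset.Icc 1 ⌊t⌋₊, f k - c * ⌊t⌋₊) - c * ((t - ⌊t⌋₊ : ℝ) : ℂ) := by
    push_cast; ring
  have h2 : ‖((t - ⌊t⌋₊ : ℝ) : ℂ)‖ ≤ 1 := by
    rw [Complex.norm_real, Real.norm_of_nonneg (by linarith [Nat.floor_le ht])]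
    linarith [Nat.lt_floor_add_one t]
  rw [h1]
  refine (norm_sub_le _ _).trans (add_le_add (hB _) ?_)
  rw [norm_mul]
  nlinarith [norm_nonneg c]

/-- The integral `∫₁^∞ E(t) t^{-s-1} dt` for a bounded function `E`. -/
def tailMellin (E : ℝ → ℂ) (s : ℂ) : ℂ := ∫ t in Set.Ioi (1 : ℝ), E t * (t : ℂ) ^ (-(s + 1))

lemma norm_tailMellin_le {E : ℝ → ℂ} {B : ℝ} (hB : ∀ t, 0 ≤ t → ‖E t‖ ≤ B) {s : ℂ} (hs : 1 / 2 ≤ s.re) :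
    ‖tailMellin E s‖ ≤ 2 * B := by
  have hB0 : 0 ≤ B := (norm_nonneg _).trans (hB 0 le_rfl)
  have hInt : IntegrableOn (fun t : ℝ => B * t ^ (-(3 / 2) : ℝ)) (Set.Ioi 1) :=
    (integrableOn_Ioi_rpow_of_lt (by norm_num) one_pos).const_mul B
  have h := norm_integral_le_of_norm_le (f := fun t : ℝ => E t * (t : ℂ) ^ (-(s + 1))) hInt (by
    filter_upwards [ae_restrict_mem measurableSet_Ioi] with t ht
    have ht1 : (1 : ℝ) < t := ht
    rw [norm_mul, Complex.norm_cpow_eq_rpow_re_of_pos (by linarith)]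
    gcongr
    · exact hB t (by linarith)
    · exact ht1.le
    · simp only [Complex.neg_re, Complex.add_re, Complex.one_re]; linarith)
  refine h.trans (le_of_eq ?_)
  rw [integral_const_mul, integral_Ioi_rpow_of_lt (by norm_num) one_pos]
  norm_num
  ring

lemma differentiableAt_tailMellin {E : ℝ → ℂ} {B : ℝ} (hE : Measurable E) (hB : ∀ t, 0 ≤ t → ‖E t‖ ≤ B) {s : ℂ}
    (hs : 0 < s.re) : DifferentiableAt ℂ (tailMellin E) s := by
  have hB0 : 0 ≤ B := (norm_nonneg _).trans (hB 0 le_rfl)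
  set f : ℝ → ℂ := (Set.Ioi (1 : ℝ)).indicator E with hf
  have hfB : ∀ t, ‖f t‖ ≤ B := fun t => by
    by_cases h : t ∈ Set.Ioi (1 : ℝ)
    · rw [hf, Set.indicator_of_mem h]; exact hB t (by have : (1 : ℝ) < t := h; linarith)
    · rw [hf, Set.indicator_of_notMem h]; simpa
  have hfm : Measurable f := hE.indicator measurableSet_Ioi
  have hloc : LocallyIntegrableOn f (Set.Ioi 0) := by
    refine LocallyIntegrable.locallyIntegrableOn ?_ _
    refine (locallyIntegrable_const B).mono hfm.aestronglyMeasurable ?_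
    exact .of_forall fun t => (hfB t).trans (Real.le_norm_self _)
  have heq : tailMellin E = fun s => mellin f (-s) := by
    funext s
    rw [tailMellin, mellin]
    have : ∀ t : ℝ, (t : ℂ) ^ (-s - 1) • f t =
        (Set.Ioi (1 : ℝ)).indicator (fun t : ℝ => E t * (t : ℂ) ^ (-(s + 1))) t := fun t => by
      by_cases h : t ∈ Set.Ioi (1 : ℝ)
      · rw [hf, Set.indicator_of_mem h, Set.indicator_of_mem h, smul_eq_mul, mul_comm]
        congr 2; ring
      · rw [hf, Set.indicator_of_notMem h, Set.indicator_of_notMem h, smul_zero]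
    simp_rw [this]
    rw [setIntegral_indicator measurableSet_Ioi]
    congr 2
    ext t; simp only [Set.mem_inter_iff, Set.mem_Ioi]
    constructor
    · intro h; exact ⟨by linarith, h⟩
    · exact fun h => h.2
  rw [heq]
  have h1 : DifferentiableAt ℂ (mellin f) (-s) := by
    refine mellin_differentiableAt_of_isBigO_rpow (a := 0) (b := (-s).re - 1) hloc ?_ (by simpa) ?_ (by linarith)
    · refine Asymptotics.IsBigO.of_bound B (.of_forall fun t => ?_)
      simpa using hfB t
    · refine Asymptotics.IsBigO.of_bound 0 ?_
      filter_upwards [Ioo_mem_nhdsGT (zero_lt_one)] with t ht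
      rw [hf, Set.indicator_of_notMem (by simpa using ht.2.le)]
      simp
  exact h1.comp s differentiableAt_id.neg

lemma sub_one_mul_LSeries_eq {f : ℕ → ℂ} {c : ℂ} {B : ℝ} (hf : ∀ n, ‖f n‖ ≤ 1)
    (hB : ∀ t : ℝ, 0 ≤ t → ‖∑ k ∈ Finset.Icc 1 ⌊t⌋₊, f k - c * t‖ ≤ B) {s : ℂ} (hs : 1 < s.re) :
    (s - 1) * LSeries f s = c * s + s * (s - 1) *
      tailMellin (fun t => ∑ k ∈ Finset.Icc 1 ⌊t⌋₊, f k - c * t) s := by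
  have hs1 : s - 1 ≠ 0 := fun h => by
    have := congrArg Complex.re h
    simp at this; linarith
  rw [LSeries_eq_mul_integral' f zero_le_one hs, tailMellin]
  swap
  · refine Asymptotics.IsBigO.of_bound 1 (.of_forall fun n => ?_)
    rw [Real.norm_of_nonneg (Finset.sum_nonneg fun _ _ => norm_nonneg _), Real.rpow_one, one_mul, Real.norm_natCast]
    refine (Finset.sum_le_sum fun k _ => hf k).trans ?_
    simp
  have hm : Measurable (fun t : ℝ => ∑ k ∈ Finset.Icc 1 ⌊t⌋₊, f k) :=
    (measurable_from_nat (f := fun n => ∑ k ∈ Finset.Icc 1 n, f k)).comp Nat.measurable_floor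
  have i1 : IntegrableOn (fun t : ℝ => (t : ℂ) ^ (-s)) (Set.Ioi 1) :=
    integrableOn_Ioi_cpow_of_lt (by simpa using hs) one_pos
  have i2 : IntegrableOn (fun t : ℝ => (∑ k ∈ Finset.Icc 1 ⌊t⌋₊, f k - c * t) * (t : ℂ) ^ (-(s + 1))) (Set.Ioi 1) := by
    have i3 : IntegrableOn (fun t : ℝ => (t : ℂ) ^ (-(s + 1))) (Set.Ioi 1) :=
      integrableOn_Ioi_cpow_of_lt (by simp; linarith) one_pos
    refine Integrable.bdd_mul (c := B) i3 ?_ ?_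
    · refine (hm.sub ?_).aestronglyMeasurable
      fun_prop
    · filter_upwards [ae_restrict_mem measurableSet_Ioi] with t ht
      have : (1 : ℝ) < t := ht
      exact hB t (by linarith)
  have key : ∫ t in Set.Ioi (1 : ℝ), (∑ k ∈ Finset.Icc 1 ⌊t⌋₊, f k) * (t : ℂ) ^ (-(s + 1)) =
      c * (1 / (s - 1)) + ∫ t in Set.Ioi (1 : ℝ), (∑ k ∈ Finset.Icc 1 ⌊t⌋₊, f k - c * t) * (t : ℂ) ^ (-(s + 1)) := by
    have h1 : ∫ t in Set.Ioi (1 : ℝ), (t : ℂ) ^ (-s) = 1 / (s - 1) := by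
      rw [integral_Ioi_cpow_of_lt (by simpa using hs) one_pos, Complex.ofReal_one, Complex.one_cpow,
        show -s + 1 = -(s - 1) by ring, neg_div_neg_eq]
    rw [← h1, ← integral_const_mul, ← integral_add (i1.const_mul c) i2]
    refine setIntegral_congr_fun measurableSet_Ioi fun t ht => ?_
    have ht0 : (t : ℂ) ≠ 0 := by
      have : (1 : ℝ) < t := ht
      exact_mod_cast (by linarith : t ≠ 0)
    have : (t : ℂ) ^ (-s) = t * (t : ℂ) ^ (-(s + 1)) := by
      rw [show -s = 1 + -(s + 1) by ring, Complex.cpow_add _ _ ht0, Complex.cpow_one]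
    simp only [this]
    ring
  rw [key]
  generalize ∫ t in Set.Ioi (1 : ℝ), (∑ k ∈ Finset.Icc 1 ⌊t⌋₊, f k - c * t) * (t : ℂ) ^ (-(s + 1)) = J
  field_simp

variable {q : ℕ} [NeZero q] (χ : DirichletCharacter ℂ q)

lemma exists_entireL_growth_aux : ∃ C : ℝ, 0 ≤ C ∧ ∀ s : ℂ, 1 / 2 ≤ s.re →
    ‖(s - 1) ^ (1 - poleOrder χ) * entireL χ s‖ ≤ C * (1 + ‖s‖) ^ 2 := by
  have hper : Function.Periodic (fun n : ℕ => χ n) q := fun n => by simp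
  obtain ⟨c, B, hB0, hB⟩ := exists_norm_sum_floor_sub_le_of_periodic (NeZero.ne q) hper
  set E : ℝ → ℂ := fun t => ∑ k ∈ Finset.Icc 1 ⌊t⌋₊, χ (k : ZMod q) - c * t with hE
  have hEm : Measurable E := by
    have hm : Measurable (fun t : ℝ => ∑ k ∈ Finset.Icc 1 ⌊t⌋₊, χ (k : ZMod q)) :=
      (measurable_from_nat (f := fun n => ∑ k ∈ Finset.Icc 1 n, χ (k : ZMod q))).comp Nat.measurable_floor
    exact hm.sub (by fun_prop)
  set U : Set ℂ := {s | 0 < s.re} with hU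
  have hUo : IsOpen U := isOpen_lt continuous_const Complex.continuous_re
  have hUc : IsPreconnected U := (convex_halfSpace_re_gt 0).isPreconnected
  set H : ℂ → ℂ := fun s => (s - 1) ^ (1 - poleOrder χ) * entireL χ s with hH
  set G : ℂ → ℂ := fun s => c * s + s * (s - 1) * tailMellin E s with hG
  have hHd : AnalyticOnNhd ℂ H U := by
    refine DifferentiableOn.analyticOnNhd (Differentiable.differentiableOn ?_) hUo
    have := differentiable_entireL χ
    exact ((differentiable_id.sub_const 1).pow _).mul this
  have hGd : AnalyticOnNhd ℂ G U := by
    refine DifferentiableOn.analyticOnNhd (fun s hs => ?_) hUo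
    have := differentiableAt_tailMellin hEm hB hs
    refine DifferentiableAt.differentiableWithinAt ?_
    fun_prop
  have hHG : H =ᶠ[nhds 2] G := by
    have : {s : ℂ | 1 < s.re} ∈ nhds (2 : ℂ) :=
      (isOpen_lt continuous_const Complex.continuous_re).mem_nhds (by simp)
    filter_upwards [this] with s hs
    have hs' : 1 < s.re := hs
    have hs1 : s ≠ 1 := fun h => by rw [h] at hs'; simp at hs'
    have h1 := sub_one_mul_LSeries_eq (f := fun n : ℕ => χ n) (fun n => χ.norm_le_one _) hB hs'
    rw [hH, hG]
    simp only
    rw [← h1, entireL_eq χ hs1, DirichletCharacter.LFunction_eq_LSeries χ hs', ← mul_assoc, ← pow_add]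
    have : 1 - poleOrder χ + poleOrder χ = 1 := by
      unfold poleOrder; split_ifs <;> rfl
    rw [this, pow_one]
  have hEq := hHd.eqOn_of_preconnected_of_eventuallyEq hGd hUc (z₀ := 2) (by simp [hU]) hHG
  refine ⟨‖c‖ + 2 * B, by positivity, fun s hs => ?_⟩
  have h1 : H s = G s := hEq (show 0 < s.re by linarith)
  change ‖H s‖ ≤ _
  rw [h1, hG]
  have h2 := norm_tailMellin_le hB hs
  have h3 : ‖s - 1‖ ≤ 1 + ‖s‖ := by
    have := norm_sub_le s 1; rw [norm_one] at this; linarith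
  calc ‖c * s + s * (s - 1) * tailMellin E s‖ ≤ ‖c‖ * ‖s‖ + ‖s‖ * ‖s - 1‖ * ‖tailMellin E s‖ := by
        refine (norm_add_le _ _).trans (le_of_eq ?_)
        simp only [norm_mul]
    _ ≤ ‖c‖ * (1 + ‖s‖) ^ 2 + (1 + ‖s‖) * (1 + ‖s‖) * (2 * B) := by
        have : ‖s‖ ≤ (1 + ‖s‖) ^ 2 := by nlinarith [norm_nonneg s]
        gcongr
        linarith
    _ = _ := by ring

lemma exists_entireL_growth : ∃ C : ℝ, 1 ≤ C ∧ ∀ s : ℂ, 1 / 2 ≤ s.re →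
    ‖entireL χ s‖ ≤ C * (1 + ‖s‖) ^ 2 := by
  obtain ⟨C, hC0, hC⟩ := exists_entireL_growth_aux χ
  obtain ⟨M, hM⟩ := (isCompact_closedBall (1 : ℂ) 1).exists_bound_of_continuousOn
    (differentiable_entireL χ).continuous.continuousOn
  refine ⟨C + |M| + 1, by linarith [abs_nonneg M], fun s hs => ?_⟩
  have h1 : 1 ≤ (1 + ‖s‖) ^ 2 := by nlinarith [norm_nonneg s]
  rcases le_total ‖s - 1‖ 1 with h | h
  · have h2 := hM s (by rwa [Metric.mem_closedBall, dist_eq_norm])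
    have h3 := le_abs_self M
    nlinarith [abs_nonneg M]
  · have h2 := hC s hs
    rw [norm_mul, norm_pow] at h2
    have h3 : 1 * ‖entireL χ s‖ ≤ ‖s - 1‖ ^ (1 - poleOrder χ) * ‖entireL χ s‖ := by
      gcongr
      exact one_le_pow₀ h
    nlinarith [abs_nonneg M]

end

noncomputable section

lemma prime_pow_succ_injective : Function.Injective fun i : Nat.Primes × ℕ => (i.1 : ℕ) ^ (i.2 + 1) := by
  intro i j h
  have := Nat.Primes.prodNatEquiv.injective (a₁ := i) (a₂ := j) (Subtype.ext h)
  exact this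

lemma exp_neg_log_mul {i : Nat.Primes × ℕ} (s : ℂ) :
    Complex.exp (-(((i.2 + 1) * Real.log i.1 : ℝ) : ℂ) * s) = ((i.1 : ℂ) ^ (-s)) ^ (i.2 + 1) := by
  have hp : ((i.1 : ℕ) : ℂ) ≠ 0 := by exact_mod_cast i.1.2.ne_zero
  rw [Complex.cpow_def_of_ne_zero hp, ← Complex.exp_nat_mul]
  congr 1
  rw [← Complex.natCast_log]
  push_cast; ring

lemma exp_log_mul_real (i : Nat.Primes × ℕ) : Real.exp ((i.2 + 1) * Real.log i.1) = ((i.1 ^ (i.2 + 1) : ℕ) : ℝ) := by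
  have hp : (0 : ℝ) < (i.1 : ℕ) := by exact_mod_cast i.1.2.pos
  rw [show ((i.2 : ℝ) + 1) = ((i.2 + 1 : ℕ) : ℝ) by push_cast; rfl, ← Real.log_pow, Real.exp_log (by positivity)]
  push_cast; rfl

lemma finite_log_le (X : ℝ) : {i : Nat.Primes × ℕ | (i.2 + 1) * Real.log i.1 ≤ X}.Finite := by
  refine Set.Finite.subset ((Set.finite_Iic ⌊Real.exp X⌋₊).preimage
    (prime_pow_succ_injective.injOn)) fun i hi => ?_
  simp only [Set.mem_preimage, Set.mem_Iic]
  rw [Nat.le_floor_iff (Real.exp_pos _).le, ← exp_log_mul_real]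
  exact Real.exp_le_exp.2 hi

lemma summable_exp_neg_log {σ : ℝ} (hσ : 1 < σ) :
    Summable fun i : Nat.Primes × ℕ => Real.exp (-((i.2 + 1) * Real.log i.1) * σ) := by
  have h := ((Real.summable_nat_rpow (p := -σ)).2 (by linarith)).comp_injective prime_pow_succ_injective
  refine h.congr fun i => ?_
  simp only [Function.comp]
  rw [← exp_log_mul_real, ← Real.exp_mul]
  congr 1; ring

variable {q : ℕ} [NeZero q] (χ : DirichletCharacter ℂ q)

omit [NeZero q] in
lemma norm_div_succ_le (i : Nat.Primes × ℕ) : ‖χ i.1 ^ (i.2 + 1) / (i.2 + 1 : ℂ)‖ ≤ 1 := by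
  rw [norm_div, norm_pow]
  have h1 : ‖(i.2 + 1 : ℂ)‖ = i.2 + 1 := by
    rw [show (i.2 + 1 : ℂ) = ((i.2 + 1 : ℕ) : ℂ) by push_cast; rfl, Complex.norm_natCast]; push_cast; rfl
  rw [h1]
  refine div_le_one_of_le₀ ((pow_le_one₀ (norm_nonneg _) (χ.norm_le_one _)).trans ?_) (by positivity)
  linarith [(Nat.cast_nonneg i.2 : (0:ℝ) ≤ i.2)]

lemma LFunction_eq_exp_tsum {s : ℂ} (hs : 1 < s.re) : DirichletCharacter.LFunction χ s =
    Complex.exp (∑' i : Nat.Primes × ℕ, χ i.1 ^ (i.2 + 1) / (i.2 + 1) *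
      Complex.exp (-(((i.2 + 1) * Real.log i.1 : ℝ) : ℂ) * s)) := by
  have hsum : Summable fun i : Nat.Primes × ℕ => χ i.1 ^ (i.2 + 1) / (i.2 + 1) *
      Complex.exp (-(((i.2 + 1) * Real.log i.1 : ℝ) : ℂ) * s) := by
    refine Summable.of_norm_bounded (summable_exp_neg_log hs) fun i => ?_
    rw [norm_mul, Complex.norm_exp]
    have := norm_div_succ_le χ i
    calc _ ≤ 1 * Real.exp (-((i.2 + 1) * Real.log i.1) * s.re) := by
          refine mul_le_mul this (Real.exp_le_exp.2 (le_of_eq ?_)) (Real.exp_pos _).le zero_le_one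
          simp only [neg_mul, Complex.neg_re, Complex.re_ofReal_mul]
      _ = _ := one_mul _
  rw [DirichletCharacter.LFunction_eq_LSeries χ hs, ← DirichletCharacter.LSeries_eulerProduct_exp_log χ hs,
    hsum.tsum_prod]
  congr 2
  funext p
  have hz : ‖χ p * (p : ℂ) ^ (-s)‖ < 1 := by
    have hp1 : (1 : ℝ) < (p : ℕ) := by exact_mod_cast p.2.one_lt
    rw [norm_mul]
    have h2 : ‖((p : ℕ) : ℂ) ^ (-s)‖ < 1 := by
      rw [show ((p : ℕ) : ℂ) = (((p : ℕ) : ℝ) : ℂ) by simp, Complex.norm_cpow_eq_rpow_re_of_pos (by linarith)]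
      exact Real.rpow_lt_one_of_one_lt_of_neg hp1 (by simp; linarith)
    nlinarith [χ.norm_le_one p, norm_nonneg (χ p), norm_nonneg (((p : ℕ) : ℂ) ^ (-s))]
  rw [← (Complex.hasSum_taylorSeries_neg_log' hz).tsum_eq]
  congr 1
  funext j
  rw [exp_neg_log_mul (i := (p, j)), mul_pow]
  push_cast; ring

theorem exists_eulerData (hGRH : GRHmod q) : ∃ C : ℝ, EulerData (entireL χ) (poleOrder χ)
    (fun i : Nat.Primes × ℕ => χ i.1 ^ (i.2 + 1) / (i.2 + 1)) (fun i => (i.2 + 1) * Real.log i.1) C := by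
  obtain ⟨C₁, h1, hf⟩ := exists_entireL_fold χ
  obtain ⟨C₂, h2, hg⟩ := exists_entireL_growth χ
  refine ⟨max C₁ C₂, h1.trans (le_max_left _ _), differentiable_entireL χ,
    fun s hs => entireL_ne_zero χ hGRH hs, fun s hs => (hg s hs).trans ?_, fun a y ha => (hf a y ha).trans ?_,
    fun i => ?_, finite_log_le, fun σ hσ => ?_, fun s hs => ?_⟩
  · gcongr; exact le_max_right _ _
  · have : 0 ≤ Real.log (|y| + a + 2) := Real.log_nonneg (by linarith [abs_nonneg y])
    gcongr <;> exact le_max_left _ _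
  · have := Real.log_natCast_nonneg i.1
    positivity
  · refine Summable.of_nonneg_of_le (fun i => by positivity) (fun i => ?_) (summable_exp_neg_log hσ)
    exact mul_le_of_le_one_left (Real.exp_pos _).le (norm_div_succ_le χ i)
  · have hs1 : s ≠ 1 := fun h => by rw [h] at hs; simp at hs
    rw [entireL_eq χ hs1, LFunction_eq_exp_tsum χ hs]

end

noncomputable section

lemma finite_primes_log_le (X : ℝ) : {p : Nat.Primes | Real.log p ≤ X}.Finite := by
  refine Set.Finite.subset ((Set.finite_Iic ⌊Real.exp X⌋₊).preimage
    (Nat.Primes.coe_nat_injective.injOn)) fun p hp => ?_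
  simp only [Set.mem_preimage, Set.mem_Iic]
  have hp0 : (0 : ℝ) < (p : ℕ) := by exact_mod_cast p.2.pos
  rw [Nat.le_floor_iff (Real.exp_pos _).le, ← Real.exp_log hp0]
  exact Real.exp_le_exp.2 hp

/-- The primes `p` with `log p ≤ X`. -/
def primesLogLE (X : ℝ) : Finset Nat.Primes := (finite_primes_log_le X).toFinset

lemma mem_primesLogLE {X : ℝ} {p : Nat.Primes} : p ∈ primesLogLE X ↔ Real.log p ≤ X := by
  simp [primesLogLE]

/-- The Dirichlet polynomial `∑ c p * p ^ (-i κ t)`. -/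
def dirPoly (S : Finset Nat.Primes) (c : Nat.Primes → ℂ) (κ t : ℝ) : ℂ :=
  ∑ p ∈ S, c p * Complex.exp (-((κ * t * Real.log p : ℝ) : ℂ) * Complex.I)

lemma continuous_dirPoly (S : Finset Nat.Primes) (c : Nat.Primes → ℂ) (κ : ℝ) :
    Continuous (dirPoly S c κ) := by
  unfold dirPoly
  fun_prop

/-- The smooth weight of the prime `p` in the approximation of `log L(1/2 + it, χ)`. -/
def primeWeight (L : ℝ) (p : Nat.Primes) : ℂ :=
  Complex.exp (-((1 / 2 * Real.log p : ℝ) : ℂ)) * bandTransform (Real.log p / L)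

/-- The smooth weight of the square of `p` in the approximation of `log L(1/2 + it, χ)`. -/
def primeSqWeight (L : ℝ) (p : Nat.Primes) : ℂ :=
  Complex.exp (-(Real.log p : ℂ)) / 2 * bandTransform (2 * Real.log p / L)

lemma norm_primeWeight_sq_le {L : ℝ} (hL : 0 ≤ L) (p : Nat.Primes) :
    ‖primeWeight L p‖ ^ 2 ≤ (p : ℝ)⁻¹ := by
  have hp0 : (0 : ℝ) < (p : ℕ) := by exact_mod_cast p.2.pos
  have h1 : ‖bandTransform (Real.log p / L)‖ ≤ 1 :=
    norm_bandTransform_le (div_nonneg (Real.log_natCast_nonneg _) hL)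
  have h2 : ‖primeWeight L p‖ ≤ Real.exp (-(1 / 2 * Real.log p)) := by
    rw [primeWeight, norm_mul, Complex.norm_exp, ← Complex.ofReal_neg, Complex.ofReal_re]
    exact mul_le_of_le_one_right (Real.exp_pos _).le h1
  calc _ ≤ Real.exp (-(1 / 2 * Real.log p)) ^ 2 := by gcongr
    _ = (p : ℝ)⁻¹ := by
      rw [← Real.exp_nat_mul, ← Real.exp_log (inv_pos.2 hp0), Real.log_inv]
      congr 1; push_cast; ring

lemma norm_primeSqWeight_le {L : ℝ} (hL : 0 ≤ L) (p : Nat.Primes) :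
    ‖primeSqWeight L p‖ ≤ (p : ℝ)⁻¹ := by
  have hp0 : (0 : ℝ) < (p : ℕ) := by exact_mod_cast p.2.pos
  have h1 : ‖bandTransform (2 * Real.log p / L)‖ ≤ 1 :=
    norm_bandTransform_le (div_nonneg (mul_nonneg zero_le_two (Real.log_natCast_nonneg _)) hL)
  have h3 : Real.exp (-Real.log p) = (p : ℝ)⁻¹ := by rw [Real.exp_neg, Real.exp_log hp0]
  rw [primeSqWeight, norm_mul, norm_div, Complex.norm_exp, ← Complex.ofReal_neg, Complex.ofReal_re, h3]
  have : (0 : ℝ) < (p : ℝ)⁻¹ := inv_pos.2 hp0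
  calc _ ≤ (p : ℝ)⁻¹ / ‖(2 : ℂ)‖ * 1 := by gcongr
    _ ≤ _ := by norm_num

lemma norm_sum_prime_powers_le {f : Nat.Primes × ℕ → ℂ}
    (hf : ∀ i, ‖f i‖ ≤ Real.exp (-(1 / 2) * ((i.2 + 1) * Real.log i.1))) :
    ∀ (P : Finset Nat.Primes) (J : ℕ), ‖∑ j ∈ Finset.range J, ∑ p ∈ P, f (p, j + 2)‖ ≤
      ∑' i : Nat.Primes × ℕ, ((i.1 : ℕ) : ℝ) ^ (-(3 / 2) : ℝ) * (3 / 4) ^ i.2 := by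
  intro P J
  have hs : Summable fun i : Nat.Primes × ℕ => ((i.1 : ℕ) : ℝ) ^ (-(3 / 2) : ℝ) * (3 / 4 : ℝ) ^ i.2 := by
    have h1 : Summable fun p : Nat.Primes => ((p : ℕ) : ℝ) ^ (-(3 / 2) : ℝ) :=
      Nat.Primes.summable_rpow.2 (by norm_num)
    have h2 : Summable fun j : ℕ => (3 / 4 : ℝ) ^ j := summable_geometric_of_lt_one (by norm_num) (by norm_num)
    exact h1.mul_of_nonneg h2 (fun p => by positivity) (fun j => by positivity)
  rw [← Finset.sum_product_right (f := fun i : Nat.Primes × ℕ => f (i.1, i.2 + 2))]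
  refine (norm_sum_le _ _).trans (le_trans ?_ (hs.sum_le_tsum (P ×ˢ Finset.range J) fun i _ => by positivity))
  refine Finset.sum_le_sum fun i _ => (hf _).trans ?_
  have hp0 : (0 : ℝ) < (i.1 : ℕ) := by exact_mod_cast i.1.2.pos
  have hp2 : (2 : ℝ) ≤ (i.1 : ℕ) := by exact_mod_cast i.1.2.two_le
  have h34 : Real.exp (-(1 / 2) * Real.log i.1) ≤ 3 / 4 := by
    have h3 : Real.log 2 ≤ Real.log i.1 := Real.log_le_log (by norm_num) hp2
    have h4 := Real.log_two_gt_d9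
    have h6 := Real.add_one_le_exp (1 / 2 * Real.log i.1)
    rw [neg_mul, Real.exp_neg]
    calc _ ≤ ((4 : ℝ) / 3)⁻¹ := by gcongr; norm_num at h4 ⊢; linarith
      _ = _ := by norm_num
  calc Real.exp (-(1 / 2) * (((i.2 + 2 : ℕ) + 1 : ℝ) * Real.log i.1))
      = ((i.1 : ℕ) : ℝ) ^ (-(3 / 2) : ℝ) * Real.exp (-(1 / 2) * Real.log i.1) ^ i.2 := by
        rw [Real.rpow_def_of_pos hp0, ← Real.exp_nat_mul, ← Real.exp_add]
        congr 1; push_cast; ring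
    _ ≤ _ := by gcongr

variable {q : ℕ} [NeZero q] (χ : DirichletCharacter ℂ q)

theorem exists_log_norm_LFunction_le (hGRH : GRHmod q) : ∃ K : ℝ, ∀ t L : ℝ, 1 ≤ t → 1 ≤ L →
    Real.exp (4 * L) ≤ t → DirichletCharacter.LFunction χ (1 / 2 + t * Complex.I) ≠ 0 →
    Real.log ‖DirichletCharacter.LFunction χ (1 / 2 + t * Complex.I)‖ ≤
      (dirPoly (primesLogLE (2 * L)) (fun p => χ p * primeWeight L p) 1 t +
        dirPoly (primesLogLE (2 * L)) (fun p => χ p ^ 2 * primeSqWeight L p) 2 t).re +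
      K + K * (Real.log (t + 2) / L) := by
  obtain ⟨C, h⟩ := exists_eulerData χ hGRH
  obtain ⟨K, hK⟩ := h.exists_log_norm_le
  set D : ℝ := ∑' i : Nat.Primes × ℕ, ((i.1 : ℕ) : ℝ) ^ (-(3 / 2) : ℝ) * (3 / 4) ^ i.2 with hD
  refine ⟨|K| + D, fun t L ht hL htL hne => ?_⟩
  have hD0 : 0 ≤ D := tsum_nonneg fun i => by positivity
  have hs1 : (1 / 2 + t * Complex.I : ℂ) ≠ 1 := fun h => by
    have := congrArg Complex.re h
    simp at this
  have hs10 := sub_ne_zero.2 hs1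
  have hFe := entireL_eq χ hs1
  have hb := hK t L ht hL htL (by rw [hFe]; exact mul_ne_zero (pow_ne_zero _ hs10) hne)
  rw [hFe, norm_mul, norm_pow, Real.log_mul (pow_ne_zero _ (norm_ne_zero_iff.2 hs10)) (norm_ne_zero_iff.2 hne),
    Real.log_pow, show (1 / 2 + t * Complex.I - 1 : ℂ) = -1 / 2 + t * Complex.I by ring] at hb
  set s : ℂ := 1 / 2 + t * Complex.I with hs
  set f : Nat.Primes × ℕ → ℂ := fun i => χ i.1 ^ (i.2 + 1) / (i.2 + 1) *
    Complex.exp (-(((i.2 + 1) * Real.log i.1 : ℝ) : ℂ) * s) *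
      bandTransform ((i.2 + 1) * Real.log i.1 / L) with hf
  have hξ : ∀ i : Nat.Primes × ℕ, 0 ≤ ((i.2 : ℝ) + 1) * Real.log i.1 := h.nonneg
  have hfn : ∀ i, ‖f i‖ ≤ Real.exp (-(1 / 2) * ((i.2 + 1) * Real.log i.1)) := fun i => by
    have h1 := norm_div_succ_le χ i
    have h2 : ‖bandTransform ((i.2 + 1) * Real.log i.1 / L)‖ ≤ 1 :=
      norm_bandTransform_le (div_nonneg (hξ i) (by linarith))
    have h3 : ‖Complex.exp (-(((i.2 + 1) * Real.log i.1 : ℝ) : ℂ) * s)‖ =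
        Real.exp (-(1 / 2) * ((i.2 + 1) * Real.log i.1)) := by
      rw [Complex.norm_exp, ← Complex.ofReal_neg, Complex.re_ofReal_mul]
      congr 1
      simp [hs]
      ring
    rw [hf]
    simp only
    rw [norm_mul, norm_mul, h3]
    calc _ ≤ 1 * Real.exp (-(1 / 2) * ((i.2 + 1) * Real.log i.1)) * 1 := by gcongr
      _ = _ := by ring
  have hlog2 : ∀ p : Nat.Primes, 1 / 2 ≤ Real.log p := fun p => by
    have hp2 : (2 : ℝ) ≤ (p : ℕ) := by exact_mod_cast p.2.two_le
    have h3 : Real.log 2 ≤ Real.log p := Real.log_le_log (by norm_num) hp2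
    linarith [Real.log_two_gt_d9]
  obtain ⟨J, hJ⟩ := exists_nat_ge (4 * L)
  have hband : h.bandSum L s = dirPoly (primesLogLE (2 * L)) (fun p => χ p * primeWeight L p) 1 t +
        dirPoly (primesLogLE (2 * L)) (fun p => χ p ^ 2 * primeSqWeight L p) 2 t +
        ∑ j ∈ Finset.range J, ∑ p ∈ primesLogLE (2 * L), f (p, j + 2) := by
    have h1 : h.bandSum L s = ∑ i ∈ primesLogLE (2 * L) ×ˢ Finset.range (J + 2), f i := by
      unfold EulerData.bandSum
      refine Finset.sum_subset_zero_on_sdiff (fun i hi => ?_) (fun i hi => ?_) (fun i _ => rfl)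
      · have hi' : ((i.2 : ℝ) + 1) * Real.log i.1 ≤ 2 * L := by simpa using hi
        have hl := hlog2 i.1
        rw [Finset.mem_product, mem_primesLogLE, Finset.mem_range]
        have hi2 : (0 : ℝ) ≤ i.2 := Nat.cast_nonneg _
        refine ⟨by nlinarith, ?_⟩
        have : (i.2 : ℝ) < (J + 2 : ℕ) := by push_cast; nlinarith
        exact_mod_cast this
      · have hi' : ¬ ((i.2 : ℝ) + 1) * Real.log i.1 ≤ 2 * L := by
          have := (Finset.mem_sdiff.1 hi).2
          simpa using this
        rw [hf]
        simp only
        rw [bandTransform_eq_zero, mul_zero]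
        rw [le_div_iff₀ (by linarith)]
        exact (not_le.1 hi').le
    rw [h1, Finset.sum_product_right, Finset.sum_range_succ', Finset.sum_range_succ', add_assoc, add_comm]
    congr 1
    rw [add_comm]
    congr 1
    · refine Finset.sum_congr rfl fun p _ => ?_
      simp only [hf, primeWeight, Nat.cast_zero, zero_add, pow_one, div_one, one_mul]
      have : Complex.exp (-(Real.log p : ℂ) * s) = Complex.exp (-((1 / 2 * Real.log p : ℝ) : ℂ)) *
          Complex.exp (-((t * Real.log p : ℝ) : ℂ) * Complex.I) := by
        rw [← Complex.exp_add, hs]; congr 1; push_cast; ring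
      rw [this]; ring
    · refine Finset.sum_congr rfl fun p _ => ?_
      simp only [hf, primeSqWeight, zero_add, Nat.cast_one, Nat.reduceAdd]
      have : Complex.exp (-((((1 : ℝ) + 1) * Real.log p : ℝ) : ℂ) * s) = Complex.exp (-(Real.log p : ℂ)) *
          Complex.exp (-((2 * t * Real.log p : ℝ) : ℂ) * Complex.I) := by
        rw [← Complex.exp_add, hs]; congr 1; push_cast; ring
      rw [this, one_add_one_eq_two, one_add_one_eq_two]; ring
  rw [hband, Complex.add_re] at hb
  have h5 := (Complex.re_le_norm _).trans (norm_sum_prime_powers_le hfn (primesLogLE (2 * L)) J)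
  have h6 : 0 ≤ Real.log (t + 2) / L := div_nonneg (Real.log_nonneg (by linarith)) (by linarith)
  have h7 : K * (Real.log (t + 2) / L) ≤ (|K| + D) * (Real.log (t + 2) / L) := by
    gcongr; linarith [le_abs_self K]
  have h8 := le_abs_self K
  linarith

end

noncomputable section

variable {q : ℕ} [NeZero q] (ℓ : DirichletCharacter ℂ q → ℕ)

/-- The coefficient at `p` of the Dirichlet series of `∏ L(s,χ)^{ℓ χ}`. -/
def primeCoef (p : Nat.Primes) : ℂ := ∑ χ : DirichletCharacter ℂ q, ℓ χ * χ p

/-- The contribution of the characters to the coefficient of `p ^ (-2s)` in `log ∏ L(s,χ)^{ℓ χ}`. -/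
def primeSqCoef (p : Nat.Primes) : ℂ := ∑ χ : DirichletCharacter ℂ q, ℓ χ * χ p ^ 2

omit [NeZero q] in
lemma norm_primeCoef_le (p : Nat.Primes) : ‖primeCoef ℓ p‖ ≤ ∑ χ : DirichletCharacter ℂ q, (ℓ χ : ℝ) := by
  refine norm_sum_le_of_le _ fun χ _ => ?_
  rw [norm_mul, Complex.norm_natCast]
  exact mul_le_of_le_one_right (Nat.cast_nonneg _) (χ.norm_le_one _)

omit [NeZero q] in
lemma norm_primeSqCoef_le (p : Nat.Primes) : ‖primeSqCoef ℓ p‖ ≤ ∑ χ : DirichletCharacter ℂ q, (ℓ χ : ℝ) := by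
  refine norm_sum_le_of_le _ fun χ _ => ?_
  rw [norm_mul, Complex.norm_natCast, norm_pow]
  exact mul_le_of_le_one_right (Nat.cast_nonneg _) (pow_le_one₀ (norm_nonneg _) (χ.norm_le_one _))

omit [NeZero q] in
lemma sum_mul_dirPoly (S : Finset Nat.Primes) (a : DirichletCharacter ℂ q → Nat.Primes → ℂ)
    (w : Nat.Primes → ℂ) (κ t : ℝ) :
    ∑ χ : DirichletCharacter ℂ q, ℓ χ * dirPoly S (fun p => a χ p * w p) κ t =
      dirPoly S (fun p => (∑ χ : DirichletCharacter ℂ q, ℓ χ * a χ p) * w p) κ t := by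
  unfold dirPoly
  simp_rw [Finset.mul_sum, Finset.sum_mul]
  rw [Finset.sum_comm]
  refine Finset.sum_congr rfl fun p _ => Finset.sum_congr rfl fun χ _ => ?_
  ring

theorem exists_log_norm_Ll_le (hGRH : GRHmod q) : ∃ K : ℝ, 1 ≤ K ∧ ∀ t L : ℝ, 1 ≤ t → 1 ≤ L →
    Real.exp (4 * L) ≤ t → Ll ℓ (1 / 2 + t * Complex.I) ≠ 0 →
    Real.log ‖Ll ℓ (1 / 2 + t * Complex.I)‖ ≤
      ‖dirPoly (primesLogLE (2 * L)) (fun p => primeCoef ℓ p * primeWeight L p) 1 t‖ +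
      ‖dirPoly (primesLogLE (2 * L)) (fun p => primeSqCoef ℓ p * primeSqWeight L p) 2 t‖ +
      K + K * (Real.log (t + 2) / L) := by
  choose K hK using fun χ : DirichletCharacter ℂ q => exists_log_norm_LFunction_le χ hGRH
  refine ⟨1 + ∑ χ : DirichletCharacter ℂ q, ℓ χ * |K χ|, by
    have : 0 ≤ ∑ χ : DirichletCharacter ℂ q, ℓ χ * |K χ| := Finset.sum_nonneg fun χ _ => by positivity
    linarith, fun t L ht hL htL hne => ?_⟩
  have h6 : 0 ≤ Real.log (t + 2) / L := div_nonneg (Real.log_nonneg (by linarith)) (by linarith)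
  set A : DirichletCharacter ℂ q → ℂ := fun χ =>
    dirPoly (primesLogLE (2 * L)) (fun p => χ p * primeWeight L p) 1 t with hA
  set B : DirichletCharacter ℂ q → ℂ := fun χ =>
    dirPoly (primesLogLE (2 * L)) (fun p => χ p ^ 2 * primeSqWeight L p) 2 t with hB
  have hne' : ∀ χ : DirichletCharacter ℂ q, DirichletCharacter.LFunction χ (1 / 2 + t * Complex.I) ^ ℓ χ ≠ 0 :=
    fun χ => Finset.prod_ne_zero_iff.1 hne χ (Finset.mem_univ χ)
  have h1 : Real.log ‖Ll ℓ (1 / 2 + t * Complex.I)‖ =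
      ∑ χ : DirichletCharacter ℂ q, ℓ χ * Real.log ‖DirichletCharacter.LFunction χ (1 / 2 + t * Complex.I)‖ := by
    rw [Ll, norm_prod, Real.log_prod (fun χ _ => norm_ne_zero_iff.2 (hne' χ))]
    refine Finset.sum_congr rfl fun χ _ => ?_
    rw [norm_pow, Real.log_pow]
  have h2 : ∀ χ : DirichletCharacter ℂ q,
      ℓ χ * Real.log ‖DirichletCharacter.LFunction χ (1 / 2 + t * Complex.I)‖ ≤
        (ℓ χ * A χ).re + (ℓ χ * B χ).re + ℓ χ * |K χ| * (1 + Real.log (t + 2) / L) := fun χ => by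
    rcases Nat.eq_zero_or_pos (ℓ χ) with h0 | h0
    · simp [h0]
    have h3 := hK χ t L ht hL htL (fun h => hne' χ (by rw [h, zero_pow h0.ne']))
    have e1 : ∀ z : ℂ, ((ℓ χ : ℂ) * z).re = ℓ χ * z.re := fun z => by simp
    rw [e1, e1]
    rw [Complex.add_re] at h3
    have h4 : K χ ≤ |K χ| := le_abs_self _
    have h5 : K χ * (Real.log (t + 2) / L) ≤ |K χ| * (Real.log (t + 2) / L) := by gcongr
    calc _ ≤ (ℓ χ : ℝ) * ((A χ).re + (B χ).re + K χ + K χ * (Real.log (t + 2) / L)) := by gcongr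
      _ ≤ (ℓ χ : ℝ) * ((A χ).re + (B χ).re + |K χ| + |K χ| * (Real.log (t + 2) / L)) := by gcongr
      _ = _ := by ring
  have h3 : ∑ χ : DirichletCharacter ℂ q, (ℓ χ * A χ).re ≤
      ‖dirPoly (primesLogLE (2 * L)) (fun p => primeCoef ℓ p * primeWeight L p) 1 t‖ := by
    rw [← Complex.re_sum, hA, sum_mul_dirPoly ℓ _ (fun χ p => χ p)]
    exact Complex.re_le_norm _
  have h4 : ∑ χ : DirichletCharacter ℂ q, (ℓ χ * B χ).re ≤
      ‖dirPoly (primesLogLE (2 * L)) (fun p => primeSqCoef ℓ p * primeSqWeight L p) 2 t‖ := by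
    rw [← Complex.re_sum, hB, sum_mul_dirPoly ℓ _ (fun χ p => χ p ^ 2)]
    exact Complex.re_le_norm _
  rw [h1]
  refine (Finset.sum_le_sum fun χ _ => h2 χ).trans ?_
  rw [Finset.sum_add_distrib, Finset.sum_add_distrib, ← Finset.sum_mul]
  generalize ∑ χ : DirichletCharacter ℂ q, ℓ χ * |K χ| = Z
  linarith

lemma continuous_Ll_line : Continuous fun t : ℝ => Ll ℓ (1 / 2 + t * Complex.I) := by
  unfold Ll
  refine continuous_finsetProd _ fun χ _ => Continuous.pow ?_ _
  refine continuous_iff_continuousAt.2 fun t => ?_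
  have h1 : (1 / 2 + t * Complex.I : ℂ) ≠ 1 := fun h => by
    have := congrArg Complex.re h
    simp at this
  exact (DirichletCharacter.differentiableAt_LFunction χ _ (.inl h1)).continuousAt.comp
    (f := fun t : ℝ => (1 / 2 + t * Complex.I : ℂ)) (by fun_prop)

end

noncomputable section

lemma norm_integral_exp_le (x : ℝ) (hx : x ≠ 0) (a b : ℝ) :
    ‖∫ t in a..b, Complex.exp (((t * x : ℝ) : ℂ) * Complex.I)‖ ≤ 2 / |x| := by
  have hc : (x : ℂ) * Complex.I ≠ 0 := mul_ne_zero (by exact_mod_cast hx) Complex.I_ne_zero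
  have h1 : ∀ t : ℝ, Complex.exp (((t * x : ℝ) : ℂ) * Complex.I) = Complex.exp ((x : ℂ) * Complex.I * t) :=
    fun t => by congr 1; push_cast; ring
  simp_rw [h1]
  rw [integral_exp_mul_complex hc, norm_div, norm_mul, Complex.norm_I, mul_one, Complex.norm_real, Real.norm_eq_abs]
  gcongr
  refine (norm_sub_le _ _).trans (le_of_eq ?_)
  rw [← h1, ← h1, Complex.norm_exp_ofReal_mul_I, Complex.norm_exp_ofReal_mul_I]
  norm_num

lemma integral_norm_sq_expSum_le {α : Type} (A : Finset α) (C : α → ℂ) (μ : α → ℝ) {T M R : ℝ} (hT : 0 ≤ T)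
    (hM : ∀ a ∈ A, (#{b ∈ A | μ b = μ a} : ℝ) ≤ M)
    (hR : ∀ a ∈ A, ∀ b ∈ A, μ a ≠ μ b → 2 / |μ a - μ b| ≤ R) (hR0 : 0 ≤ R) :
    ∫ t in T..(2 * T), ‖∑ a ∈ A, C a * Complex.exp (((t * μ a : ℝ) : ℂ) * Complex.I)‖ ^ 2 ≤
      T * M * ∑ a ∈ A, ‖C a‖ ^ 2 + R * (∑ a ∈ A, ‖C a‖) ^ 2 := by
  have hpt : ∀ t : ℝ, ((‖∑ a ∈ A, C a * Complex.exp (((t * μ a : ℝ) : ℂ) * Complex.I)‖ ^ 2 : ℝ) : ℂ) =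
      ∑ a ∈ A, ∑ b ∈ A, C a * starRingEnd ℂ (C b) *
        Complex.exp (((t * (μ a - μ b) : ℝ) : ℂ) * Complex.I) := fun t => by
    rw [← Complex.normSq_eq_norm_sq, ← Complex.mul_conj, map_sum, Finset.sum_mul_sum]
    refine Finset.sum_congr rfl fun a _ => Finset.sum_congr rfl fun b _ => ?_
    rw [map_mul, ← Complex.exp_conj, map_mul, Complex.conj_I, Complex.conj_ofReal]
    have : Complex.exp (((t * (μ a - μ b) : ℝ) : ℂ) * Complex.I) =
        Complex.exp (((t * μ a : ℝ) : ℂ) * Complex.I) * Complex.exp (((t * μ b : ℝ) : ℂ) * -Complex.I) := by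
      rw [← Complex.exp_add]; congr 1; push_cast; ring
    rw [this]; ring
  set J : α → α → ℂ := fun a b => ∫ t in T..(2 * T), Complex.exp (((t * (μ a - μ b) : ℝ) : ℂ) * Complex.I) with hJ
  have hInt : ((∫ t in T..(2 * T), ‖∑ a ∈ A, C a * Complex.exp (((t * μ a : ℝ) : ℂ) * Complex.I)‖ ^ 2 : ℝ) : ℂ) =
      ∑ a ∈ A, ∑ b ∈ A, C a * starRingEnd ℂ (C b) * J a b := by
    rw [← intervalIntegral.integral_ofReal]
    simp_rw [hpt]
    rw [intervalIntegral.integral_finsetSum]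
    · refine Finset.sum_congr rfl fun a _ => ?_
      rw [intervalIntegral.integral_finsetSum]
      · refine Finset.sum_congr rfl fun b _ => ?_
        rw [intervalIntegral.integral_const_mul]
      · intro b _
        exact Continuous.intervalIntegrable (by fun_prop) _ _
    · intro a _
      exact Continuous.intervalIntegrable (by fun_prop) _ _
  have hJ1 : ∀ a ∈ A, ∀ b ∈ A, ‖J a b‖ ≤ (if μ b = μ a then T else 0) + R := fun a ha b hb => by
    split_ifs with h
    · rw [hJ]
      simp only [h, sub_self, mul_zero, Complex.ofReal_zero, zero_mul, Complex.exp_zero]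
      rw [intervalIntegral.integral_const, norm_smul, norm_one, Real.norm_of_nonneg (by linarith)]
      linarith
    · rw [zero_add]
      exact (norm_integral_exp_le _ (sub_ne_zero.2 (Ne.symm h)) _ _).trans (hR a ha b hb (Ne.symm h))
  have h1 : ∫ t in T..(2 * T), ‖∑ a ∈ A, C a * Complex.exp (((t * μ a : ℝ) : ℂ) * Complex.I)‖ ^ 2 ≤
      ∑ a ∈ A, ∑ b ∈ A, ‖C a‖ * ‖C b‖ * ((if μ b = μ a then T else 0) + R) := by
    refine (le_abs_self _).trans ?_
    rw [← Real.norm_eq_abs, ← Complex.norm_real, hInt]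
    refine norm_sum_le_of_le _ fun a ha => norm_sum_le_of_le _ fun b hb => ?_
    rw [norm_mul, norm_mul, RCLike.norm_conj]
    exact mul_le_mul_of_nonneg_left (hJ1 a ha b hb) (by positivity)
  refine h1.trans ?_
  have h2 : ∀ a b, ‖C a‖ * ‖C b‖ * ((if μ b = μ a then T else 0) + R) ≤
      (if μ b = μ a then T * ‖C a‖ ^ 2 / 2 else 0) + (if μ a = μ b then T * ‖C b‖ ^ 2 / 2 else 0) +
        R * (‖C a‖ * ‖C b‖) := fun a b => by
    by_cases h : μ b = μ a
    · rw [if_pos h, if_pos h, if_pos h.symm]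
      nlinarith [mul_nonneg hT (sq_nonneg (‖C a‖ - ‖C b‖))]
    · rw [if_neg h, if_neg h, if_neg (Ne.symm h)]
      nlinarith
  refine (Finset.sum_le_sum fun a _ => Finset.sum_le_sum fun b _ => h2 a b).trans ?_
  simp_rw [Finset.sum_add_distrib]
  have h3 : ∑ a ∈ A, ∑ b ∈ A, (if μ b = μ a then T * ‖C a‖ ^ 2 / 2 else 0) ≤
      T * M * (∑ a ∈ A, ‖C a‖ ^ 2) / 2 := by
    rw [Finset.mul_sum, Finset.sum_div]
    refine Finset.sum_le_sum fun a ha => ?_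
    rw [← Finset.sum_filter, Finset.sum_const, nsmul_eq_mul]
    calc _ ≤ M * (T * ‖C a‖ ^ 2 / 2) := mul_le_mul_of_nonneg_right (hM a ha) (by positivity)
      _ = _ := by ring
  have h4 : ∑ a ∈ A, ∑ b ∈ A, (if μ a = μ b then T * ‖C b‖ ^ 2 / 2 else 0) ≤
      T * M * (∑ a ∈ A, ‖C a‖ ^ 2) / 2 := by
    rw [Finset.sum_comm]; exact h3
  have h5 : ∑ a ∈ A, ∑ b ∈ A, R * (‖C a‖ * ‖C b‖) = R * (∑ a ∈ A, ‖C a‖) ^ 2 := by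
    rw [sq, Finset.sum_mul_sum, Finset.mul_sum]
    exact Finset.sum_congr rfl fun a _ => by rw [Finset.mul_sum]
  rw [h5]
  linarith

lemma card_tuples_le {m : ℕ} (A : Finset (Fin m → Nat.Primes)) (f : Fin m → Nat.Primes)
    (h : ∀ g ∈ A, ∏ i, (g i : ℕ) = ∏ i, (f i : ℕ)) : #A ≤ m.factorial := by
  have hinj : Set.InjOn (fun g : Fin m → Nat.Primes => List.ofFn fun i => (g i : ℕ)) A := by
    intro g _ g' _ hgg
    have := List.ofFn_injective hgg
    funext i
    exact Nat.Primes.coe_nat_injective (congrFun this i)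
  rw [← Finset.card_image_of_injOn hinj]
  have hsub : A.image (fun g : Fin m → Nat.Primes => List.ofFn fun i => (g i : ℕ)) ⊆
      (List.ofFn fun i => (f i : ℕ)).permutations.toFinset := by
    intro l hl
    obtain ⟨g, hg, rfl⟩ := Finset.mem_image.1 hl
    rw [List.mem_toFinset, List.mem_permutations]
    have h1 : (List.ofFn fun i => (g i : ℕ)).Perm (Nat.primeFactorsList (∏ i, (f i : ℕ))) :=
      Nat.primeFactorsList_unique (by rw [List.prod_ofFn, h g hg]) (by
        intro p hp
        obtain ⟨i, rfl⟩ := List.mem_ofFn.1 hp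
        exact (g i).2)
    have h2 : (List.ofFn fun i => (f i : ℕ)).Perm (Nat.primeFactorsList (∏ i, (f i : ℕ))) :=
      Nat.primeFactorsList_unique (by rw [List.prod_ofFn]) (by
        intro p hp
        obtain ⟨i, rfl⟩ := List.mem_ofFn.1 hp
        exact (f i).2)
    exact h1.trans h2.symm
  refine (Finset.card_le_card hsub).trans ((List.toFinset_card_le _).trans ?_)
  rw [List.length_permutations, List.length_ofFn]

lemma card_le_exp {S : Finset Nat.Primes} {X : ℝ} (hS : ∀ p ∈ S, Real.log p ≤ X) : (#S : ℝ) ≤ Real.exp X := by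
  have h : #S ≤ ⌊Real.exp X⌋₊ := by
    rw [← Finset.card_image_of_injOn (s := S) Nat.Primes.coe_nat_injective.injOn]
    have : S.image (fun p : Nat.Primes => (p : ℕ)) ⊆ Finset.Icc 1 ⌊Real.exp X⌋₊ := by
      intro n hn
      obtain ⟨p, hp, rfl⟩ := Finset.mem_image.1 hn
      have hp0 : (0 : ℝ) < (p : ℕ) := by exact_mod_cast p.2.pos
      rw [Finset.mem_Icc, Nat.le_floor_iff (Real.exp_pos _).le, ← Real.exp_log hp0]
      exact ⟨p.2.one_le, Real.exp_le_exp.2 (hS p hp)⟩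
    simpa using Finset.card_le_card this
  exact (Nat.cast_le.2 h).trans (Nat.floor_le (Real.exp_pos _).le)

lemma two_div_abs_log_sub_le {a b : ℕ} (ha : 0 < a) (hb : 0 < b) (hab : a ≠ b) {κ Z : ℝ} (hκ : 1 ≤ κ)
    (haZ : (a : ℝ) ≤ Z) (hbZ : (b : ℝ) ≤ Z) :
    2 / |κ * Real.log a - κ * Real.log b| ≤ 2 * Z := by
  wlog h : b < a generalizing a b with H
  · rw [abs_sub_comm]
    exact H hb ha hab.symm hbZ haZ (lt_of_le_of_ne (not_lt.1 h) hab)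
  have ha' : (0 : ℝ) < a := by exact_mod_cast ha
  have hb' : (0 : ℝ) < b := by exact_mod_cast hb
  have h1 : (b : ℝ) + 1 ≤ a := by exact_mod_cast h
  have h2 := Real.one_sub_inv_le_log_of_pos (div_pos ha' hb')
  rw [Real.log_div ha'.ne' hb'.ne', inv_div] at h2
  have h3 : 1 / Z ≤ 1 - b / a := by
    calc 1 / Z ≤ 1 / a := by gcongr
      _ ≤ 1 - b / a := by
        rw [one_sub_div ha'.ne']; gcongr; linarith
  have hZ : 0 < Z := by linarith
  have h4 : 1 / Z ≤ |κ * Real.log a - κ * Real.log b| := by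
    rw [← mul_sub, abs_mul]
    have h5 : 1 / Z ≤ |Real.log a - Real.log b| := (h3.trans h2).trans (le_abs_self _)
    have h6 : 1 ≤ |κ| := hκ.trans (le_abs_self _)
    nlinarith [abs_nonneg (Real.log a - Real.log b)]
  calc _ ≤ 2 / (1 / Z) := by gcongr
    _ = 2 * Z := by field_simp

theorem integral_norm_dirPoly_pow_le (S : Finset Nat.Primes) (c : Nat.Primes → ℂ) {κ X T : ℝ} (m : ℕ)
    (hκ : 1 ≤ κ) (hS : ∀ p ∈ S, Real.log p ≤ X) (hT : Real.exp (2 * m * X) ≤ T) :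
    ∫ t in T..(2 * T), ‖dirPoly S c κ t‖ ^ (2 * m) ≤ 3 * T * (m.factorial * (∑ p ∈ S, ‖c p‖ ^ 2) ^ m) := by
  have hT0 : 0 < T := (Real.exp_pos _).trans_le hT
  set A := Fintype.piFinset fun _ : Fin m => S with hA
  set C : (Fin m → Nat.Primes) → ℂ := fun f => ∏ i, c (f i) with hC
  set μ : (Fin m → Nat.Primes) → ℝ := fun f => -(κ * Real.log ((∏ i, (f i : ℕ) : ℕ) : ℝ)) with hμ
  have hpos : ∀ f : Fin m → Nat.Primes, 0 < ∏ i, (f i : ℕ) := fun f => Finset.prod_pos fun i _ => (f i).2.pos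
  have hle : ∀ f ∈ A, ((∏ i, (f i : ℕ) : ℕ) : ℝ) ≤ Real.exp (m * X) := fun f hf => by
    push_cast
    calc ∏ i, ((f i : ℕ) : ℝ) ≤ ∏ i : Fin m, Real.exp X := by
          refine Finset.prod_le_prod (fun i _ => Nat.cast_nonneg _) fun i _ => ?_
          have hp0 : (0 : ℝ) < (f i : ℕ) := by exact_mod_cast (f i).2.pos
          rw [← Real.exp_log hp0]
          exact Real.exp_le_exp.2 (hS _ (Fintype.mem_piFinset.1 hf i))
      _ = _ := by rw [Finset.prod_const, Finset.card_univ, Fintype.card_fin, ← Real.exp_nat_mul]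
  have hμinj : ∀ f g, μ f = μ g → ∏ i, (f i : ℕ) = ∏ i, (g i : ℕ) := fun f g h => by
    have h1 : Real.log ((∏ i, (f i : ℕ) : ℕ) : ℝ) = Real.log ((∏ i, (g i : ℕ) : ℕ) : ℝ) :=
      mul_left_cancel₀ (by linarith : κ ≠ 0) (neg_injective h)
    have hf : (0 : ℝ) < ((∏ i, (f i : ℕ) : ℕ) : ℝ) := by exact_mod_cast hpos f
    have hg : (0 : ℝ) < ((∏ i, (g i : ℕ) : ℕ) : ℝ) := by exact_mod_cast hpos g
    exact_mod_cast Real.log_injOn_pos hf hg h1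
  have hpow : ∀ t : ℝ, dirPoly S c κ t ^ m = ∑ f ∈ A, C f * Complex.exp (((t * μ f : ℝ) : ℂ) * Complex.I) := by
    intro t
    rw [dirPoly, Finset.sum_pow']
    refine Finset.sum_congr rfl fun f _ => ?_
    rw [Finset.prod_mul_distrib, ← Complex.exp_sum, hC]
    have hlog : μ f = -(κ * ∑ i, Real.log (f i)) := by
      have h1 : Real.log (∏ i, ((f i : ℕ) : ℝ)) = ∑ i, Real.log (f i) :=
        Real.log_prod fun i _ => by exact_mod_cast (f i).2.ne_zero
      rw [← h1, hμ]
      push_cast; rfl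
    congr 2
    rw [hlog, ← Finset.sum_mul, Finset.sum_neg_distrib, ← Complex.ofReal_sum, ← Finset.mul_sum]
    push_cast; ring
  have hsq : ∑ f ∈ A, ‖C f‖ ^ 2 = (∑ p ∈ S, ‖c p‖ ^ 2) ^ m := by
    rw [Finset.sum_pow']
    refine Finset.sum_congr rfl fun f _ => ?_
    rw [hC, norm_prod, Finset.prod_pow]
  have habs : ∑ f ∈ A, ‖C f‖ = (∑ p ∈ S, ‖c p‖) ^ m := by
    rw [Finset.sum_pow']
    exact Finset.sum_congr rfl fun f _ => by rw [hC, norm_prod]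
  have hcs : (∑ p ∈ S, ‖c p‖) ^ 2 ≤ Real.exp X * ∑ p ∈ S, ‖c p‖ ^ 2 :=
    (sq_sum_le_card_mul_sum_sq).trans (mul_le_mul_of_nonneg_right (card_le_exp hS)
      (Finset.sum_nonneg fun _ _ => by positivity))
  have main := integral_norm_sq_expSum_le A C μ (T := T) (M := m.factorial) (R := 2 * Real.exp (m * X)) hT0.le
    (fun f _ => by
      exact_mod_cast card_tuples_le _ f fun g hg => hμinj g f (Finset.mem_filter.1 hg).2)
    (fun f hf g hg hfg => by
      rw [hμ]
      simp only
      rw [neg_sub_neg]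
      exact two_div_abs_log_sub_le (hpos g) (hpos f) (fun h => hfg (by rw [hμ]; simp only [h])) hκ (hle g hg) (hle f hf))
    (by positivity)
  simp_rw [← hpow] at main
  simp_rw [norm_pow, ← pow_mul, mul_comm m 2] at main
  refine main.trans ?_
  rw [hsq, habs, ← pow_mul, mul_comm m 2, pow_mul]
  set v := ∑ p ∈ S, ‖c p‖ ^ 2 with hv
  have hv0 : 0 ≤ v := Finset.sum_nonneg fun _ _ => by positivity
  have h1 : 2 * Real.exp (m * X) * ((∑ p ∈ S, ‖c p‖) ^ 2) ^ m ≤ 2 * T * v ^ m := by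
    calc _ ≤ 2 * Real.exp (m * X) * (Real.exp X * v) ^ m := by gcongr
      _ = 2 * Real.exp (2 * m * X) * v ^ m := by
        rw [mul_pow, ← Real.exp_nat_mul, show 2 * (m : ℝ) * X = m * X + m * X by ring, Real.exp_add]; ring
      _ ≤ _ := by gcongr
  have h2 : v ^ m ≤ m.factorial * v ^ m :=
    le_mul_of_one_le_left (by positivity) (by exact_mod_cast Nat.one_le_iff_ne_zero.2 m.factorial_ne_zero)
  nlinarith

end

noncomputable section

lemma norm_prime_cpow_le {p : Nat.Primes} {s : ℂ} (hs : 1 < s.re) :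
    ‖((p : ℕ) : ℂ) ^ (-s)‖ ≤ (p : ℝ)⁻¹ := by
  have hp1 : (1 : ℝ) < (p : ℕ) := by exact_mod_cast p.2.one_lt
  rw [show ((p : ℕ) : ℂ) = (((p : ℕ) : ℝ) : ℂ) by simp, Complex.norm_cpow_eq_rpow_re_of_pos (by linarith),
    ← Real.rpow_neg_one]
  exact Real.rpow_le_rpow_of_exponent_le hp1.le (by simp; linarith)

lemma summable_prime_inv_sq : Summable fun p : Nat.Primes => ((p : ℝ)⁻¹) ^ 2 := by
  refine (Nat.Primes.summable_rpow.2 (by norm_num : (-2 : ℝ) < -1)).congr fun p => ?_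
  rw [Real.rpow_neg (Nat.cast_nonneg _), inv_pow]
  norm_num

variable {q : ℕ} [NeZero q] (χ : DirichletCharacter ℂ q)

lemma entireL_ne_zero_of_one_le_re {s : ℂ} (hs : 1 ≤ s.re) : entireL χ s ≠ 0 := by
  rcases eq_or_ne s 1 with rfl | h1
  · exact entireL_one_ne_zero χ
  rw [entireL_eq χ h1]
  exact mul_ne_zero (pow_ne_zero _ (sub_ne_zero.2 h1))
    (DirichletCharacter.LFunction_ne_zero_of_one_le_re χ (.inr h1) hs)

omit [NeZero q] in
lemma norm_tsum_neg_log_sub_le {s : ℂ} (hs : 1 < s.re) :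
    (Summable fun p : Nat.Primes => χ p * ((p : ℕ) : ℂ) ^ (-s)) ∧
    ‖∑' p : Nat.Primes, -Complex.log (1 - χ p * (p : ℂ) ^ (-s)) - ∑' p : Nat.Primes, χ p * ((p : ℕ) : ℂ) ^ (-s)‖ ≤
      ∑' p : Nat.Primes, ((p : ℝ)⁻¹) ^ 2 := by
  have hsum := DirichletCharacter.summable_neg_log_one_sub_mul_prime_cpow χ hs
  have hz : ∀ p : Nat.Primes, ‖χ p * ((p : ℕ) : ℂ) ^ (-s)‖ ≤ (p : ℝ)⁻¹ := fun p => by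
    rw [norm_mul]
    have := norm_prime_cpow_le (p := p) hs
    nlinarith [χ.norm_le_one p, norm_nonneg (χ p), norm_nonneg (((p : ℕ) : ℂ) ^ (-s))]
  have hd : ∀ p : Nat.Primes, ‖-Complex.log (1 - χ p * (p : ℂ) ^ (-s)) - χ p * ((p : ℕ) : ℂ) ^ (-s)‖ ≤
      ((p : ℝ)⁻¹) ^ 2 := fun p => by
    have hp2 : (2 : ℝ) ≤ (p : ℕ) := by exact_mod_cast p.2.two_le
    have hh : (p : ℝ)⁻¹ ≤ 2⁻¹ := by gcongr
    set z := χ p * ((p : ℕ) : ℂ) ^ (-s) with hzd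
    have hz1 : ‖-z‖ ≤ 2⁻¹ := by rw [norm_neg]; exact (hz p).trans hh
    have := Complex.norm_log_one_add_sub_self_le (z := -z) (by linarith)
    rw [← norm_neg, show -(-Complex.log (1 - z) - z) = Complex.log (1 + -z) - -z by ring_nf]
    refine this.trans ?_
    rw [norm_neg] at hz1 ⊢
    have h1 : (1 - ‖z‖)⁻¹ ≤ 2 := by
      calc (1 - ‖z‖)⁻¹ ≤ (2⁻¹)⁻¹ := by gcongr; linarith
        _ = 2 := by norm_num
    calc ‖z‖ ^ 2 * (1 - ‖z‖)⁻¹ / 2 ≤ ‖z‖ ^ 2 * 2 / 2 := by gcongr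
      _ = ‖z‖ ^ 2 := by ring
      _ ≤ _ := by have := hz p; gcongr
  have hds : Summable fun p : Nat.Primes =>
      -Complex.log (1 - χ p * (p : ℂ) ^ (-s)) - χ p * ((p : ℕ) : ℂ) ^ (-s) :=
    Summable.of_norm_bounded summable_prime_inv_sq hd
  have hs2 : Summable fun p : Nat.Primes => χ p * ((p : ℕ) : ℂ) ^ (-s) := by
    refine (hsum.sub hds).congr fun p => ?_
    ring
  refine ⟨hs2, ?_⟩
  rw [← hsum.tsum_sub hs2]
  exact tsum_of_norm_bounded summable_prime_inv_sq.hasSum hd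

/-- The sum `∑ Re χ(p) p^{-σ}`. -/
def primeSum (χ : DirichletCharacter ℂ q) (σ : ℝ) : ℝ :=
  ∑' p : Nat.Primes, (χ p).re * Real.exp (-σ * Real.log p)

omit [NeZero q] in
lemma re_mul_prime_cpow (p : Nat.Primes) (σ : ℝ) :
    (χ p * ((p : ℕ) : ℂ) ^ (-(σ : ℂ))).re = (χ p).re * Real.exp (-σ * Real.log p) := by
  have hp : ((p : ℕ) : ℂ) ≠ 0 := by exact_mod_cast p.2.ne_zero
  rw [Complex.cpow_def_of_ne_zero hp, ← Complex.natCast_log,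
    show ((Real.log p : ℝ) : ℂ) * -(σ : ℂ) = ((-σ * Real.log p : ℝ) : ℂ) by push_cast; ring,
    ← Complex.ofReal_exp, Complex.re_mul_ofReal]

omit [NeZero q] in
lemma summable_primeSum {σ : ℝ} (hσ : 1 < σ) :
    Summable fun p : Nat.Primes => (χ p).re * Real.exp (-σ * Real.log p) := by
  have := (norm_tsum_neg_log_sub_le χ (s := (σ : ℂ)) (by simpa)).1
  refine (Complex.hasSum_re this.hasSum).summable.congr fun p => ?_
  exact re_mul_prime_cpow χ p σ

lemma exists_abs_primeSum_sub_le : ∃ C : ℝ, 0 ≤ C ∧ ∀ σ : ℝ, 1 < σ → σ ≤ 2 →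
    |primeSum χ σ - poleOrder χ * Real.log (1 / (σ - 1))| ≤ C := by
  obtain ⟨M, hM⟩ := (isCompact_Icc (a := (1 : ℝ)) (b := 2)).exists_bound_of_continuousOn
    (f := fun σ : ℝ => Real.log ‖entireL χ σ‖) (by
      refine ContinuousOn.log ?_ fun σ hσ => ?_
      · exact ((differentiable_entireL χ).continuous.comp Complex.continuous_ofReal).norm.continuousOn
      · exact norm_ne_zero_iff.2 (entireL_ne_zero_of_one_le_re χ (by simpa using hσ.1)))
  have hD0 : 0 ≤ ∑' p : Nat.Primes, ((p : ℝ)⁻¹) ^ 2 := tsum_nonneg fun p => by positivity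
  have hM0 : 0 ≤ M := (norm_nonneg _).trans (hM 1 (by norm_num))
  refine ⟨M + ∑' p : Nat.Primes, ((p : ℝ)⁻¹) ^ 2, by positivity, fun σ h1 h2 => ?_⟩
  have hs : 1 < (σ : ℂ).re := by simpa
  obtain ⟨hsum, hle⟩ := norm_tsum_neg_log_sub_le χ hs
  have h3 := hM σ ⟨h1.le, h2⟩
  have hne : (σ : ℂ) ≠ 1 := by exact_mod_cast h1.ne'
  rw [entireL_eq χ hne, DirichletCharacter.LFunction_eq_LSeries χ hs,
    ← DirichletCharacter.LSeries_eulerProduct_exp_log χ hs, norm_mul, norm_pow, Complex.norm_exp,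
    Real.log_mul (pow_ne_zero _ (norm_ne_zero_iff.2 (sub_ne_zero.2 hne))) (Real.exp_pos _).ne', Real.log_exp,
    Real.log_pow, ← Complex.ofReal_one, ← Complex.ofReal_sub, Complex.norm_real,
    Real.norm_of_nonneg (by linarith : 0 ≤ σ - 1)] at h3
  have h4 := (Complex.abs_re_le_norm _).trans hle
  rw [Complex.sub_re, Complex.re_tsum hsum] at h4
  simp_rw [re_mul_prime_cpow] at h4
  change |_ - primeSum χ σ| ≤ _ at h4
  rw [one_div, Real.log_inv]
  rw [Real.norm_eq_abs, Complex.ofReal_one] at h3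
  rw [abs_le] at h3 h4 ⊢
  constructor <;> linarith

end

noncomputable section

lemma hasSum_norm_primeCoef_sq_mul_exp {q : ℕ} [NeZero q] (ℓ : DirichletCharacter ℂ q → ℕ) {σ : ℝ} (hσ : 1 < σ) :
    HasSum (fun p : Nat.Primes => ‖primeCoef ℓ p‖ ^ 2 * Real.exp (-σ * Real.log p))
      (∑ χ : DirichletCharacter ℂ q, ∑ ψ : DirichletCharacter ℂ q,
        (ℓ χ : ℝ) * ℓ ψ * primeSum (χ * ψ⁻¹) σ) := by
  have h1 : ∀ p : Nat.Primes, ‖primeCoef ℓ p‖ ^ 2 * Real.exp (-σ * Real.log p) =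
      ∑ χ : DirichletCharacter ℂ q, ∑ ψ : DirichletCharacter ℂ q,
        (ℓ χ : ℝ) * ℓ ψ * (((χ * ψ⁻¹) p).re * Real.exp (-σ * Real.log p)) := fun p => by
    have h2 : ((‖primeCoef ℓ p‖ ^ 2 : ℝ) : ℂ) = ∑ χ : DirichletCharacter ℂ q, ∑ ψ : DirichletCharacter ℂ q,
        (ℓ χ : ℂ) * ℓ ψ * ((χ * ψ⁻¹) p) := by
      rw [Complex.ofReal_pow, ← Complex.mul_conj', primeCoef, map_sum, Finset.sum_mul_sum]
      refine Finset.sum_congr rfl fun χ _ => Finset.sum_congr rfl fun ψ _ => ?_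
      have h3 : (starRingEnd ℂ) (ψ p) = ψ⁻¹ p := MulChar.star_apply' ψ _
      rw [map_mul, h3, MulChar.mul_apply, Complex.conj_natCast]
      ring
    have h4 := congrArg Complex.re h2
    rw [Complex.ofReal_re] at h4
    rw [h4]
    simp only [Complex.re_sum, Finset.sum_mul]
    refine Finset.sum_congr rfl fun χ _ => Finset.sum_congr rfl fun ψ _ => ?_
    have h5 : ((ℓ χ : ℂ) * ℓ ψ) = (((ℓ χ : ℝ) * ℓ ψ : ℝ) : ℂ) := by push_cast; rfl
    rw [h5, Complex.re_ofReal_mul, mul_assoc]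
  simp only [h1]
  exact hasSum_sum fun χ _ => hasSum_sum fun ψ _ => ((summable_primeSum (χ * ψ⁻¹) hσ).hasSum).mul_left _

/-- The mean square over primes of the coefficients of `∏ L(s,χ)^{ℓ χ}`. -/
lemma exists_sum_norm_primeCoef_sq_le {q : ℕ} [NeZero q] (ℓ : DirichletCharacter ℂ q → ℕ) {ε : ℝ} (hε : 0 < ε) :
    ∃ C : ℝ, 0 ≤ C ∧ ∀ x : ℝ, 1 ≤ x → ∑ p ∈ primesLogLE x, ‖primeCoef ℓ p‖ ^ 2 * (p : ℝ)⁻¹ ≤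
      (((∑ χ : DirichletCharacter ℂ q, (ℓ χ) ^ 2 : ℕ) : ℝ) + ε) * Real.log x + C := by
  set lam : ℝ := ((∑ χ : DirichletCharacter ℂ q, (ℓ χ) ^ 2 : ℕ) : ℝ) with hlam
  have hlam0 : 0 ≤ lam := Nat.cast_nonneg _
  set δ : ℝ := min (1 / 2) (ε / (2 * (lam + 1))) with hδ
  have hδ0 : 0 < δ := by positivity
  have hδ2 : δ ≤ 1 / 2 := min_le_left _ _
  have hexp : Real.exp δ ≤ 1 + 2 * δ := by
    refine (Real.exp_bound_div_one_sub_of_interval hδ0.le (by linarith)).trans ?_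
    rw [div_le_iff₀ (by linarith)]
    nlinarith
  have hle : lam * Real.exp δ ≤ lam + ε := by
    have h1 : δ ≤ ε / (2 * (lam + 1)) := min_le_right _ _
    rw [le_div_iff₀ (by linarith)] at h1
    nlinarith
  choose C hC0 hC using fun χ : DirichletCharacter ℂ q => exists_abs_primeSum_sub_le χ
  set C1 : ℝ := ∑ χ : DirichletCharacter ℂ q, ∑ ψ : DirichletCharacter ℂ q, (ℓ χ : ℝ) * ℓ ψ * C (χ * ψ⁻¹) with hC1
  have hC10 : 0 ≤ C1 := Finset.sum_nonneg fun χ _ => Finset.sum_nonneg fun ψ _ =>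
    mul_nonneg (by positivity) (hC0 _)
  have hlogδ : 0 ≤ Real.log (1 / δ) := Real.log_nonneg (by rw [le_div_iff₀ hδ0]; linarith)
  refine ⟨Real.exp δ * (lam * Real.log (1 / δ) + C1), by positivity, fun x hx => ?_⟩
  have hx0 : 0 < x := by linarith
  have hlogx : 0 ≤ Real.log x := Real.log_nonneg hx
  set σ : ℝ := 1 + δ / x with hσ
  have hσ1 : 1 < σ := by
    have : 0 < δ / x := by positivity
    linarith
  have hσ2 : σ ≤ 2 := by
    have : δ / x ≤ 1 := by rw [div_le_one hx0]; linarith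
    linarith
  have hS := hasSum_norm_primeCoef_sq_mul_exp ℓ hσ1
  have h1 : ∑ p ∈ primesLogLE x, ‖primeCoef ℓ p‖ ^ 2 * (p : ℝ)⁻¹ ≤
      Real.exp δ * ∑ p ∈ primesLogLE x, ‖primeCoef ℓ p‖ ^ 2 * Real.exp (-σ * Real.log p) := by
    rw [Finset.mul_sum]
    refine Finset.sum_le_sum fun p hp => ?_
    have hp0 : (0 : ℝ) < (p : ℕ) := by exact_mod_cast p.2.pos
    have h2 : (p : ℝ)⁻¹ = Real.exp (-Real.log p) := by rw [Real.exp_neg, Real.exp_log hp0]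
    rw [h2, mul_left_comm, ← Real.exp_add]
    gcongr
    have h3 := mem_primesLogLE.1 hp
    have h4 : δ / x * Real.log p ≤ δ := by
      rw [div_mul_eq_mul_div, div_le_iff₀ hx0]
      gcongr
    rw [hσ]
    linarith
  have h2 : ∑ p ∈ primesLogLE x, ‖primeCoef ℓ p‖ ^ 2 * Real.exp (-σ * Real.log p) ≤
      ∑ χ : DirichletCharacter ℂ q, ∑ ψ : DirichletCharacter ℂ q, (ℓ χ : ℝ) * ℓ ψ * primeSum (χ * ψ⁻¹) σ :=
    sum_le_hasSum _ (fun p _ => by positivity) hS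
  have h3 : ∑ χ : DirichletCharacter ℂ q, ∑ ψ : DirichletCharacter ℂ q, (ℓ χ : ℝ) * ℓ ψ * primeSum (χ * ψ⁻¹) σ ≤
      lam * Real.log (1 / (σ - 1)) + C1 := by
    have h4 : lam = ∑ χ : DirichletCharacter ℂ q, ∑ ψ : DirichletCharacter ℂ q,
        (ℓ χ : ℝ) * ℓ ψ * poleOrder (χ * ψ⁻¹) := by
      rw [hlam]
      push_cast
      refine Finset.sum_congr rfl fun χ _ => ?_
      rw [Finset.sum_eq_single χ]
      · simp [poleOrder, sq]
      · intro ψ _ hψ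
        simp [poleOrder, mul_inv_eq_one, hψ.symm]
      · simp
    rw [h4, hC1, Finset.sum_mul, ← Finset.sum_add_distrib]
    refine Finset.sum_le_sum fun χ _ => ?_
    rw [Finset.sum_mul, ← Finset.sum_add_distrib]
    refine Finset.sum_le_sum fun ψ _ => ?_
    rw [mul_assoc _ (poleOrder (χ * ψ⁻¹) : ℝ), ← mul_add]
    gcongr
    have := (abs_le.1 (hC (χ * ψ⁻¹) σ hσ1 hσ2)).2
    linarith
  have h5 : Real.log (1 / (σ - 1)) = Real.log (1 / δ) + Real.log x := by
    rw [← Real.log_mul (by positivity) hx0.ne']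
    congr 1
    rw [hσ, add_sub_cancel_left, one_div_div, one_div_mul_eq_div]
  rw [h5] at h3
  calc _ ≤ Real.exp δ * (lam * (Real.log (1 / δ) + Real.log x) + C1) :=
        h1.trans (mul_le_mul_of_nonneg_left (h2.trans h3) (Real.exp_pos _).le)
    _ = lam * Real.exp δ * Real.log x + Real.exp δ * (lam * Real.log (1 / δ) + C1) := by ring
    _ ≤ _ := by gcongr

/-- Mertens-type bound for primes with `δ x < log p ≤ x`. -/
lemma exists_sum_prime_inv_le {δ : ℝ} (hδ0 : 0 < δ) (hδ1 : δ ≤ 1) : ∃ C : ℝ, 0 ≤ C ∧ ∀ x : ℝ, 2 / δ ≤ x →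
    ∑ p ∈ (primesLogLE x).filter (fun p : Nat.Primes => δ * x < Real.log p), (p : ℝ)⁻¹ ≤ C := by
  obtain ⟨C, hC0, hC⟩ := exists_abs_primeSum_sub_le (1 : DirichletCharacter ℂ 1)
  have hlogδ : 0 ≤ Real.log (2 / δ) := Real.log_nonneg (by rw [le_div_iff₀ hδ0]; linarith)
  refine ⟨Real.exp 2 * (Real.log (2 / δ) + 2 * C), by positivity, fun x hx => ?_⟩
  have h2δ : 2 ≤ 2 / δ := by rw [le_div_iff₀ hδ0]; linarith
  have hx0 : 0 < x := by linarith
  have hσ1 : 1 < 1 + 1 / x := by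
    have : 0 < 1 / x := by positivity
    linarith
  have hσ2 : 1 + 1 / x ≤ 2 := by
    have : 1 / x ≤ 1 := by rw [div_le_one hx0]; linarith
    linarith
  have hτ1 : 1 < 1 + 2 / (δ * x) := by
    have : 0 < 2 / (δ * x) := by positivity
    linarith
  have hδx : 2 ≤ δ * x := by
    rw [div_le_iff₀ hδ0] at hx
    linarith
  have hτ2 : 1 + 2 / (δ * x) ≤ 2 := by
    have : 2 / (δ * x) ≤ 1 := by rw [div_le_one (by positivity)]; linarith
    linarith
  have hcmp : 1 / x ≤ 2 / (δ * x) := by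
    rw [div_le_div_iff₀ hx0 (by positivity)]
    nlinarith
  have hone : ∀ p : Nat.Primes, (((1 : DirichletCharacter ℂ 1) p).re) = 1 := fun p => by
    rw [MulChar.one_apply (isUnit_of_subsingleton _), Complex.one_re]
  have hs1 := summable_primeSum (1 : DirichletCharacter ℂ 1) hσ1
  have hs2 := summable_primeSum (1 : DirichletCharacter ℂ 1) hτ1
  have hb1 := abs_le.1 (hC _ hσ1 hσ2)
  have hb2 := abs_le.1 (hC _ hτ1 hτ2)
  have hpo : (poleOrder (1 : DirichletCharacter ℂ 1) : ℝ) = 1 := by simp [poleOrder]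
  have hl : Real.log (1 / (1 + 1 / x - 1)) - Real.log (1 / (1 + 2 / (δ * x) - 1)) = Real.log (2 / δ) := by
    rw [add_sub_cancel_left, add_sub_cancel_left, ← Real.log_div (by positivity) (by positivity)]
    congr 1
    field_simp
  have hdiff := hs1.hasSum.sub hs2.hasSum
  have h1 : ∑ p ∈ (primesLogLE x).filter (fun p : Nat.Primes => δ * x < Real.log p), (p : ℝ)⁻¹ ≤
      Real.exp 2 * ∑ p ∈ (primesLogLE x).filter (fun p : Nat.Primes => δ * x < Real.log p),
        (((1 : DirichletCharacter ℂ 1) p).re * Real.exp (-(1 + 1 / x) * Real.log p) -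
          ((1 : DirichletCharacter ℂ 1) p).re * Real.exp (-(1 + 2 / (δ * x)) * Real.log p)) := by
    rw [Finset.mul_sum]
    refine Finset.sum_le_sum fun p hp => ?_
    rw [Finset.mem_filter, mem_primesLogLE] at hp
    have hp0 : (0 : ℝ) < (p : ℕ) := by exact_mod_cast p.2.pos
    have h2 : (p : ℝ)⁻¹ = Real.exp (-Real.log p) := by rw [Real.exp_neg, Real.exp_log hp0]
    rw [hone, one_mul, one_mul, h2]
    set u := Real.log p with hu
    have e1 : Real.exp (-u) * Real.exp (-1) ≤ Real.exp (-(1 + 1 / x) * u) := by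
      rw [← Real.exp_add]
      gcongr
      have : 1 / x * u ≤ 1 := by
        rw [div_mul_eq_mul_div, div_le_iff₀ hx0]
        linarith
      linarith
    have e2 : Real.exp (-(1 + 2 / (δ * x)) * u) ≤ Real.exp (-u) * Real.exp (-2) := by
      rw [← Real.exp_add]
      gcongr
      have : 2 ≤ 2 / (δ * x) * u := by
        rw [div_mul_eq_mul_div, le_div_iff₀ (by positivity)]
        linarith
      linarith
    have e3 : Real.exp 2 * Real.exp (-1) = Real.exp 1 := by rw [← Real.exp_add]; norm_num
    have e4 : Real.exp 2 * Real.exp (-2) = 1 := by rw [← Real.exp_add]; norm_num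
    have e5 : (2 : ℝ) ≤ Real.exp 1 := by linarith [Real.add_one_le_exp (1 : ℝ)]
    calc Real.exp (-u) ≤ Real.exp (-u) * (Real.exp 1 - 1) := le_mul_of_one_le_right (Real.exp_pos _).le (by linarith)
      _ = Real.exp 2 * (Real.exp (-u) * Real.exp (-1) - Real.exp (-u) * Real.exp (-2)) := by
        rw [← e3, ← e4]; ring
      _ ≤ _ := by gcongr
  refine h1.trans ?_
  gcongr
  refine (sum_le_hasSum _ (fun p _ => ?_) hdiff).trans ?_
  · rw [hone, one_mul, one_mul, sub_nonneg]
    gcongr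
  · change primeSum 1 _ - primeSum 1 _ ≤ _
    rw [hpo] at hb1 hb2
    linarith [hb1.2, hb2.1]

end

noncomputable section

lemma exp_le_four_mul_sum_pow_div_factorial {y : ℝ} {N : ℕ} (hy : 0 ≤ y) (hyN : y ≤ N) :
    Real.exp y ≤ 4 * ∑ m ∈ Finset.range (N + 1), y ^ (2 * m) / (2 * m).factorial := by
  set a : ℕ → ℝ := fun m => y ^ (2 * m) / (2 * m).factorial with ha
  have ha0 : ∀ m, 0 ≤ a m := fun m => by positivity
  have hcosh : HasSum a (Real.cosh y) := Real.hasSum_cosh y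
  have hstep : ∀ m, N ≤ m → a (m + 1) ≤ a m * (1 / 4) := fun m hm => by
    have hm' : y ≤ m := hyN.trans (by exact_mod_cast hm)
    simp only [ha]
    rw [show 2 * (m + 1) = 2 * m + 1 + 1 by ring, Nat.factorial_succ, Nat.factorial_succ, pow_succ, pow_succ,
      div_mul_eq_mul_div, div_le_div_iff₀ (by positivity) (by positivity)]
    push_cast
    have h1 : y * y * 4 ≤ (2 * (m : ℝ) + 1 + 1) * (2 * (m : ℝ) + 1) := by nlinarith
    have h2 : 0 ≤ y ^ (2 * m) * ((2 * m).factorial : ℝ) := by positivity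
    nlinarith [mul_le_mul_of_nonneg_left h1 h2]
  have hgeo : ∀ j, a (j + N) ≤ a N * (1 / 4) ^ j := fun j => by
    induction j with
    | zero => simp
    | succ j ih =>
      rw [show j + 1 + N = j + N + 1 by ring, pow_succ, ← mul_assoc]
      exact (hstep _ (Nat.le_add_left _ _)).trans (by gcongr)
  have hg : HasSum (fun j : ℕ => a N * (1 / 4 : ℝ) ^ j) (a N * (4 / 3)) := by
    rw [show (4 / 3 : ℝ) = (1 - 1 / 4)⁻¹ by norm_num]
    exact (hasSum_geometric_of_lt_one (by norm_num) (by norm_num)).mul_left (a N)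
  have htail : ∑' j, a (j + N) ≤ a N * (4 / 3) :=
    hasSum_le hgeo ((summable_nat_add_iff N).2 hcosh.summable).hasSum hg
  have h1 : Real.cosh y = ∑ m ∈ Finset.range N, a m + ∑' j, a (j + N) := by
    rw [hcosh.summable.sum_add_tsum_nat_add, hcosh.tsum_eq]
  have h2 : Real.exp y ≤ 2 * Real.cosh y := by
    rw [Real.cosh_eq]
    linarith [Real.exp_pos (-y)]
  have h3 : 0 ≤ ∑ m ∈ Finset.range N, a m := Finset.sum_nonneg fun m _ => ha0 m
  rw [Finset.sum_range_succ]
  linarith [ha0 N]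

lemma four_pow_mul_factorial_div_le (m : ℕ) :
    (4 : ℝ) ^ m * m.factorial / (2 * m).factorial ≤ (2 * m + 1) / m.factorial := by
  have h1 : 4 ^ m ≤ (2 * m + 1) * m.centralBinom := by
    rcases Nat.eq_zero_or_pos m with rfl | hm
    · simp
    · exact (Nat.four_pow_le_two_mul_self_mul_centralBinom m hm).trans (by gcongr; omega)
  have h2 : (2 * m).factorial = m.centralBinom * (m.factorial * m.factorial) := by
    have := Nat.choose_mul_factorial_mul_factorial (show m ≤ 2 * m by omega)
    rw [show 2 * m - m = m by omega] at this
    rw [← this, Nat.centralBinom, mul_assoc]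
  have h3 : (4 : ℝ) ^ m ≤ (2 * m + 1) * m.centralBinom := by exact_mod_cast h1
  rw [div_le_div_iff₀ (by positivity) (by positivity), h2]
  push_cast
  calc (4 : ℝ) ^ m * m.factorial * m.factorial ≤ (2 * m + 1) * m.centralBinom * m.factorial * m.factorial := by gcongr
    _ = _ := by ring

variable {S : Finset Nat.Primes} {c : Nat.Primes → ℂ} {κ X T v : ℝ}

/-- Large values of Dirichlet polynomials over primes are rare. -/
lemma integral_norm_dirPoly_div_pow_le {a u r : ℝ} (hκ : 1 ≤ κ) (hX : 0 ≤ X)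
    (hS : ∀ p ∈ S, Real.log p ≤ X) (hv : ∑ p ∈ S, ‖c p‖ ^ 2 ≤ v) (ha : 0 < a) (hu : 0 ≤ u) (hr : 0 ≤ r)
    (huv : u * v / a ^ 2 ≤ Real.exp (-r)) (hT : Real.exp (2 * u * X) ≤ T) :
    ∫ t in T..(2 * T), (‖dirPoly S c κ t‖ / a) ^ (2 * ⌊u⌋₊) ≤ 3 * T * Real.exp (r - r * u) := by
  set m := ⌊u⌋₊ with hm
  have hmu : (m : ℝ) ≤ u := Nat.floor_le hu
  have hum : u - 1 ≤ m := (Nat.sub_one_lt_floor u).le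
  have hT0 : 0 < T := (Real.exp_pos _).trans_le hT
  have hv0 : 0 ≤ ∑ p ∈ S, ‖c p‖ ^ 2 := Finset.sum_nonneg fun p _ => by positivity
  have h1 := integral_norm_dirPoly_pow_le S c m hκ hS (T := T)
    ((Real.exp_le_exp.2 (by gcongr)).trans hT)
  simp only [div_pow, intervalIntegral.integral_div]
  rw [div_le_iff₀ (by positivity)]
  refine h1.trans ?_
  rw [mul_assoc (3 * T) (Real.exp _)]
  refine mul_le_mul_of_nonneg_left ?_ (by positivity : 0 ≤ 3 * T)
  calc (m.factorial : ℝ) * (∑ p ∈ S, ‖c p‖ ^ 2) ^ m ≤ (m : ℝ) ^ m * v ^ m := by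
        gcongr
        exact_mod_cast Nat.factorial_le_pow m
    _ ≤ u ^ m * v ^ m := by have := hv0.trans hv; gcongr
    _ = (u * v / a ^ 2) ^ m * a ^ (2 * m) := by
        rw [div_pow, mul_pow, ← pow_mul]
        field_simp
    _ ≤ Real.exp (-r) ^ m * a ^ (2 * m) := by
        have : 0 ≤ v := hv0.trans hv
        gcongr
    _ ≤ Real.exp (r - r * u) * a ^ (2 * m) := by
        gcongr
        rw [← Real.exp_nat_mul, Real.exp_le_exp]
        nlinarith

/-- A truncated exponential moment of a Dirichlet polynomial over primes. -/
lemma integral_truncated_exp_dirPoly_le (N : ℕ) (hκ : 1 ≤ κ) (hX : 0 ≤ X)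
    (hS : ∀ p ∈ S, Real.log p ≤ X) (hv : ∑ p ∈ S, ‖c p‖ ^ 2 ≤ v) (hT : Real.exp (2 * N * X) ≤ T) :
    ∫ t in T..(2 * T), 4 * ∑ m ∈ Finset.range (N + 1), (2 * ‖dirPoly S c κ t‖) ^ (2 * m) / (2 * m).factorial ≤
      12 * T * (2 * N + 1) * Real.exp v := by
  have hT0 : 0 < T := (Real.exp_pos _).trans_le hT
  have hv0 : 0 ≤ ∑ p ∈ S, ‖c p‖ ^ 2 := Finset.sum_nonneg fun p _ => by positivity
  have hv1 : 0 ≤ v := hv0.trans hv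
  have hcont := continuous_dirPoly S c κ
  rw [intervalIntegral.integral_const_mul, intervalIntegral.integral_finsetSum
    (fun m _ => Continuous.intervalIntegrable (by fun_prop) _ _)]
  have h1 : ∀ m ∈ Finset.range (N + 1),
      ∫ t in T..(2 * T), (2 * ‖dirPoly S c κ t‖) ^ (2 * m) / (2 * m).factorial ≤
        3 * T * (2 * N + 1) * (v ^ m / m.factorial) := fun m hm => by
    have hmN : (m : ℝ) ≤ N := by exact_mod_cast Nat.lt_succ_iff.1 (Finset.mem_range.1 hm)
    have h2 := integral_norm_dirPoly_pow_le S c m hκ hS (T := T)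
      ((Real.exp_le_exp.2 (by gcongr)).trans hT)
    simp only [mul_pow, intervalIntegral.integral_div, intervalIntegral.integral_const_mul]
    calc _ ≤ 2 ^ (2 * m) * (3 * T * (m.factorial * v ^ m)) / (2 * m).factorial := by
          gcongr
          exact h2.trans (by gcongr)
      _ = 3 * T * v ^ m * (4 ^ m * m.factorial / (2 * m).factorial) := by
          rw [pow_mul]; norm_num; ring
      _ ≤ 3 * T * v ^ m * ((2 * m + 1) / m.factorial) := by
          have := four_pow_mul_factorial_div_le m
          gcongr
      _ ≤ 3 * T * v ^ m * ((2 * N + 1) / m.factorial) := by gcongr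
      _ = _ := by ring
  have h3 : ∑ m ∈ Finset.range (N + 1), v ^ m / m.factorial ≤ Real.exp v := Real.sum_le_exp_of_nonneg hv1 _
  calc _ ≤ 4 * ∑ m ∈ Finset.range (N + 1), 3 * T * (2 * N + 1) * (v ^ m / m.factorial) := by
        gcongr with m hm
        exact h1 m hm
    _ = 12 * T * (2 * N + 1) * ∑ m ∈ Finset.range (N + 1), v ^ m / m.factorial := by
        rw [← Finset.mul_sum]; ring
    _ ≤ _ := by gcongr

end

noncomputable section

variable {q : ℕ} [NeZero q] (ℓ : DirichletCharacter ℂ q → ℕ)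

/-- The prime part of the approximation of `log ∏ L(1/2 + it, χ)^{ℓ χ}` of length `exp (2 L)`. -/
def primePoly (L t : ℝ) : ℂ :=
  dirPoly (primesLogLE (2 * L)) (fun p => primeCoef ℓ p * primeWeight L p) 1 t

/-- The contribution of prime squares to the approximation of `log ∏ L(1/2 + it, χ)^{ℓ χ}`. -/
def primeSqPoly (L t : ℝ) : ℂ :=
  dirPoly (primesLogLE (2 * L)) (fun p => primeSqCoef ℓ p * primeSqWeight L p) 2 t

omit [NeZero q] in
lemma continuous_primePoly (L : ℝ) : Continuous (primePoly ℓ L) := continuous_dirPoly _ _ _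

omit [NeZero q] in
lemma continuous_primeSqPoly (L : ℝ) : Continuous (primeSqPoly ℓ L) := continuous_dirPoly _ _ _

lemma norm_dirPoly_le (S : Finset Nat.Primes) (c : Nat.Primes → ℂ) (κ t : ℝ) :
    ‖dirPoly S c κ t‖ ≤ ∑ p ∈ S, ‖c p‖ := by
  refine norm_sum_le_of_le _ fun p _ => ?_
  rw [norm_mul, ← Complex.ofReal_neg, Complex.norm_exp_ofReal_mul_I, mul_one]

lemma exists_log_norm_Ll_le_of_mem (hGRH : GRHmod q) : ∃ K : ℝ, 1 ≤ K ∧ ∀ T t L : ℝ, 3 ≤ T → T ≤ t → t ≤ 2 * T →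
    1 ≤ L → 4 * L ≤ Real.log T → Ll ℓ (1 / 2 + t * Complex.I) ≠ 0 →
    Real.log ‖Ll ℓ (1 / 2 + t * Complex.I)‖ ≤
      ‖primePoly ℓ L t‖ + ‖primeSqPoly ℓ L t‖ + K + K * (Real.log T / L) := by
  obtain ⟨K, hK1, hK⟩ := exists_log_norm_Ll_le ℓ hGRH
  refine ⟨2 * K, by linarith, fun T t L hT h1 h2 hL hLT hne => ?_⟩
  refine (hK t L (by linarith) hL ?_ hne).trans ?_
  · exact ((Real.le_log_iff_exp_le (by linarith)).1 hLT).trans h1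
  · have h3 : Real.log (t + 2) ≤ 2 * Real.log T := by
      rw [← Real.log_rpow (by linarith)]
      refine Real.log_le_log (by linarith) ?_
      norm_cast
      nlinarith
    have h4 : K * (Real.log (t + 2) / L) ≤ 2 * K * (Real.log T / L) := by
      calc _ ≤ K * (2 * Real.log T / L) := by gcongr
        _ = _ := by ring
    unfold primePoly primeSqPoly
    linarith

lemma exists_log_norm_Ll_le_mul_log (hGRH : GRHmod q) : ∃ K : ℝ, 0 ≤ K ∧ ∀ T t : ℝ, 3 ≤ T → 4 ≤ Real.log T →
    T ≤ t → t ≤ 2 * T → Ll ℓ (1 / 2 + t * Complex.I) ≠ 0 →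
    Real.log ‖Ll ℓ (1 / 2 + t * Complex.I)‖ ≤ K * Real.log T := by
  obtain ⟨K, hK1, hK⟩ := exists_log_norm_Ll_le_of_mem ℓ hGRH
  set M1 := ∑ p ∈ primesLogLE (2 * 1), ‖primeCoef ℓ p * primeWeight 1 p‖ with hM1
  set M2 := ∑ p ∈ primesLogLE (2 * 1), ‖primeSqCoef ℓ p * primeSqWeight 1 p‖ with hM2
  have hM10 : 0 ≤ M1 := Finset.sum_nonneg fun p _ => norm_nonneg _
  have hM20 : 0 ≤ M2 := Finset.sum_nonneg fun p _ => norm_nonneg _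
  refine ⟨M1 + M2 + 2 * K, by positivity, fun T t hT hT4 h1 h2 hne => ?_⟩
  have h3 := hK T t 1 hT h1 h2 le_rfl (by linarith) hne
  have h4 : ‖primePoly ℓ 1 t‖ ≤ M1 := norm_dirPoly_le _ _ _ _
  have h5 : ‖primeSqPoly ℓ 1 t‖ ≤ M2 := norm_dirPoly_le _ _ _ _
  rw [div_one] at h3
  nlinarith

omit [NeZero q] in
lemma norm_primeCoef_mul_primeWeight_sq_le {L : ℝ} (hL : 0 ≤ L) (p : Nat.Primes) :
    ‖primeCoef ℓ p * primeWeight L p‖ ^ 2 ≤ ‖primeCoef ℓ p‖ ^ 2 * (p : ℝ)⁻¹ := by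
  rw [norm_mul, mul_pow]
  gcongr
  exact norm_primeWeight_sq_le hL p

lemma exists_variance_primePoly_le {ε : ℝ} (hε : 0 < ε) : ∃ C : ℝ, 0 ≤ C ∧ ∀ L Y : ℝ, 1 ≤ L → 4 * L ≤ Y →
    ∑ p ∈ primesLogLE (2 * L), ‖primeCoef ℓ p * primeWeight L p‖ ^ 2 ≤
      (((∑ χ : DirichletCharacter ℂ q, (ℓ χ) ^ 2 : ℕ) : ℝ) + ε) * Real.log Y + C := by
  obtain ⟨C, hC0, hC⟩ := exists_sum_norm_primeCoef_sq_le ℓ hε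
  refine ⟨C, hC0, fun L Y hL hLY => ?_⟩
  refine (Finset.sum_le_sum fun p _ => norm_primeCoef_mul_primeWeight_sq_le ℓ (by linarith) p).trans
    ((hC (2 * L) (by linarith)).trans ?_)
  gcongr
  linarith

omit [NeZero q] in
lemma exists_variance_primePoly_tail_le {δ : ℝ} (hδ0 : 0 < δ) (hδ1 : δ ≤ 1) :
    ∃ C : ℝ, 0 ≤ C ∧ ∀ L : ℝ, 1 / δ ≤ L →
    ∑ p ∈ (primesLogLE (2 * L)).filter (fun p : Nat.Primes => δ * (2 * L) < Real.log p),
      ‖primeCoef ℓ p * primeWeight L p‖ ^ 2 ≤ C := by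
  obtain ⟨C, hC0, hC⟩ := exists_sum_prime_inv_le hδ0 hδ1
  set k : ℝ := ∑ χ : DirichletCharacter ℂ q, (ℓ χ : ℝ) with hk
  refine ⟨k ^ 2 * C, by positivity, fun L hL => ?_⟩
  have hL0 : 0 ≤ L := (by positivity : 0 ≤ 1 / δ).trans hL
  refine le_trans ?_ (mul_le_mul_of_nonneg_left (hC (2 * L) ?_) (sq_nonneg k))
  · rw [Finset.mul_sum]
    refine Finset.sum_le_sum fun p _ => (norm_primeCoef_mul_primeWeight_sq_le ℓ hL0 p).trans ?_
    gcongr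
    exact norm_primeCoef_le ℓ p
  · rw [show 2 / δ = 2 * (1 / δ) by ring]
    linarith

omit [NeZero q] in
lemma exists_variance_primeSqPoly_le : ∃ C : ℝ, 0 ≤ C ∧ ∀ L : ℝ, 0 ≤ L →
    ∑ p ∈ primesLogLE (2 * L), ‖primeSqCoef ℓ p * primeSqWeight L p‖ ^ 2 ≤ C := by
  set k : ℝ := ∑ χ : DirichletCharacter ℂ q, (ℓ χ : ℝ) with hk
  refine ⟨k ^ 2 * ∑' p : Nat.Primes, ((p : ℝ)⁻¹) ^ 2, mul_nonneg (sq_nonneg k) (tsum_nonneg fun p => by positivity),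
    fun L hL => ?_⟩
  refine le_trans ?_ (mul_le_mul_of_nonneg_left
    (summable_prime_inv_sq.sum_le_tsum (primesLogLE (2 * L)) fun p _ => by positivity) (sq_nonneg k))
  rw [Finset.mul_sum]
  refine Finset.sum_le_sum fun p _ => ?_
  rw [norm_mul, mul_pow]
  gcongr
  · exact norm_primeSqCoef_le ℓ p
  · exact norm_primeSqWeight_le hL p

omit [NeZero q] in
/-- Bound for the part of the second moment where the product has size about `exp V`. -/
lemma integral_large_le {A V T v : ℝ} (hA : 1 ≤ A) (hAV : 4 * A ≤ V) (hT : 1 ≤ T)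
    (hv1 : ∑ p ∈ primesLogLE (2 * (A * Real.log T / V)),
      ‖primeCoef ℓ p * primeWeight (A * Real.log T / V) p‖ ^ 2 ≤ v)
    (hv2 : ∑ p ∈ primesLogLE (2 * (A * Real.log T / V)),
      ‖primeSqCoef ℓ p * primeSqWeight (A * Real.log T / V) p‖ ^ 2 ≤ v)
    (hv : 4 * v ≤ A * V * Real.exp (-(12 * A))) :
    ∫ t in T..(2 * T), Real.exp (2 * V + 2) *
      ((‖primePoly ℓ (A * Real.log T / V) t‖ / (V / 4)) ^ (2 * ⌊V / (4 * A)⌋₊) +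
       (‖primeSqPoly ℓ (A * Real.log T / V) t‖ / (V / 4)) ^ (2 * ⌊V / (4 * A)⌋₊)) ≤
      6 * T * Real.exp (2 + 12 * A) * Real.exp (-V) := by
  have hA0 : 0 < A := by linarith
  have hV0 : 0 < V := by linarith
  have hlog : 0 ≤ Real.log T := Real.log_nonneg hT
  have hX : 0 ≤ 2 * (A * Real.log T / V) := by positivity
  have hexp : Real.exp (2 * (V / (4 * A)) * (2 * (A * Real.log T / V))) ≤ T := by
    rw [show 2 * (V / (4 * A)) * (2 * (A * Real.log T / V)) = Real.log T by field_simp; norm_num,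
      Real.exp_log (by linarith)]
  have huv : V / (4 * A) * v / (V / 4) ^ 2 ≤ Real.exp (-(12 * A)) := by
    rw [div_le_iff₀ (by positivity), div_mul_eq_mul_div, div_le_iff₀ (by positivity)]
    nlinarith
  have c1 := continuous_primePoly ℓ (A * Real.log T / V)
  have c2 := continuous_primeSqPoly ℓ (A * Real.log T / V)
  have h1 : ∫ t in T..(2 * T), (‖primePoly ℓ (A * Real.log T / V) t‖ / (V / 4)) ^ (2 * ⌊V / (4 * A)⌋₊) ≤
      3 * T * Real.exp (12 * A - 12 * A * (V / (4 * A))) :=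
    integral_norm_dirPoly_div_pow_le le_rfl hX (fun p hp => mem_primesLogLE.1 hp) hv1 (by positivity)
      (by positivity) (by positivity) huv hexp
  have h2 : ∫ t in T..(2 * T), (‖primeSqPoly ℓ (A * Real.log T / V) t‖ / (V / 4)) ^ (2 * ⌊V / (4 * A)⌋₊) ≤
      3 * T * Real.exp (12 * A - 12 * A * (V / (4 * A))) :=
    integral_norm_dirPoly_div_pow_le one_le_two hX (fun p hp => mem_primesLogLE.1 hp) hv2 (by positivity)
      (by positivity) (by positivity) huv hexp
  rw [intervalIntegral.integral_const_mul, intervalIntegral.integral_add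
    (Continuous.intervalIntegrable (by fun_prop) _ _) (Continuous.intervalIntegrable (by fun_prop) _ _)]
  calc _ ≤ Real.exp (2 * V + 2) * (3 * T * Real.exp (12 * A - 12 * A * (V / (4 * A))) +
        3 * T * Real.exp (12 * A - 12 * A * (V / (4 * A)))) := by gcongr
    _ = 6 * T * (Real.exp (2 * V + 2) * Real.exp (12 * A - 12 * A * (V / (4 * A)))) := by ring
    _ = _ := by
      rw [mul_assoc (6 * T), ← Real.exp_add, ← Real.exp_add]
      congr 2
      field_simp
      ring

end

noncomputable section

variable {q : ℕ} [NeZero q] (ℓ : DirichletCharacter ℂ q → ℕ)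

/-- The primes of `primePoly` with `log p ≤ 2 δ L`. -/
def lowPoly (δ L t : ℝ) : ℂ :=
  dirPoly ((primesLogLE (2 * L)).filter (fun p : Nat.Primes => ¬ δ * (2 * L) < Real.log p))
    (fun p => primeCoef ℓ p * primeWeight L p) 1 t

/-- The primes of `primePoly` with `2 δ L < log p`. -/
def highPoly (δ L t : ℝ) : ℂ :=
  dirPoly ((primesLogLE (2 * L)).filter (fun p : Nat.Primes => δ * (2 * L) < Real.log p))
    (fun p => primeCoef ℓ p * primeWeight L p) 1 t

omit [NeZero q] in
lemma continuous_lowPoly (δ L : ℝ) : Continuous (lowPoly ℓ δ L) := continuous_dirPoly _ _ _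

omit [NeZero q] in
lemma continuous_highPoly (δ L : ℝ) : Continuous (highPoly ℓ δ L) := continuous_dirPoly _ _ _

omit [NeZero q] in
lemma norm_primePoly_le (δ L t : ℝ) : ‖primePoly ℓ L t‖ ≤ ‖lowPoly ℓ δ L t‖ + ‖highPoly ℓ δ L t‖ := by
  have h : primePoly ℓ L t = lowPoly ℓ δ L t + highPoly ℓ δ L t := by
    unfold primePoly lowPoly highPoly dirPoly
    rw [add_comm, Finset.sum_filter_add_sum_filter_not]
  rw [h]
  exact norm_add_le _ _

omit [NeZero q] in
/-- Bound for the part of the second moment where the high primes or the prime squares are unusually large. -/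
lemma integral_high_le {b w δ T v : ℝ} {n : ℕ} (hw : 0 < w) (hb : 0 ≤ b) (hT : 1 ≤ T)
    (hv1 : ∑ p ∈ (primesLogLE (2 * (Real.log T / w))).filter
        (fun p : Nat.Primes => δ * (2 * (Real.log T / w)) < Real.log p),
      ‖primeCoef ℓ p * primeWeight (Real.log T / w) p‖ ^ 2 ≤ v)
    (hv2 : ∑ p ∈ primesLogLE (2 * (Real.log T / w)),
      ‖primeSqCoef ℓ p * primeSqWeight (Real.log T / w) p‖ ^ 2 ≤ v)
    (hv : v ≤ 4 * w * Real.exp (-b)) (hn : 2 * n ≤ b * w / 4 + 2) :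
    ∫ t in T..(2 * T), Real.exp (2 * n) *
      ((‖highPoly ℓ δ (Real.log T / w) t‖ / w) ^ (2 * ⌊w / 4⌋₊) +
       (‖primeSqPoly ℓ (Real.log T / w) t‖ / w) ^ (2 * ⌊w / 4⌋₊)) ≤
      6 * T * Real.exp (2 + b) := by
  have hlog : 0 ≤ Real.log T := Real.log_nonneg hT
  have hX : 0 ≤ 2 * (Real.log T / w) := by positivity
  have hexp : Real.exp (2 * (w / 4) * (2 * (Real.log T / w))) ≤ T := by
    rw [show 2 * (w / 4) * (2 * (Real.log T / w)) = Real.log T by field_simp; norm_num,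
      Real.exp_log (by linarith)]
  have huv : w / 4 * v / w ^ 2 ≤ Real.exp (-b) := by
    rw [div_le_iff₀ (by positivity)]
    nlinarith
  have c1 := continuous_highPoly ℓ δ (Real.log T / w)
  have c2 := continuous_primeSqPoly ℓ (Real.log T / w)
  have h1 : ∫ t in T..(2 * T), (‖highPoly ℓ δ (Real.log T / w) t‖ / w) ^ (2 * ⌊w / 4⌋₊) ≤
      3 * T * Real.exp (b - b * (w / 4)) :=
    integral_norm_dirPoly_div_pow_le le_rfl hX (fun p hp => mem_primesLogLE.1 (Finset.mem_filter.1 hp).1) hv1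
      (by positivity) (by positivity) (by positivity) huv hexp
  have h2 : ∫ t in T..(2 * T), (‖primeSqPoly ℓ (Real.log T / w) t‖ / w) ^ (2 * ⌊w / 4⌋₊) ≤
      3 * T * Real.exp (b - b * (w / 4)) :=
    integral_norm_dirPoly_div_pow_le one_le_two hX (fun p hp => mem_primesLogLE.1 hp) hv2 (by positivity)
      (by positivity) (by positivity) huv hexp
  rw [intervalIntegral.integral_const_mul, intervalIntegral.integral_add
    (Continuous.intervalIntegrable (by fun_prop) _ _) (Continuous.intervalIntegrable (by fun_prop) _ _)]
  calc _ ≤ Real.exp (2 * n) * (3 * T * Real.exp (b - b * (w / 4)) + 3 * T * Real.exp (b - b * (w / 4))) := by gcongr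
    _ = 6 * T * (Real.exp (2 * n) * Real.exp (b - b * (w / 4))) := by ring
    _ ≤ _ := by
      rw [← Real.exp_add]
      exact mul_le_mul_of_nonneg_left (Real.exp_le_exp.2 (by linarith)) (by positivity)

omit [NeZero q] in
/-- Bound for the main part of the second moment. -/
lemma integral_low_le {w δ T v E : ℝ} {n : ℕ} (hw : 0 < w) (hδ : 0 ≤ δ) (hT : 1 ≤ T)
    (hv : ∑ p ∈ primesLogLE (2 * (Real.log T / w)),
      ‖primeCoef ℓ p * primeWeight (Real.log T / w) p‖ ^ 2 ≤ v)
    (hn : 8 * n * δ ≤ w) :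
    ∫ t in T..(2 * T), Real.exp (2 * E) * (4 * ∑ m ∈ Finset.range (2 * n + 1),
      (2 * ‖lowPoly ℓ δ (Real.log T / w) t‖) ^ (2 * m) / (2 * m).factorial) ≤
      12 * T * (4 * n + 1) * Real.exp (2 * E + v) := by
  have hlog : 0 ≤ Real.log T := Real.log_nonneg hT
  have hX : 0 ≤ δ * (2 * (Real.log T / w)) := by positivity
  have hexp : Real.exp (2 * (2 * n : ℕ) * (δ * (2 * (Real.log T / w)))) ≤ T := by
    rw [← Real.le_log_iff_exp_le (by linarith)]
    push_cast
    calc _ = 8 * n * δ * (Real.log T / w) := by ring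
      _ ≤ w * (Real.log T / w) := by gcongr
      _ = _ := by field_simp
  have h1 := integral_truncated_exp_dirPoly_le (κ := 1) (T := T) (v := v) (2 * n) le_rfl hX
    (S := (primesLogLE (2 * (Real.log T / w))).filter
      (fun p : Nat.Primes => ¬ δ * (2 * (Real.log T / w)) < Real.log p))
    (c := fun p => primeCoef ℓ p * primeWeight (Real.log T / w) p)
    (fun p hp => not_lt.1 (Finset.mem_filter.1 hp).2)
    ((Finset.sum_le_sum_of_subset_of_nonneg (Finset.filter_subset _ _) fun p _ _ => by positivity).trans hv) hexp
  rw [intervalIntegral.integral_const_mul]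
  calc _ ≤ Real.exp (2 * E) * (12 * T * (2 * (2 * n : ℕ) + 1) * Real.exp v) := by
        gcongr
        exact h1
    _ = _ := by
      rw [Real.exp_add]
      push_cast
      ring

lemma one_le_div_pow_add {a x y : ℝ} (ha : 0 < a) (hx : 0 ≤ x) (hy : 0 ≤ y) (h : a ≤ x ∨ a ≤ y) (m : ℕ) :
    1 ≤ (x / a) ^ m + (y / a) ^ m := by
  have hx' : 0 ≤ (x / a) ^ m := by positivity
  have hy' : 0 ≤ (y / a) ^ m := by positivity
  rcases h with h | h
  · linarith [one_le_pow₀ (n := m) ((one_le_div ha).2 h)]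
  · linarith [one_le_pow₀ (n := m) ((one_le_div ha).2 h)]

omit [NeZero q] in
/-- The decomposition of the square of a quantity whose logarithm is controlled by prime sums. -/
lemma sq_le_large_add_high_add_low {A K Y w δ t f : ℝ} {n : ℕ} (hK : 1 ≤ K) (hA : 8 * K ≤ A) (hn : 4 * A ≤ n)
    (hw : 4 ≤ w) (hwY : w ≤ Y) (hf0 : 0 ≤ f)
    (hf : ∀ L : ℝ, 1 ≤ L → 4 * L ≤ Y → f ≠ 0 →
      Real.log f ≤ ‖primePoly ℓ L t‖ + ‖primeSqPoly ℓ L t‖ + K + K * (Y / L))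
    (hf' : f ≠ 0 → Real.log f ≤ A * Y) :
    f ^ 2 ≤ ∑ V ∈ Finset.Ico n (⌊A * Y⌋₊ + 1), Real.exp (2 * V + 2) *
        ((‖primePoly ℓ (A * Y / V) t‖ / (V / 4)) ^ (2 * ⌊(V : ℝ) / (4 * A)⌋₊) +
         (‖primeSqPoly ℓ (A * Y / V) t‖ / (V / 4)) ^ (2 * ⌊(V : ℝ) / (4 * A)⌋₊)) +
      Real.exp (2 * n) *
        ((‖highPoly ℓ δ (Y / w) t‖ / w) ^ (2 * ⌊w / 4⌋₊) + (‖primeSqPoly ℓ (Y / w) t‖ / w) ^ (2 * ⌊w / 4⌋₊)) +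
      Real.exp (2 * (2 * w + K + K * w)) * (4 * ∑ m ∈ Finset.range (2 * n + 1),
        (2 * ‖lowPoly ℓ δ (Y / w) t‖) ^ (2 * m) / (2 * m).factorial) := by
  have hw0 : 0 < w := by linarith
  have hA0 : 0 < A := by linarith
  have hY0 : 0 < Y := by linarith
  set GA : ℕ → ℝ := fun V => Real.exp (2 * V + 2) *
        ((‖primePoly ℓ (A * Y / V) t‖ / (V / 4)) ^ (2 * ⌊(V : ℝ) / (4 * A)⌋₊) +
         (‖primeSqPoly ℓ (A * Y / V) t‖ / (V / 4)) ^ (2 * ⌊(V : ℝ) / (4 * A)⌋₊)) with hGA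
  set GB : ℝ := Real.exp (2 * n) *
        ((‖highPoly ℓ δ (Y / w) t‖ / w) ^ (2 * ⌊w / 4⌋₊) + (‖primeSqPoly ℓ (Y / w) t‖ / w) ^ (2 * ⌊w / 4⌋₊)) with hGB
  set GC : ℝ := Real.exp (2 * (2 * w + K + K * w)) * (4 * ∑ m ∈ Finset.range (2 * n + 1),
        (2 * ‖lowPoly ℓ δ (Y / w) t‖) ^ (2 * m) / (2 * m).factorial) with hGC
  have hGA0 : ∀ V, 0 ≤ GA V := fun V => by positivity
  have hGAs : 0 ≤ ∑ V ∈ Finset.Ico n (⌊A * Y⌋₊ + 1), GA V := Finset.sum_nonneg fun V _ => hGA0 V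
  have hGB0 : 0 ≤ GB := by positivity
  have hGC0 : 0 ≤ GC := by positivity
  rcases eq_or_ne f 0 with h0 | h0
  · rw [h0, zero_pow two_ne_zero]
    linarith
  have hfexp : f ^ 2 = Real.exp (2 * Real.log f) := by
    rw [mul_comm, Real.exp_mul, Real.exp_log (hf0.lt_of_ne' h0)]
    norm_cast
  set l := Real.log f with hl
  rw [hfexp]
  rcases le_or_gt (n : ℝ) l with hnl | hnl
  · have hl0 : 0 ≤ l := (Nat.cast_nonneg n).trans hnl
    set V := ⌊l⌋₊ with hV
    have hVl : (V : ℝ) ≤ l := Nat.floor_le hl0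
    have hlV : l < V + 1 := Nat.lt_floor_add_one l
    have hnV : n ≤ V := Nat.le_floor hnl
    have hAV : 4 * A ≤ V := hn.trans (by exact_mod_cast hnV)
    have hV0 : (0 : ℝ) < V := by linarith
    have hmem : V ∈ Finset.Ico n (⌊A * Y⌋₊ + 1) :=
      Finset.mem_Ico.2 ⟨hnV, Nat.lt_succ_of_le (Nat.floor_le_floor (hf' h0))⟩
    have h1 := hf (A * Y / V) (by rw [le_div_iff₀ hV0]; linarith [hf' h0])
      (by rw [← mul_div_assoc, div_le_iff₀ hV0]; nlinarith) h0
    have h2 : K * (Y / (A * Y / V)) ≤ V / 8 := by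
      rw [show K * (Y / (A * Y / V)) = K * V / A by field_simp, div_le_iff₀ hA0]
      nlinarith
    have h3 : GA V ≤ ∑ V ∈ Finset.Ico n (⌊A * Y⌋₊ + 1), GA V :=
      Finset.single_le_sum (f := GA) (fun V _ => hGA0 V) hmem
    have h4 : Real.exp (2 * l) ≤ GA V := by
      refine (Real.exp_le_exp.2 (by linarith : 2 * l ≤ 2 * V + 2)).trans
        (le_mul_of_one_le_right (Real.exp_pos _).le ?_)
      refine one_le_div_pow_add (by positivity) (norm_nonneg _) (norm_nonneg _) ?_ _
      by_contra! hcon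
      linarith [hcon.1, hcon.2]
    linarith
  · have h1 := hf (Y / w) ((one_le_div hw0).2 hwY) (by rw [← mul_div_assoc, div_le_iff₀ hw0]; nlinarith) h0
    rw [show Y / (Y / w) = w by field_simp] at h1
    have h2 := norm_primePoly_le ℓ δ (Y / w) t
    by_cases hbig : w ≤ ‖highPoly ℓ δ (Y / w) t‖ ∨ w ≤ ‖primeSqPoly ℓ (Y / w) t‖
    · have h3 : Real.exp (2 * l) ≤ GB :=
        (Real.exp_le_exp.2 (by linarith)).trans (le_mul_of_one_le_right (Real.exp_pos _).le
          (one_le_div_pow_add hw0 (norm_nonneg _) (norm_nonneg _) hbig _))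
      linarith
    · push Not at hbig
      set y := min (2 * ‖lowPoly ℓ δ (Y / w) t‖) (2 * n : ℕ) with hy
      have hy0 : 0 ≤ y := by positivity
      have h3 : 2 * l ≤ 2 * (2 * w + K + K * w) + y := by
        have h5 : 0 ≤ K * w := by positivity
        rw [← sub_le_iff_le_add', hy, le_min_iff]
        push_cast
        constructor <;> linarith [hbig.1, hbig.2]
      have h4 : Real.exp (2 * l) ≤ GC := by
        refine (Real.exp_le_exp.2 h3).trans ?_
        rw [Real.exp_add]
        refine mul_le_mul_of_nonneg_left ((exp_le_four_mul_sum_pow_div_factorial hy0 (min_le_right _ _)).trans ?_)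
          (Real.exp_pos _).le
        gcongr
        exact min_le_left _ _
      linarith

end

noncomputable section

lemma sum_exp_neg_nat_le (s : Finset ℕ) : ∑ V ∈ s, Real.exp (-(V : ℝ)) ≤ 2 := by
  refine le_trans (Finset.sum_le_sum fun V _ => ?_)
    (sum_le_hasSum s (fun V _ => by positivity) hasSum_geometric_two)
  rw [← mul_neg_one, Real.exp_nat_mul]
  gcongr
  rw [Real.exp_neg, one_div]
  gcongr
  linarith [Real.add_one_le_exp (1 : ℝ)]

/-- The second moment over `[T, 2T]` in terms of the variances of the approximating prime sums. -/
lemma integral_norm_Ll_sq_le {q : ℕ} [NeZero q] (ℓ : DirichletCharacter ℂ q → ℕ) {A K T w δ b v v₁ : ℝ} {n : ℕ}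
    (hK1 : 1 ≤ K) (hA : 8 * K ≤ A) (hn4 : 4 * A ≤ n) (hw4 : 4 ≤ w) (hwT : w ≤ Real.log T) (hT : 1 ≤ T)
    (hδ : 0 ≤ δ) (hb : 0 ≤ b)
    (hf : ∀ t ∈ Set.Icc T (2 * T), ∀ L : ℝ, 1 ≤ L → 4 * L ≤ Real.log T → Ll ℓ (1 / 2 + t * Complex.I) ≠ 0 →
      Real.log ‖Ll ℓ (1 / 2 + t * Complex.I)‖ ≤
        ‖primePoly ℓ L t‖ + ‖primeSqPoly ℓ L t‖ + K + K * (Real.log T / L))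
    (hf' : ∀ t ∈ Set.Icc T (2 * T), Ll ℓ (1 / 2 + t * Complex.I) ≠ 0 →
      Real.log ‖Ll ℓ (1 / 2 + t * Complex.I)‖ ≤ A * Real.log T)
    (hv : ∀ L : ℝ, 1 ≤ L → 4 * L ≤ Real.log T →
      ∑ p ∈ primesLogLE (2 * L), ‖primeCoef ℓ p * primeWeight L p‖ ^ 2 ≤ v)
    (hv_tail : ∑ p ∈ (primesLogLE (2 * (Real.log T / w))).filter
        (fun p : Nat.Primes => δ * (2 * (Real.log T / w)) < Real.log p),
      ‖primeCoef ℓ p * primeWeight (Real.log T / w) p‖ ^ 2 ≤ v₁)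
    (hv_sq : ∀ L : ℝ, 0 ≤ L → ∑ p ∈ primesLogLE (2 * L), ‖primeSqCoef ℓ p * primeSqWeight L p‖ ^ 2 ≤ v₁)
    (hvA : 4 * (v + v₁) ≤ n * Real.exp (-(12 * A))) (hvb : v₁ ≤ 4 * w * Real.exp (-b))
    (hnb : 2 * n ≤ b * w / 4 + 2) (hnδ : 8 * n * δ ≤ w) :
    ∫ t in T..(2 * T), ‖Ll ℓ (1 / 2 + t * Complex.I)‖ ^ 2 ≤
      12 * T * Real.exp (2 + 12 * A) + 6 * T * Real.exp (2 + b) +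
        12 * T * (4 * n + 1) * Real.exp (2 * (2 * w + K + K * w) + v) := by
  have hA1 : 1 ≤ A := by linarith
  have hw0 : 0 < w := by linarith
  have hY0 : 0 < Real.log T := by linarith
  have hL1 : 1 ≤ Real.log T / w := (one_le_div hw0).2 hwT
  have hL4 : 4 * (Real.log T / w) ≤ Real.log T := by
    rw [← mul_div_assoc, div_le_iff₀ hw0]
    nlinarith
  have hv0 : 0 ≤ v := (Finset.sum_nonneg fun p _ => by positivity).trans (hv _ hL1 hL4)
  have hv₁0 : 0 ≤ v₁ := (Finset.sum_nonneg fun p _ => by positivity).trans hv_tail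
  have hlarge : ∀ V ∈ Finset.Ico n (⌊A * Real.log T⌋₊ + 1), ∫ t in T..(2 * T), Real.exp (2 * V + 2) *
      ((‖primePoly ℓ (A * Real.log T / V) t‖ / (V / 4)) ^ (2 * ⌊(V : ℝ) / (4 * A)⌋₊) +
       (‖primeSqPoly ℓ (A * Real.log T / V) t‖ / (V / 4)) ^ (2 * ⌊(V : ℝ) / (4 * A)⌋₊)) ≤
      6 * T * Real.exp (2 + 12 * A) * Real.exp (-(V : ℝ)) := fun V hV => by
    obtain ⟨h1, h2⟩ := Finset.mem_Ico.1 hV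
    have hnV : (n : ℝ) ≤ V := by exact_mod_cast h1
    have hV0 : (0 : ℝ) < V := by linarith
    have hVY : (V : ℝ) ≤ A * Real.log T := (Nat.le_floor_iff (by positivity)).1 (Nat.lt_succ_iff.1 h2)
    have h3 : 1 ≤ A * Real.log T / V := (one_le_div hV0).2 hVY
    have h4 : 4 * (A * Real.log T / V) ≤ Real.log T := by
      rw [← mul_div_assoc, div_le_iff₀ hV0]
      nlinarith
    refine integral_large_le ℓ (v := v + v₁) hA1 (by linarith) hT ((hv _ h3 h4).trans (by linarith))
      ((hv_sq _ (by linarith)).trans (by linarith)) (hvA.trans ?_)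
    gcongr
    nlinarith
  have hhigh := integral_high_le ℓ hw0 hb hT hv_tail (hv_sq _ (by linarith)) hvb hnb
  have hlow := integral_low_le ℓ (E := 2 * w + K + K * w) hw0 hδ hT (hv _ hL1 hL4) hnδ
  have hpt : ∀ t ∈ Set.Icc T (2 * T), _ := fun t ht =>
    sq_le_large_add_high_add_low ℓ (w := w) (δ := δ) hK1 hA hn4 hw4 hwT
      (norm_nonneg (Ll ℓ (1 / 2 + t * Complex.I)))
      (fun L h1 h2 h3 => hf t ht L h1 h2 (norm_ne_zero_iff.1 h3)) (fun h3 => hf' t ht (norm_ne_zero_iff.1 h3))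
  have cL := continuous_Ll_line ℓ
  have c1 := continuous_primePoly ℓ
  have c2 := continuous_primeSqPoly ℓ
  have c3 := continuous_lowPoly ℓ δ (Real.log T / w)
  have c4 := continuous_highPoly ℓ δ (Real.log T / w)
  refine (intervalIntegral.integral_mono_on (μ := volume) (by linarith : T ≤ 2 * T)
    (Continuous.intervalIntegrable (by fun_prop) _ _) (Continuous.intervalIntegrable (by fun_prop) _ _) hpt).trans ?_
  rw [intervalIntegral.integral_add (Continuous.intervalIntegrable (by fun_prop) _ _)
      (Continuous.intervalIntegrable (by fun_prop) _ _),
    intervalIntegral.integral_add (Continuous.intervalIntegrable (by fun_prop) _ _)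
      (Continuous.intervalIntegrable (by fun_prop) _ _),
    intervalIntegral.integral_finsetSum (fun V _ => Continuous.intervalIntegrable (by fun_prop) _ _)]
  have hlargesum := (Finset.sum_le_sum hlarge).trans_eq (Finset.mul_sum _ _ _).symm
  have hsum2 := sum_exp_neg_nat_le (Finset.Ico n (⌊A * Real.log T⌋₊ + 1))
  refine add_le_add (add_le_add (hlargesum.trans ?_) hhigh) hlow
  calc _ ≤ 6 * T * Real.exp (2 + 12 * A) * 2 := by gcongr
    _ = _ := by ring

/-- The numerical conditions under which `integral_norm_Ll_sq_le` is applied, for a large parameter `W`. -/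
lemma eventually_parameter_bounds {A B C η δ b ε K : ℝ} (hB : 1 ≤ B) (hη0 : 0 < η) (hδ : δ = η / (16 * B))
    (hb : b = 16 * B / η) (hηε : (5 + 2 * K) * η ≤ ε) :
    ∀ᶠ W in atTop, 1 ≤ W ∧ 4 * A ≤ (⌈B * W⌉₊ : ℝ) ∧ 4 ≤ η * W ∧ 1 / δ ≤ Real.exp W / (η * W) ∧
      C ≤ 4 * (η * W) * Real.exp (-b) ∧ 2 * (⌈B * W⌉₊ : ℝ) ≤ b * (η * W) / 4 + 2 ∧
      8 * (⌈B * W⌉₊ : ℝ) * δ ≤ η * W ∧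
      ∀ μ C' : ℝ, (4 * (⌈B * W⌉₊ : ℝ) + 1) *
        Real.exp (2 * (2 * (η * W) + K + K * (η * W)) + ((μ + ε) * W + C')) ≤
          Real.exp (2 * K + C') * Real.exp ((μ + 2 * ε) * W) := by
  have hδ0 : 0 < δ := by rw [hδ]; positivity
  filter_upwards [eventually_ge_atTop 2, eventually_ge_atTop (4 * A), eventually_ge_atTop (4 / η),
    eventually_ge_atTop (2 * (η / δ)), eventually_ge_atTop (C / (4 * η * Real.exp (-b))),
    eventually_ge_atTop (18 * B / η ^ 2)] with W hW2 hWA hWη hWδ hWC hWB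
  have hW0 : 0 < W := by linarith
  have hw0 : 0 < η * W := by positivity
  have hnB : B * W ≤ (⌈B * W⌉₊ : ℝ) := Nat.le_ceil _
  have hnB' : (⌈B * W⌉₊ : ℝ) ≤ B * W + 1 := (Nat.ceil_lt_add_one (by positivity)).le
  have hWBW : W ≤ B * W := le_mul_of_one_le_left hW0.le hB
  have hquad : ∀ x : ℝ, 0 ≤ x → x ^ 2 / 2 ≤ Real.exp x := fun x hx => by
    linarith [Real.quadratic_le_exp_of_nonneg hx]
  rw [div_le_iff₀ hη0] at hWη
  refine ⟨by linarith, by linarith, by linarith, ?_, ?_, ?_, ?_, fun μ C' => ?_⟩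
  · rw [div_le_div_iff₀ hδ0 hw0, one_mul]
    calc η * W = η / δ * W * δ := by field_simp
      _ ≤ W ^ 2 / 2 * δ := by gcongr; nlinarith
      _ ≤ _ := by gcongr; exact hquad W hW0.le
  · rw [div_le_iff₀ (by positivity)] at hWC
    linarith
  · have : b * (η * W) / 4 = 4 * (B * W) := by rw [hb]; field_simp; norm_num
    linarith
  · calc 8 * (⌈B * W⌉₊ : ℝ) * δ ≤ 8 * (2 * (B * W)) * δ := by gcongr; linarith
      _ = η * W := by rw [hδ]; field_simp; norm_num
  · have hnw : 4 * (⌈B * W⌉₊ : ℝ) + 1 ≤ Real.exp (η * W) := by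
      refine le_trans ?_ (hquad _ hw0.le)
      rw [div_le_iff₀ (by positivity)] at hWB
      have h1 : 9 * B * W ≤ (η * W) ^ 2 / 2 := by
        rw [mul_pow]
        nlinarith
      linarith
    refine (mul_le_mul_of_nonneg_right hnw (Real.exp_pos _).le).trans ?_
    rw [← Real.exp_add, ← Real.exp_add, Real.exp_le_exp]
    have := mul_le_mul_of_nonneg_right hηε hW0.le
    linarith

theorem exists_integral_norm_Ll_sq_le {q : ℕ} [NeZero q] (hGRH : GRHmod q) (ℓ : DirichletCharacter ℂ q → ℕ)
    {ε : ℝ} (hε : 0 < ε) :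
    ∃ C T₀ : ℝ, ∀ T : ℝ, T₀ ≤ T →
      (∫ t in T..(2*T), ‖Ll ℓ (1/2 + t * Complex.I)‖ ^ 2)
        ≤ C * T * Real.log T ^ (((∑ χ : DirichletCharacter ℂ q, (ℓ χ) ^ 2 : ℕ) : ℝ) + ε) := by
  obtain ⟨K, hK1, hK⟩ := exists_log_norm_Ll_le_of_mem ℓ hGRH
  obtain ⟨K', hK'0, hK'⟩ := exists_log_norm_Ll_le_mul_log ℓ hGRH
  obtain ⟨C₁, hC₁0, hC₁⟩ := exists_variance_primePoly_le ℓ (half_pos hε)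
  obtain ⟨C₃, hC₃0, hC₃⟩ := exists_variance_primeSqPoly_le ℓ
  generalize hlam : ((∑ χ : DirichletCharacter ℂ q, (ℓ χ) ^ 2 : ℕ) : ℝ) = lam at *
  have hlam0 : 0 ≤ lam := hlam ▸ Nat.cast_nonneg _
  obtain ⟨A, hA⟩ : ∃ A, A = 8 * K + K' := ⟨_, rfl⟩
  obtain ⟨η, hη0, hη1, hηε⟩ : ∃ η : ℝ, 0 < η ∧ η ≤ 1 ∧ (5 + 2 * K) * η ≤ ε / 2 := by
    refine ⟨min 1 (ε / (2 * (5 + 2 * K))), by positivity, min_le_left _ _, ?_⟩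
    have h := min_le_right 1 (ε / (2 * (5 + 2 * K)))
    rw [le_div_iff₀ (by positivity)] at h
    linarith
  obtain ⟨B, hB⟩ : ∃ B, B = 4 * (lam + ε / 2 + 1) * Real.exp (12 * A) := ⟨_, rfl⟩
  have hB1 : 1 ≤ B := by
    have h1 : 1 ≤ Real.exp (12 * A) := Real.one_le_exp (by linarith)
    have h2 : 1 ≤ 4 * (lam + ε / 2 + 1) := by linarith
    rw [hB]
    nlinarith
  obtain ⟨δ, hδ⟩ : ∃ δ, δ = η / (16 * B) := ⟨_, rfl⟩
  have hδ0 : 0 < δ := by rw [hδ]; positivity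
  have hδ1 : δ ≤ 1 := by
    rw [hδ, div_le_one (by positivity)]
    linarith
  obtain ⟨b, hb⟩ : ∃ b, b = 16 * B / η := ⟨_, rfl⟩
  have hb0 : 0 ≤ b := by rw [hb]; positivity
  obtain ⟨C₂, hC₂0, hC₂⟩ := exists_variance_primePoly_tail_le ℓ hδ0 hδ1
  have htend : Tendsto (fun T : ℝ => Real.log (Real.log T)) atTop atTop :=
    Real.tendsto_log_atTop.comp Real.tendsto_log_atTop
  obtain ⟨T₀, hT₀⟩ := eventually_atTop.1 ((eventually_ge_atTop 3).and
    ((Real.tendsto_log_atTop.eventually_ge_atTop 4).and ((htend.eventually_ge_atTop (C₁ + (C₂ + C₃))).and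
      (htend.eventually (eventually_parameter_bounds (A := A) (C := C₂ + C₃) hB1 hη0 hδ hb hηε)))))
  refine ⟨12 * Real.exp (2 + 12 * A) + 6 * Real.exp (2 + b) + 12 * Real.exp (2 * K + C₁), T₀, fun T hT => ?_⟩
  obtain ⟨hT3, hY4, hWC, hW1, hWA, hWη, hWδ, hWb, hWn, hWnδ, hmain⟩ := hT₀ T hT
  have hmain := hmain lam C₁
  have hT0 : 0 < T := by linarith
  have hY0 : 0 < Real.log T := by linarith
  have hpow1 : 1 ≤ Real.log T ^ (lam + ε) := Real.one_le_rpow (by linarith) (by positivity)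
  rw [Real.exp_log hY0] at hWδ
  rw [mul_div_cancel₀ ε two_ne_zero, mul_comm (lam + ε), ← Real.rpow_def_of_pos hY0] at hmain
  have hwT : η * Real.log (Real.log T) ≤ Real.log T :=
    (one_le_div (by linarith)).1 (((one_le_div hδ0).2 hδ1).trans hWδ)
  refine (integral_norm_Ll_sq_le ℓ (A := A) (b := b) (v := (lam + ε / 2) * Real.log (Real.log T) + C₁)
    (v₁ := C₂ + C₃) hK1 (by linarith) hWA hWη hwT (by linarith) hδ0.le hb0
    (fun t ht L h1 h2 h3 => hK T t L hT3 ht.1 ht.2 h1 h2 h3)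
    (fun t ht h3 => (hK' T t hT3 hY4 ht.1 ht.2 h3).trans (by gcongr; linarith))
    (fun L h1 h2 => hC₁ L _ h1 h2) ((hC₂ _ hWδ).trans (by linarith)) (fun L hL => (hC₃ L hL).trans (by linarith))
    ?_ hWb hWn hWnδ).trans ?_
  · calc _ ≤ 4 * ((lam + ε / 2 + 1) * Real.log (Real.log T)) := by linarith
      _ = B * Real.log (Real.log T) * Real.exp (-(12 * A)) := by rw [hB, Real.exp_neg]; field_simp
      _ ≤ _ := by gcongr; exact Nat.le_ceil _
  · have h1 := mul_le_mul_of_nonneg_left hmain (by positivity : 0 ≤ 12 * T)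
    have h2 := mul_le_mul_of_nonneg_left hpow1
      (by positivity : 0 ≤ (12 * Real.exp (2 + 12 * A) + 6 * Real.exp (2 + b)) * T)
    rw [← mul_assoc] at h1
    linarith

lemma sum_sq_add_one_le {ι : Type*} [Fintype ι] [DecidableEq ι] [Nonempty ι] {k : ℕ} {ℓ : ι → ℕ} (hk : ∑ i, ℓ i = k)
    (h : ∀ i, ℓ ≠ fun j => if j = i then k else 0) : ∑ i, ℓ i ^ 2 + 1 ≤ k ^ 2 := by
  have hle : ∀ i, ℓ i ≤ k := fun i => hk ▸ Finset.single_le_sum (fun _ _ => Nat.zero_le _) (Finset.mem_univ i)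
  rw [Nat.add_one_le_iff, sq k]
  nth_rewrite 1 [← hk]
  rw [Finset.sum_mul]
  refine Finset.sum_lt_sum (fun i _ => by rw [sq]; exact Nat.mul_le_mul_left _ (hle i)) ?_
  by_contra! hcon
  have h1 : ∀ i, ℓ i = 0 ∨ ℓ i = k := fun i => by
    rcases Nat.eq_zero_or_pos (ℓ i) with h0 | h0
    · exact .inl h0
    · have h2 := hcon i (Finset.mem_univ i)
      rw [sq] at h2
      exact .inr ((hle i).antisymm (Nat.le_of_mul_le_mul_left h2 h0))
  obtain ⟨i, hi⟩ : ∃ i, ℓ i = k := by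
    by_contra! hne
    have h0 : ∀ i, ℓ i = 0 := fun i => (h1 i).resolve_right (hne i)
    obtain ⟨i⟩ := ‹Nonempty ι›
    refine hne i ?_
    rw [← hk, Finset.sum_eq_zero fun j _ => h0 j, h0]
  refine h i (funext fun j => ?_)
  split_ifs with hj
  · rw [hj, hi]
  · have h2 := Finset.add_le_sum (fun _ _ => Nat.zero_le _) (Finset.mem_univ i) (Finset.mem_univ j) (Ne.symm hj) (f := ℓ)
    omega

end

/-- On GRH mod `q`: `∫_T^{2T} |𝓛^ℓ(1/2+it)|² dt ≪_{q,k,ε} T (log T)^{λ(ℓ)+ε}`;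
and if `ℓ ≠ k·δ^χ` for every `χ`, then `∫_T^{2T} |𝓛^ℓ(1/2+it)|² dt ≪_{q,k,ε} T (log T)^{k²−1+ε}`. -/
theorem L_product_mean_square_upper (q k : ℕ) [NeZero q] (hGRH : GRHmod q)
    (ℓ : DirichletCharacter ℂ q → ℕ) (hk : ∑ χ : DirichletCharacter ℂ q, ℓ χ = k)
    (ε : ℝ) (hε : 0 < ε) :
    (∃ C T₀ : ℝ, ∀ T : ℝ, T₀ ≤ T →
      (∫ t in T..(2*T), ‖Ll ℓ (1/2 + t * Complex.I)‖ ^ 2)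
        ≤ C * T * Real.log T ^ (((∑ χ : DirichletCharacter ℂ q, (ℓ χ) ^ 2 : ℕ) : ℝ) + ε)) ∧
    ((∀ χ : DirichletCharacter ℂ q, ℓ ≠ fun ν => if ν = χ then k else 0) →
      ∃ C T₀ : ℝ, ∀ T : ℝ, T₀ ≤ T →
        (∫ t in T..(2*T), ‖Ll ℓ (1/2 + t * Complex.I)‖ ^ 2)
          ≤ C * T * Real.log T ^ ((k : ℝ) ^ 2 - 1 + ε)) := by
  obtain ⟨C, T₀, h⟩ := exists_integral_norm_Ll_sq_le hGRH ℓ hε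
  refine ⟨⟨C, T₀, h⟩, fun hℓ => ⟨|C|, max T₀ 3, fun T hT => ?_⟩⟩
  obtain ⟨hT₀, hT3⟩ := max_le_iff.1 hT
  have hlog : 1 ≤ Real.log T := by
    rw [Real.le_log_iff_exp_le (by linarith)]
    exact (Real.exp_one_lt_d9.le.trans (by norm_num)).trans hT3
  have hsq : ((∑ χ : DirichletCharacter ℂ q, (ℓ χ) ^ 2 : ℕ) : ℝ) + 1 ≤ (k : ℝ) ^ 2 := by
    exact_mod_cast sum_sq_add_one_le hk hℓ
  refine (h T hT₀).trans ?_
  exact mul_le_mul (mul_le_mul_of_nonneg_right (le_abs_self C) (by linarith))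
    (Real.rpow_le_rpow_of_exponent_le hlog (by linarith)) (by positivity) (by positivity)
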